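/- Assume the Riemann Hypothesis. Then E_M(x) ≪ (log x)², i.e. there is a constant C > 0 such that |E_M(x)| ≤ C (log x)² for all x ≥ 5. -/

import Mathlib

open Filter Real Set

/-- The Mertens product `∏_{p ≤ x} (1 - 1/p)⁻¹`. -/
noncomputable def mertensProd (x : ℝ) : ℝ :=
  ∏ p ∈ Finset.filter Nat.Prime (Finset.Iic ⌊x⌋₊), ((1 : ℝ) - 1 / p)⁻¹

/-- `E_M(x) = √x log x (log ∏_{p≤x}(1-1/p)⁻¹ - log log x - γ)`. -/
noncomputable def EM (x : ℝ) : ℝ :=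
  Real.sqrt x * Real.log x *
    (Real.log (mertensProd x) - Real.log (Real.log x) - Real.eulerMascheroniConstant)

/-- A nonvanishing holomorphic function on a disc has a holomorphic logarithm there. -/
theorem exists_log_of_ne_zero_on_ball {G : ℂ → ℂ} {c : ℂ} {R : ℝ} (hR : 0 < R)
    (hG : DifferentiableOn ℂ G (Metric.ball c R)) (h0 : ∀ z ∈ Metric.ball c R, G z ≠ 0) :
    ∃ L : ℂ → ℂ, L c = 0 ∧ ∀ z ∈ Metric.ball c R,
      HasDerivAt L (logDeriv G z) z ∧ G z = G c * Complex.exp (L z) := by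
  have hd : DifferentiableOn ℂ (logDeriv G) (Metric.ball c R) :=
    (hG.deriv Metric.isOpen_ball).div hG h0
  obtain ⟨L, hL⟩ := hd.isExactOn_ball
  have hc : c ∈ Metric.ball c R := Metric.mem_ball_self hR
  refine ⟨fun z => L z - L c, sub_self _, fun z hz => ⟨(hL z hz).sub_const _, ?_⟩⟩
  have key : ∀ w ∈ Metric.ball c R, HasDerivAt (fun z => G z * Complex.exp (-(L z - L c))) 0 w := by
    intro w hw
    have h1 : HasDerivAt G (deriv G w) w :=
      (hG.differentiableAt (Metric.isOpen_ball.mem_nhds hw)).hasDerivAt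
    have h2 := h1.mul (((hL w hw).sub_const (L c)).neg.cexp)
    refine h2.congr_deriv ?_
    have := h0 w hw
    rw [logDeriv_apply]
    field_simp
    simp
  have hconst := (convex_ball c R).is_const_of_fderivWithin_eq_zero (𝕜 := ℂ)
    (f := fun z => G z * Complex.exp (-(L z - L c)))
    (fun w hw => (key w hw).differentiableAt.differentiableWithinAt)
    (fun w hw => by
      rw [((key w hw).hasFDerivAt.hasFDerivWithinAt).fderivWithin
        (Metric.isOpen_ball.uniqueDiffWithinAt hw)]
      ext; simp) hz hc
  simp only [sub_self, neg_zero, Complex.exp_zero, mul_one] at hconst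
  rw [← hconst, mul_assoc, ← Complex.exp_add]
  simp

/-- Borel–Carathéodory for the logarithm of a nonvanishing function. -/
theorem exists_log_norm_le_on_ball {G : ℂ → ℂ} {c : ℂ} {R M : ℝ} (hR : 0 < R) (hM : 1 < M)
    (hG : DifferentiableOn ℂ G (Metric.ball c R)) (h0 : ∀ z ∈ Metric.ball c R, G z ≠ 0)
    (hb : ∀ z ∈ Metric.ball c R, ‖G z‖ ≤ M * ‖G c‖) :
    ∃ L : ℂ → ℂ, ∀ z ∈ Metric.ball c R,
      HasDerivAt L (logDeriv G z) z ∧ G z = G c * Complex.exp (L z) ∧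
        ‖L z‖ ≤ 2 * Real.log M * ‖z - c‖ / (R - ‖z - c‖) := by
  obtain ⟨L, hLc, hL⟩ := exists_log_of_ne_zero_on_ball hR hG h0
  have hmem : ∀ w ∈ Metric.ball (0 : ℂ) R, c + w ∈ Metric.ball c R := by
    intro w hw; simpa using hw
  refine ⟨L, fun z hz => ⟨(hL z hz).1, (hL z hz).2, ?_⟩⟩
  have hd : DifferentiableOn ℂ (fun w => L (c + w)) (Metric.ball 0 R) := fun w hw =>
    (((hL _ (hmem w hw)).1.comp_const_add c w).differentiableAt).differentiableWithinAt
  have hre : Set.MapsTo (fun w => L (c + w)) (Metric.ball 0 R) {z | z.re ≤ Real.log M} := by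
    intro w hw
    have h1 := hb _ (hmem w hw)
    rw [(hL _ (hmem w hw)).2, norm_mul, Complex.norm_exp, mul_comm M] at h1
    have h2 := le_of_mul_le_mul_left h1 (norm_pos_iff.2 (h0 c (Metric.mem_ball_self hR)))
    exact (Real.le_log_iff_exp_le (by linarith)).2 h2
  have := Complex.borelCaratheodory_zero (Real.log_pos hM) hd hre hR (z := z - c)
    (by simpa [dist_eq_norm] using hz) (by simpa using hLc)
  simpa using this

/-- Lower bound for a nonvanishing function bounded on a larger disc. -/
theorem norm_ge_rpow_of_ne_zero_on_ball {G : ℂ → ℂ} {c : ℂ} {R r M : ℝ} (hr : 0 < r) (hrR : r < R)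
    (hM : 1 < M) (hG : DifferentiableOn ℂ G (Metric.ball c R))
    (h0 : ∀ z ∈ Metric.ball c R, G z ≠ 0)
    (hb : ∀ z ∈ Metric.ball c R, ‖G z‖ ≤ M * ‖G c‖) {z : ℂ} (hz : ‖z - c‖ ≤ r) :
    ‖G c‖ * M ^ (-(2 * r / (R - r))) ≤ ‖G z‖ := by
  obtain ⟨L, hL⟩ := exists_log_norm_le_on_ball (hr.trans hrR) hM hG h0 hb
  have hz' : z ∈ Metric.ball c R := by
    rw [Metric.mem_ball, dist_eq_norm]; exact hz.trans_lt hrR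
  obtain ⟨-, h2, h3⟩ := hL z hz'
  rw [h2, norm_mul, Complex.norm_exp]
  gcongr
  have hl := Real.log_pos hM
  have h4 : 2 * Real.log M * ‖z - c‖ / (R - ‖z - c‖) ≤ 2 * Real.log M * r / (R - r) := by
    have : 0 < R - r := by linarith
    gcongr
  have h5 := (abs_le.1 (Complex.abs_re_le_norm (L z))).1
  rw [Real.rpow_def_of_pos (by linarith)]
  apply Real.exp_le_exp.2
  have : Real.log M * -(2 * r / (R - r)) = -(2 * Real.log M * r / (R - r)) := by ring
  linarith

/-- Bound for the logarithmic derivative of a nonvanishing function bounded on a larger disc. -/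
theorem norm_logDeriv_le_of_ne_zero_on_ball {G : ℂ → ℂ} {c : ℂ} {R r M : ℝ} (hr : 0 < r)
    (hrR : r < R) (hM : 1 < M) (hG : DifferentiableOn ℂ G (Metric.ball c R))
    (h0 : ∀ z ∈ Metric.ball c R, G z ≠ 0)
    (hb : ∀ z ∈ Metric.ball c R, ‖G z‖ ≤ M * ‖G c‖) {z : ℂ} (hz : ‖z - c‖ ≤ r) :
    ‖logDeriv G z‖ ≤ 4 * (R + r) / (R - r) ^ 2 * Real.log M := by
  obtain ⟨L, hL⟩ := exists_log_norm_le_on_ball (hr.trans hrR) hM hG h0 hb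
  have hd : 0 < R - r := by linarith
  have hl := Real.log_pos hM
  have hsub : ∀ w ∈ Metric.closedBall z ((R - r) / 2), ‖w - c‖ ≤ (R + r) / 2 := by
    intro w hw
    rw [Metric.mem_closedBall, dist_eq_norm] at hw
    calc ‖w - c‖ = ‖(w - z) + (z - c)‖ := by ring_nf
      _ ≤ ‖w - z‖ + ‖z - c‖ := norm_add_le _ _
      _ ≤ (R + r) / 2 := by linarith
  have hball : ∀ w ∈ Metric.closedBall z ((R - r) / 2), w ∈ Metric.ball c R := by
    intro w hw
    rw [Metric.mem_ball, dist_eq_norm]; linarith [hsub w hw]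
  have hz' : z ∈ Metric.ball c R := hball z (Metric.mem_closedBall_self (by linarith))
  have hdc : DiffContOnCl ℂ L (Metric.ball z ((R - r) / 2)) := by
    apply DifferentiableOn.diffContOnCl
    intro w hw
    exact (hL w (hball w (Metric.closure_ball_subset_closedBall hw))).1.differentiableAt.differentiableWithinAt
  have := Complex.norm_deriv_le_of_forall_mem_sphere_norm_le (C := 2 * Real.log M * ((R + r) / 2) /
    (R - (R + r) / 2)) (by linarith) hdc (by
      intro w hw
      have hw' := Metric.sphere_subset_closedBall hw
      refine (hL w (hball w hw')).2.2.trans ?_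
      have := hsub w hw'
      have : 0 < R - (R + r) / 2 := by linarith
      have : 0 < R + r := by linarith
      gcongr)
  rw [(hL z hz').1.deriv] at this
  refine this.trans (le_of_eq ?_)
  have h6 : R - (R + r) / 2 = (R - r) / 2 := by ring
  rw [h6]
  field_simp
  ring

theorem mellin_fract_differentiableAt {s : ℂ} (hs : 0 < s.re) :
    DifferentiableAt ℂ (fun s => mellin ((Ioi 1).indicator fun t : ℝ => ((Int.fract t : ℝ) : ℂ)) (-s))
      s := by
  refine DifferentiableAt.comp (g := mellin ((Ioi 1).indicator
    fun t : ℝ => ((Int.fract t : ℝ) : ℂ))) s ?_ differentiableAt_id.fun_neg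
  refine mellin_differentiableAt_of_isBigO_rpow (a := 0) (b := -s.re - 1) ?_ ?_ (by simpa using hs)
    ?_ (by simp)
  · have hm : Measurable fun t : ℝ => ((Int.fract t : ℝ) : ℂ) :=
      Complex.measurable_ofReal.comp measurable_fract
    refine MeasureTheory.LocallyIntegrable.locallyIntegrableOn ?_ _
    refine (MeasureTheory.locallyIntegrable_const (1 : ℝ)).mono
      (hm.indicator measurableSet_Ioi).aestronglyMeasurable (MeasureTheory.ae_of_all _ fun t => ?_)
    refine (norm_indicator_le_norm_self _ _).trans ?_
    simp [abs_of_nonneg (Int.fract_nonneg t), (Int.fract_lt_one t).le]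
  · refine Asymptotics.IsBigO.of_bound 1 (Eventually.of_forall fun t => ?_)
    refine (norm_indicator_le_norm_self _ _).trans ?_
    simp [abs_of_nonneg (Int.fract_nonneg t), (Int.fract_lt_one t).le]
  · refine Asymptotics.IsBigO.of_bound 1 ?_
    filter_upwards [mem_nhdsWithin_of_mem_nhds (Iio_mem_nhds (zero_lt_one' ℝ))] with t ht
    rw [indicator_of_notMem (by simpa using (le_of_lt ht))]
    simp

theorem mellin_fract_eq (s : ℂ) :
    mellin ((Ioi 1).indicator fun t : ℝ => ((Int.fract t : ℝ) : ℂ)) (-s)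
      = ∫ t in Ioi (1 : ℝ), ((Int.fract t : ℝ) : ℂ) * (t : ℂ) ^ (-(s + 1)) := by
  rw [mellin, ← MeasureTheory.integral_indicator measurableSet_Ioi,
    ← MeasureTheory.integral_indicator measurableSet_Ioi]
  congr 1
  ext t
  by_cases h : t ∈ Ioi (1 : ℝ)
  · rw [indicator_of_mem (mem_Ioi.2 (lt_trans one_pos (mem_Ioi.1 h))), indicator_of_mem h,
      indicator_of_mem h, smul_eq_mul, mul_comm]
    ring_nf
  · rw [indicator_of_notMem h]
    by_cases h' : t ∈ Ioi (0 : ℝ)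
    · rw [indicator_of_mem h', indicator_of_notMem h, smul_zero]
    · rw [indicator_of_notMem h']

theorem norm_fract_mul_cpow_le {t : ℝ} (ht : 1 < t) (s : ℂ) :
    ‖((Int.fract t : ℝ) : ℂ) * (t : ℂ) ^ (-(s + 1))‖ ≤ t ^ (-s.re - 1) := by
  rw [norm_mul, Complex.norm_cpow_eq_rpow_re_of_pos (by linarith), Complex.norm_real,
    Real.norm_of_nonneg (Int.fract_nonneg t)]
  have h1 : (-(s + 1)).re = -s.re - 1 := by simp; ring
  rw [h1]
  exact mul_le_of_le_one_left (by positivity) (Int.fract_lt_one t).le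

theorem norm_mellin_fract_le {s : ℂ} (hs : 0 < s.re) :
    ‖mellin ((Ioi 1).indicator fun t : ℝ => ((Int.fract t : ℝ) : ℂ)) (-s)‖ ≤ 1 / s.re := by
  rw [mellin_fract_eq]
  refine (MeasureTheory.norm_integral_le_of_norm_le
    (integrableOn_Ioi_rpow_of_lt (by linarith : -s.re - 1 < -1) one_pos) ?_).trans ?_
  · filter_upwards [MeasureTheory.ae_restrict_mem measurableSet_Ioi] with t ht
    exact norm_fract_mul_cpow_le ht s
  · rw [integral_Ioi_rpow_of_lt (by linarith) one_pos]
    simp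

theorem riemannZeta₁_eq_of_ne {s : ℂ} (hs : s ≠ 1) : riemannZeta₁ s = (s - 1) * riemannZeta s := by
  rw [riemannZeta_eq_inv_sub_mul hs, mul_inv_cancel_left₀ (sub_ne_zero.2 hs)]

theorem riemannZeta₁_eq_mellin_of_one_lt {s : ℂ} (hs : 1 < s.re) :
    riemannZeta₁ s = s - s * (s - 1) *
      mellin ((Ioi 1).indicator fun t : ℝ => ((Int.fract t : ℝ) : ℂ)) (-s) := by
  have hs1 : s ≠ 1 := by rintro rfl; simp at hs
  have hO : (fun n : ℕ ↦ ∑ k ∈ Finset.Icc 1 n, ‖(1 : ℕ → ℂ) k‖) =O[atTop]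
      fun n : ℕ ↦ (n : ℝ) ^ (1 : ℝ) := by
    simpa using Asymptotics.isBigO_refl _ _
  have h1 := LSeries_eq_mul_integral' (1 : ℕ → ℂ) zero_le_one hs hO
  rw [LSeries_one_eq_riemannZeta hs] at h1
  have hi1 : MeasureTheory.IntegrableOn (fun t : ℝ => (t : ℂ) ^ (-s)) (Ioi 1) :=
    integrableOn_Ioi_cpow_of_lt (by simpa using hs) one_pos
  have hi2 : MeasureTheory.IntegrableOn
      (fun t : ℝ => ((Int.fract t : ℝ) : ℂ) * (t : ℂ) ^ (-(s + 1))) (Ioi 1) := by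
    refine MeasureTheory.Integrable.mono'
      (integrableOn_Ioi_rpow_of_lt (by linarith : -s.re - 1 < -1) one_pos) ?_ ?_
    · refine (Measurable.aestronglyMeasurable ?_)
      exact (Complex.measurable_ofReal.comp measurable_fract).mul
        (Complex.measurable_ofReal.pow_const _)
    · filter_upwards [MeasureTheory.ae_restrict_mem measurableSet_Ioi] with t ht
      exact norm_fract_mul_cpow_le ht s
  have h2 : ∫ t in Ioi (1 : ℝ), (∑ k ∈ Finset.Icc 1 ⌊t⌋₊, (1 : ℕ → ℂ) k) * (t : ℂ) ^ (-(s + 1))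
      = (∫ t in Ioi (1 : ℝ), (t : ℂ) ^ (-s)) -
        ∫ t in Ioi (1 : ℝ), ((Int.fract t : ℝ) : ℂ) * (t : ℂ) ^ (-(s + 1)) := by
    rw [← MeasureTheory.integral_sub hi1 hi2]
    refine MeasureTheory.setIntegral_congr_fun measurableSet_Ioi fun t ht => ?_
    have ht0 : (0 : ℝ) < t := lt_trans one_pos ht
    have ht' : (t : ℂ) ≠ 0 := by exact_mod_cast ht0.ne'
    have h3 : (t : ℂ) ^ (-s) = t * (t : ℂ) ^ (-(s + 1)) := by
      rw [show -s = 1 + -(s + 1) by ring, Complex.cpow_add _ _ ht', Complex.cpow_one]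
    have h4 : ((⌊t⌋₊ : ℕ) : ℂ) = t - ((Int.fract t : ℝ) : ℂ) := by
      rw [← Complex.ofReal_sub, ← Complex.ofReal_natCast]
      congr 1
      rw [natCast_floor_eq_intCast_floor ht0.le, Int.fract]
      ring
    simp only [Pi.one_apply, Finset.sum_const, Nat.card_Icc, add_tsub_cancel_right, nsmul_eq_mul,
      mul_one]
    rw [h3, h4]
    ring
  rw [riemannZeta₁_eq_of_ne hs1, h1, h2, integral_Ioi_cpow_of_lt (by simpa using hs) one_pos,
    ← mellin_fract_eq]
  have : s - 1 ≠ 0 := sub_ne_zero.2 hs1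
  have h5 : -s + 1 ≠ 0 := by intro h; apply this; linear_combination -h
  simp only [Complex.ofReal_one, Complex.one_cpow]
  have h6 : -1 / (-s + 1) = 1 / (s - 1) := by field_simp; ring
  rw [h6]
  field_simp

theorem riemannZeta₁_eq_mellin {s : ℂ} (hs : 0 < s.re) :
    riemannZeta₁ s = s - s * (s - 1) *
      mellin ((Ioi 1).indicator fun t : ℝ => ((Int.fract t : ℝ) : ℂ)) (-s) := by
  have hopen : IsOpen {z : ℂ | 0 < z.re} := isOpen_lt continuous_const Complex.continuous_re
  have hA : AnalyticOnNhd ℂ riemannZeta₁ {z : ℂ | 0 < z.re} :=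
    differentiable_riemannZeta₁.differentiableOn.analyticOnNhd hopen
  have hB : AnalyticOnNhd ℂ (fun s : ℂ => s - s * (s - 1) *
      mellin ((Ioi 1).indicator fun t : ℝ => ((Int.fract t : ℝ) : ℂ)) (-s)) {z : ℂ | 0 < z.re} := by
    refine DifferentiableOn.analyticOnNhd (fun z hz => ?_) hopen
    have := mellin_fract_differentiableAt (s := z) hz
    exact (DifferentiableAt.fun_sub differentiableAt_id (DifferentiableAt.fun_mul
      (by fun_prop) this)).differentiableWithinAt
  have hpre : IsPreconnected {z : ℂ | 0 < z.re} :=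
    (convex_halfSpace_re_gt 0).isPreconnected
  refine hA.eqOn_of_preconnected_of_eventuallyEq hB hpre (z₀ := 2) (by simp) ?_ hs
  have : {z : ℂ | 1 < z.re} ∈ nhds (2 : ℂ) :=
    (isOpen_lt continuous_const Complex.continuous_re).mem_nhds (by simp)
  filter_upwards [this] with z hz
  exact riemannZeta₁_eq_mellin_of_one_lt hz

theorem norm_riemannZeta₁_le {s : ℂ} (hs : 1 / 4 ≤ s.re) :
    ‖riemannZeta₁ s‖ ≤ 5 * (1 + ‖s‖) ^ 2 := by
  rw [riemannZeta₁_eq_mellin (by linarith)]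
  have h1 := norm_mellin_fract_le (s := s) (by linarith)
  have h2 : 1 / s.re ≤ 4 := by
    rw [div_le_iff₀ (by linarith)]; linarith
  have h3 : ‖s - 1‖ ≤ ‖s‖ + 1 := by simpa using norm_sub_le s 1
  refine (norm_sub_le _ _).trans ?_
  rw [norm_mul, norm_mul]
  have h4 : ‖s‖ * ‖s - 1‖ * ‖mellin ((Ioi 1).indicator fun t : ℝ => ((Int.fract t : ℝ) : ℂ)) (-s)‖
      ≤ ‖s‖ * (‖s‖ + 1) * 4 := by
    gcongr
    exact h1.trans h2
  nlinarith [norm_nonneg s]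

theorem norm_LSeries_le_two {a : ℕ → ℂ} (ha : ∀ n, ‖a n‖ ≤ 1) {s : ℂ} (hs : 2 ≤ s.re) :
    ‖LSeries a s‖ ≤ 2 := by
  have hb : ∀ n : ℕ, ‖LSeries.term a s n‖ ≤ 1 / (n : ℝ) ^ 2 := by
    intro n
    rcases eq_or_ne n 0 with rfl | hn
    · simp
    rw [LSeries.norm_term_eq, if_neg hn]
    have h2 : (n : ℝ) ^ (2 : ℕ) ≤ (n : ℝ) ^ s.re := by
      rw [← Real.rpow_natCast]
      exact Real.rpow_le_rpow_of_exponent_le (by exact_mod_cast Nat.one_le_iff_ne_zero.2 hn)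
        (by simpa using hs)
    have : (0 : ℝ) < n := by positivity
    gcongr
    exact ha n
  refine (tsum_of_norm_bounded hasSum_zeta_two hb).trans ?_
  nlinarith [Real.pi_lt_d2, Real.pi_pos]

theorem norm_riemannZeta_le_two {s : ℂ} (hs : 2 ≤ s.re) : ‖riemannZeta s‖ ≤ 2 := by
  rw [← LSeries_one_eq_riemannZeta (by linarith)]
  exact norm_LSeries_le_two (by simp) hs

theorem norm_LSeries_moebius_le {s : ℂ} (hs : 2 ≤ s.re) :
    ‖LSeries (fun n => ((ArithmeticFunction.moebius n : ℤ) : ℂ)) s‖ ≤ 2 := by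
  refine norm_LSeries_le_two (fun n => ?_) hs
  rw [Complex.norm_intCast]
  exact_mod_cast ArithmeticFunction.abs_moebius_le_one

theorem half_le_norm_riemannZeta {s : ℂ} (hs : 2 ≤ s.re) : 1 / 2 ≤ ‖riemannZeta s‖ := by
  have h1 : LSeries (fun n => ((ArithmeticFunction.zeta n : ℕ) : ℂ)) s *
    LSeries (fun n => ((ArithmeticFunction.moebius n : ℤ) : ℂ)) s = 1 :=
    ArithmeticFunction.LSeries_zeta_mul_Lseries_moebius (by linarith)
  rw [ArithmeticFunction.LSeries_zeta_eq_riemannZeta (by linarith)] at h1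
  have h2 := norm_LSeries_moebius_le hs
  have h3 := congrArg norm h1
  rw [norm_mul, norm_one] at h3
  nlinarith [norm_nonneg (riemannZeta s)]

theorem norm_sub_one_le_norm_riemannZeta₁ {s : ℂ} (hs : 2 ≤ s.re) :
    ‖s - 1‖ / 2 ≤ ‖riemannZeta₁ s‖ := by
  have hs1 : s ≠ 1 := by rintro rfl; norm_num at hs
  rw [riemannZeta₁_eq_of_ne hs1, norm_mul]
  nlinarith [half_le_norm_riemannZeta hs, norm_nonneg (s - 1)]

theorem RiemannHypothesis.riemannZeta₁_ne_zero (hRH : RiemannHypothesis) {s : ℂ}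
    (hs : 1 / 2 < s.re) : riemannZeta₁ s ≠ 0 := by
  rcases eq_or_ne s 1 with rfl | hs1
  · simp
  rw [riemannZeta₁_eq_of_ne hs1]
  refine mul_ne_zero (sub_ne_zero.2 hs1) fun h => ?_
  have := hRH s h (by
    rintro ⟨n, rfl⟩
    have h1 : ((-2 * (n + 1) : ℂ)).re = -2 * (n + 1) := by simp
    rw [h1] at hs
    have : (0 : ℝ) ≤ n := n.cast_nonneg
    linarith) hs1
  linarith

theorem norm_riemannZeta₁_le_mul_center {T : ℝ} {z : ℂ}
    (hz : z ∈ Metric.ball (2 + T * Complex.I) (3 / 2)) :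
    ‖riemannZeta₁ z‖ ≤ 156 * (2 + |T|) * ‖riemannZeta₁ (2 + T * Complex.I)‖ := by
  rw [Metric.mem_ball, dist_eq_norm] at hz
  have hre : 1 / 4 ≤ z.re := by
    have := (abs_le.1 ((Complex.abs_re_le_norm _).trans hz.le)).1
    simp at this
    linarith
  have h1 := norm_riemannZeta₁_le hre
  have hc : ‖(2 + T * Complex.I : ℂ)‖ ≤ 2 + |T| := by
    refine (norm_add_le _ _).trans ?_
    simp
  have hn : ‖z‖ ≤ 7 / 2 + |T| := by
    have := norm_add_le (z - (2 + T * Complex.I)) (2 + T * Complex.I)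
    rw [sub_add_cancel] at this
    linarith
  have h2 := norm_sub_one_le_norm_riemannZeta₁ (s := 2 + T * Complex.I) (by simp)
  have e : (2 + T * Complex.I : ℂ) - 1 = 1 + T * Complex.I := by ring
  rw [e] at h2
  have h3 : 1 ≤ ‖(1 + T * Complex.I : ℂ)‖ := by
    have := Complex.abs_re_le_norm (1 + T * Complex.I)
    simpa using this
  have h4 : |T| ≤ ‖(1 + T * Complex.I : ℂ)‖ := by
    have := Complex.abs_im_le_norm (1 + T * Complex.I)
    simpa using this
  have h5 : (2 + |T|) / 6 ≤ ‖riemannZeta₁ (2 + T * Complex.I)‖ := by linarith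
  have h6 : 156 * (2 + |T|) * ((2 + |T|) / 6) ≤
      156 * (2 + |T|) * ‖riemannZeta₁ (2 + T * Complex.I)‖ := by gcongr
  have h7 : ‖riemannZeta₁ z‖ ≤ 5 * (9 / 2 + |T|) ^ 2 := by
    have := pow_le_pow_left₀ (by positivity) (show 1 + ‖z‖ ≤ 9 / 2 + |T| by linarith) 2
    linarith
  nlinarith [abs_nonneg T]

theorem RiemannHypothesis.riemannZeta₁_ne_zero_of_mem_ball (hRH : RiemannHypothesis) {T : ℝ} {z : ℂ}
    (hz : z ∈ Metric.ball (2 + T * Complex.I) (3 / 2)) : riemannZeta₁ z ≠ 0 := by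
  apply hRH.riemannZeta₁_ne_zero
  rw [Metric.mem_ball, dist_eq_norm] at hz
  have := (abs_lt.1 ((Complex.abs_re_le_norm _).trans_lt hz)).1
  simp at this
  linarith

theorem norm_sub_two_add_im_le {s : ℂ} {ε : ℝ} (h1 : 1 / 2 + ε ≤ s.re) (h2 : s.re ≤ 2) :
    ‖s - (2 + s.im * Complex.I)‖ ≤ 3 / 2 - ε := by
  have : s - (2 + s.im * Complex.I) = ((s.re - 2 : ℝ) : ℂ) := by
    apply Complex.ext <;> simp
  rw [this, Complex.norm_real, Real.norm_eq_abs, abs_le]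
  constructor <;> linarith

theorem RiemannHypothesis.exists_norm_logDeriv_riemannZeta₁_le (hRH : RiemannHypothesis) {ε : ℝ}
    (hε : 0 < ε) (hε1 : ε ≤ 1) :
    ∃ C : ℝ, 0 < C ∧ ∀ s : ℂ, 1 / 2 + ε ≤ s.re → s.re ≤ 2 →
      ‖logDeriv riemannZeta₁ s‖ ≤ C * Real.log (2 + |s.im|) := by
  refine ⟨4 * (3 / 2 + (3 / 2 - ε)) / (3 / 2 - (3 / 2 - ε)) ^ 2 * 9, ?_, fun s h1 h2 => ?_⟩
  · have : 3 / 2 - (3 / 2 - ε) = ε := by ring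
    rw [this]
    have : 0 < 3 / 2 + (3 / 2 - ε) := by linarith
    positivity
  have hτ : 2 ≤ 2 + |s.im| := by linarith [abs_nonneg s.im]
  have h := norm_logDeriv_le_of_ne_zero_on_ball (G := riemannZeta₁) (c := 2 + s.im * Complex.I)
    (R := 3 / 2) (r := 3 / 2 - ε) (M := 156 * (2 + |s.im|)) (by linarith) (by linarith)
    (by linarith) differentiable_riemannZeta₁.differentiableOn
    (fun z hz => hRH.riemannZeta₁_ne_zero_of_mem_ball hz)
    (fun z hz => norm_riemannZeta₁_le_mul_center hz) (norm_sub_two_add_im_le h1 h2)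
  refine h.trans ?_
  rw [mul_assoc]
  have : 0 < 3 / 2 + (3 / 2 - ε) := by linarith
  gcongr
  calc Real.log (156 * (2 + |s.im|)) ≤ Real.log ((2 + |s.im|) ^ 9) := by
        apply Real.log_le_log (by positivity)
        have : (2 : ℝ) ^ 8 ≤ (2 + |s.im|) ^ 8 := by gcongr
        have h3 : 156 ≤ (2 + |s.im|) ^ 8 := by linarith
        rw [pow_succ]
        gcongr
    _ = 9 * Real.log (2 + |s.im|) := by rw [Real.log_pow]; norm_num

theorem RiemannHypothesis.exists_le_norm_riemannZeta₁ (hRH : RiemannHypothesis) {ε : ℝ}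
    (hε : 0 < ε) (hε1 : ε ≤ 1) :
    ∃ K : ℝ, 0 ≤ K ∧ ∀ s : ℂ, 1 / 2 + ε ≤ s.re →
      1 / 2 * (156 * (2 + |s.im|)) ^ (-K) ≤ ‖riemannZeta₁ s‖ := by
  have hd : 0 < 3 / 2 - (3 / 2 - ε) := by linarith
  have hr : 0 < 3 / 2 - ε := by linarith
  refine ⟨2 * (3 / 2 - ε) / (3 / 2 - (3 / 2 - ε)), by positivity, fun s h1 => ?_⟩
  have hτ : 2 ≤ 2 + |s.im| := by linarith [abs_nonneg s.im]
  have key : ∀ z : ℂ, 2 ≤ z.re → 1 / 2 ≤ ‖riemannZeta₁ z‖ := by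
    intro z hz
    have h2 := norm_sub_one_le_norm_riemannZeta₁ hz
    have h3 := (le_abs_self _).trans (Complex.abs_re_le_norm (z - 1))
    simp at h3
    linarith
  rcases le_total s.re 2 with h2 | h2
  · have h := norm_ge_rpow_of_ne_zero_on_ball (G := riemannZeta₁) (c := 2 + s.im * Complex.I)
      (R := 3 / 2) (r := 3 / 2 - ε) (M := 156 * (2 + |s.im|)) (by linarith) (by linarith)
      (by linarith) differentiable_riemannZeta₁.differentiableOn
      (fun z hz => hRH.riemannZeta₁_ne_zero_of_mem_ball hz)
      (fun z hz => norm_riemannZeta₁_le_mul_center hz) (norm_sub_two_add_im_le h1 h2)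
    refine le_trans ?_ h
    gcongr
    exact key _ (by simp)
  · refine le_trans ?_ (key s h2)
    have := Real.rpow_le_one_of_one_le_of_nonpos (x := 156 * (2 + |s.im|))
      (z := -(2 * (3 / 2 - ε) / (3 / 2 - (3 / 2 - ε)))) (by linarith)
      (by rw [neg_nonpos]; positivity)
    linarith

theorem exists_norm_betaIntegral_le {a b : ℝ} (ha : 0 < a) (hb : 0 < b) :
    ∃ C : ℝ, 0 < C ∧ ∀ u v : ℂ, a ≤ u.re → b ≤ v.re → ‖Complex.betaIntegral u v‖ ≤ C := by
  have h_int := (Complex.betaIntegral_convergent (u := a) (v := b) (by simpa) (by simpa)).norm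
  set J := ∫ x : ℝ in (0 : ℝ)..1, ‖(x : ℂ) ^ ((a : ℂ) - 1) * (1 - (x : ℂ)) ^ ((b : ℂ) - 1)‖
  have hJ : 0 ≤ J := intervalIntegral.integral_nonneg zero_le_one fun x _ => norm_nonneg _
  refine ⟨J + 1, by linarith, fun u v hu hv => ?_⟩
  refine le_trans ?_ (by linarith : J ≤ J + 1)
  refine intervalIntegral.norm_integral_le_of_norm_le zero_le_one ?_ h_int
  have hne : ∀ᵐ x : ℝ, x ≠ 1 := by
    simp [MeasureTheory.ae_iff, MeasureTheory.measure_singleton]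
  filter_upwards [hne] with x hx1 hx
  have hx0 : 0 < x := hx.1
  have hx1' : 0 < 1 - x := by
    have := lt_of_le_of_ne hx.2 hx1
    linarith
  rw [show (1 - (x : ℂ)) = ((1 - x : ℝ) : ℂ) by push_cast; ring, norm_mul, norm_mul,
    Complex.norm_cpow_eq_rpow_re_of_pos hx0, Complex.norm_cpow_eq_rpow_re_of_pos hx0,
    Complex.norm_cpow_eq_rpow_re_of_pos hx1', Complex.norm_cpow_eq_rpow_re_of_pos hx1']
  simp only [Complex.sub_re, Complex.one_re, Complex.ofReal_re]
  refine mul_le_mul ?_ ?_ (by positivity) (by positivity)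
  · exact Real.rpow_le_rpow_of_exponent_ge hx0 (by linarith) (by linarith)
  · exact Real.rpow_le_rpow_of_exponent_ge hx1' (by linarith) (by linarith)

theorem exists_norm_Gamma_div_Gamma_le {a b : ℝ} (ha : 0 < a) (hb : 0 < b) :
    ∃ C : ℝ, 0 < C ∧ ∀ u : ℂ, a ≤ u.re → ‖Complex.Gamma u / Complex.Gamma (u + b)‖ ≤ C := by
  obtain ⟨C, hC, h⟩ := exists_norm_betaIntegral_le ha hb
  have hG : Complex.Gamma b ≠ 0 := Complex.Gamma_ne_zero_of_re_pos (by simpa)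
  refine ⟨C / ‖Complex.Gamma b‖, by positivity, fun u hu => ?_⟩
  have h1 := Complex.Gamma_mul_Gamma_eq_betaIntegral (s := u) (t := b) (by linarith) (by simpa)
  have h2 : Complex.Gamma (u + b) ≠ 0 := Complex.Gamma_ne_zero_of_re_pos (by simp; linarith)
  have h3 : Complex.Gamma u / Complex.Gamma (u + b) =
      Complex.betaIntegral u b / Complex.Gamma b := by
    rw [div_eq_div_iff h2 hG, h1, mul_comm]
  rw [h3, norm_div]
  gcongr
  exact h u b hu (by simp)

theorem Complex.exists_norm_digamma_le :
    ∃ C : ℝ, 0 < C ∧ ∀ z : ℂ, 1 / 4 ≤ z.re → ‖Complex.digamma z‖ ≤ C * Real.log (2 + ‖z‖) := by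
  obtain ⟨C₁, hC₁, hβ⟩ := exists_norm_betaIntegral_le (a := 1 / 4) (b := 1 / 2) (by norm_num)
    (by norm_num)
  obtain ⟨C₂, hC₂⟩ := (isCompact_closedBall (1 : ℂ) (1 / 2)).exists_bound_of_continuousOn
    (f := fun s => (Complex.Gamma s)⁻¹) Complex.differentiable_one_div_Gamma.continuous.continuousOn
  have hC₂0 : 0 ≤ C₂ := (norm_nonneg _).trans (hC₂ 1 (by simp))
  set D := 1 + C₁ * C₂ with hD
  have hD1 : 1 ≤ D := by have := mul_nonneg hC₁.le hC₂0; linarith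
  have hlogD : 0 ≤ Real.log D := Real.log_nonneg hD1
  have hl2 : 0 < Real.log 2 := Real.log_pos (by norm_num)
  set K := 4 * (1 / 2 + 1 / 4 : ℝ) / (1 / 2 - 1 / 4) ^ 2 with hK
  have hK0 : 0 < K := by rw [hK]; norm_num
  refine ⟨K * (Real.log D / Real.log 2 + 1) + 4 / Real.log 2, by positivity, fun z hz => ?_⟩
  have hz0 : z ≠ 0 := by rintro rfl; norm_num at hz
  have hball : ∀ a ∈ Metric.ball (1 : ℂ) (1 / 2), 1 / 2 ≤ a.re := by
    intro a ha
    rw [Metric.mem_ball, dist_eq_norm] at ha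
    have := (abs_lt.1 ((Complex.abs_re_le_norm _).trans_lt ha)).1
    simp at this
    linarith
  have hΓ : Complex.Gamma z ≠ 0 := Complex.Gamma_ne_zero_of_re_pos (by linarith)
  have hadd : ∀ a ∈ Metric.ball (1 : ℂ) (1 / 2), Complex.Gamma (z + a) ≠ 0 := fun a ha =>
    Complex.Gamma_ne_zero_of_re_pos (by
      have := hball a ha
      simp; linarith)
  have hG1 : ‖Complex.Gamma z * (Complex.Gamma (z + 1))⁻¹‖ = ‖z‖⁻¹ := by
    rw [Complex.Gamma_add_one z hz0, mul_inv, mul_comm z⁻¹, mul_inv_cancel_left₀ hΓ, norm_inv]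
  have hz' : 0 < ‖z‖ := norm_pos_iff.2 hz0
  have h := norm_logDeriv_le_of_ne_zero_on_ball
    (G := fun a => Complex.Gamma z * (Complex.Gamma (z + a))⁻¹) (c := 1) (R := 1 / 2) (r := 1 / 4)
    (M := D * (2 + ‖z‖)) (by norm_num) (by norm_num) (by nlinarith)
    (((Complex.differentiable_one_div_Gamma.comp (differentiable_id.const_add z)).const_mul
      _).differentiableOn)
    (fun a ha => mul_ne_zero hΓ (inv_ne_zero (hadd a ha)))
    (fun a ha => by
      have h1 := Complex.Gamma_mul_Gamma_eq_betaIntegral (s := z) (t := a) (by linarith)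
        (by linarith [hball a ha])
      have h2 : Complex.Gamma a ≠ 0 := Complex.Gamma_ne_zero_of_re_pos (by linarith [hball a ha])
      have h3 : Complex.Gamma z * (Complex.Gamma (z + a))⁻¹ =
          Complex.betaIntegral z a * (Complex.Gamma a)⁻¹ := by
        have := hadd a ha
        field_simp
        rw [h1, mul_comm]
      rw [h3, hG1, norm_mul]
      have h4 : ‖Complex.betaIntegral z a‖ * ‖(Complex.Gamma a)⁻¹‖ ≤ C₁ * C₂ := by
        gcongr
        · exact hβ z a hz (hball a ha)
        · exact hC₂ a (Metric.ball_subset_closedBall ha)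
      have h5 : D * 1 ≤ D * (2 + ‖z‖) * ‖z‖⁻¹ := by
        rw [mul_assoc]
        gcongr
        rw [← div_eq_mul_inv, le_div_iff₀ hz']
        linarith
      linarith)
    (z := 1) (by simp)
  have hlog : logDeriv (fun a => Complex.Gamma z * (Complex.Gamma (z + a))⁻¹) 1
      = -Complex.digamma (z + 1) := by
    have hda : DifferentiableAt ℂ Complex.Gamma (z + 1) := Complex.differentiableAt_Gamma _ (by
      intro m hm
      have := congrArg Complex.re hm
      simp at this
      have : (0 : ℝ) ≤ m := m.cast_nonneg
      linarith)
    have hd : HasDerivAt (fun a => Complex.Gamma (z + a)) (deriv Complex.Gamma (z + 1)) 1 :=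
      hda.hasDerivAt.comp_const_add z 1
    have hne := hadd 1 (by simp)
    have hd2 := (hd.fun_inv hne).const_mul (Complex.Gamma z)
    rw [logDeriv_apply, hd2.deriv, Complex.digamma_def, logDeriv_apply]
    field_simp
  rw [hlog, norm_neg] at h
  have hrec := Complex.digamma_apply_add_one z (by
      intro m hm
      have := congrArg Complex.re hm
      simp at this
      have : (0 : ℝ) ≤ m := m.cast_nonneg
      linarith)
  have h6 : ‖Complex.digamma z‖ ≤ ‖Complex.digamma (z + 1)‖ + ‖z⁻¹‖ := by
    have : Complex.digamma z = Complex.digamma (z + 1) - z⁻¹ := by rw [hrec]; ring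
    rw [this]
    exact norm_sub_le _ _
  have h7 : ‖z⁻¹‖ ≤ 4 := by
    rw [norm_inv, inv_le_comm₀ hz' (by norm_num)]
    have := (le_abs_self _).trans (Complex.abs_re_le_norm z)
    linarith
  have h8 : Real.log 2 ≤ Real.log (2 + ‖z‖) := Real.log_le_log (by norm_num) (by linarith)
  rw [Real.log_mul (by linarith) (by linarith)] at h
  have h9 : Real.log D ≤ Real.log D / Real.log 2 * Real.log (2 + ‖z‖) := by
    rw [div_mul_eq_mul_div, le_div_iff₀ hl2]
    gcongr
  have h10 : 4 ≤ 4 / Real.log 2 * Real.log (2 + ‖z‖) := by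
    rw [div_mul_eq_mul_div, le_div_iff₀ hl2]
    gcongr
  have h11 : K * (Real.log D + Real.log (2 + ‖z‖)) ≤
      K * (Real.log D / Real.log 2 * Real.log (2 + ‖z‖) + Real.log (2 + ‖z‖)) := by gcongr
  linarith

/-- The function `s (s - 1) Λ(s)`, in a form without removable singularities on `0 < re s`. -/
noncomputable def xiFun (s : ℂ) : ℂ := s * Complex.Gammaℝ s * riemannZeta₁ s

theorem xiFun_eq_completedRiemannZeta {s : ℂ} (hs : 0 < s.re) (hs1 : s ≠ 1) :
    xiFun s = s * (s - 1) * completedRiemannZeta s := by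
  have h0 : s ≠ 0 := by rintro rfl; simp at hs
  rw [xiFun, riemannZeta₁_eq_of_ne hs1, riemannZeta_def_of_ne_zero h0]
  have := Complex.Gammaℝ_ne_zero_of_re_pos hs
  field_simp

theorem xiFun_one_sub {s : ℂ} (hs : 0 < s.re) (hs1 : s.re < 1) : xiFun (1 - s) = xiFun s := by
  have h1 : s ≠ 1 := by rintro rfl; simp at hs1
  have h0 : s ≠ 0 := by rintro rfl; simp at hs
  rw [xiFun_eq_completedRiemannZeta hs h1, xiFun_eq_completedRiemannZeta (by simpa) (by simpa),
    completedRiemannZeta_one_sub]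
  ring

theorem norm_xiFun_conj (s : ℂ) : ‖xiFun ((starRingEnd ℂ) s)‖ = ‖xiFun s‖ := by
  have h1 : ‖riemannZeta₁ ((starRingEnd ℂ) s)‖ = ‖riemannZeta₁ s‖ := by
    rcases eq_or_ne s 1 with rfl | hs1
    · simp
    have hs2 : (starRingEnd ℂ) s ≠ 1 := fun h => hs1 (by
      have := congrArg (starRingEnd ℂ) h
      simpa using this)
    rw [riemannZeta₁_eq_of_ne hs1, riemannZeta₁_eq_of_ne hs2, riemannZeta_conj, norm_mul, norm_mul,
      Complex.norm_conj, ← Complex.norm_conj (s - 1)]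
    simp
  have h2 : ‖Complex.Gammaℝ ((starRingEnd ℂ) s)‖ = ‖Complex.Gammaℝ s‖ := by
    rw [Complex.Gammaℝ_def, Complex.Gammaℝ_def, norm_mul, norm_mul,
      Complex.norm_cpow_eq_rpow_re_of_pos Real.pi_pos,
      Complex.norm_cpow_eq_rpow_re_of_pos Real.pi_pos, ← Complex.norm_conj (Complex.Gamma (s / 2)),
      ← Complex.Gamma_conj, map_div₀, map_ofNat]
    simp
  rw [xiFun, xiFun, norm_mul, norm_mul, norm_mul, norm_mul, h1, h2, Complex.norm_conj]

theorem differentiableAt_Gammaℝ {s : ℂ} (hs : 0 < s.re) :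
    DifferentiableAt ℂ Complex.Gammaℝ s := by
  have h := (Complex.differentiable_Gammaℝ_inv s).inv
    (inv_ne_zero (Complex.Gammaℝ_ne_zero_of_re_pos hs))
  refine h.congr_of_eventuallyEq (Eventually.of_forall fun z => ?_)
  simp

theorem differentiableAt_xiFun {s : ℂ} (hs : 0 < s.re) : DifferentiableAt ℂ xiFun s :=
  (differentiableAt_id.mul (differentiableAt_Gammaℝ hs)).mul (differentiable_riemannZeta₁ s)

theorem RiemannHypothesis.xiFun_ne_zero (hRH : RiemannHypothesis) {s : ℂ} (hs : 1 / 2 < s.re) :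
    xiFun s ≠ 0 := by
  have h0 : s ≠ 0 := by rintro rfl; norm_num at hs
  exact mul_ne_zero (mul_ne_zero h0 (Complex.Gammaℝ_ne_zero_of_re_pos (by linarith)))
    (hRH.riemannZeta₁_ne_zero hs)

theorem norm_xiFun_sub_eq_of_re_eq {ε : ℝ} (hε : 0 < ε) (hε1 : ε ≤ 1 / 4) {s : ℂ}
    (hs : s.re = 1 / 2) : ‖xiFun (s - ε)‖ = ‖xiFun (s + ε)‖ := by
  rw [← norm_xiFun_conj (s + ε), ← xiFun_one_sub (s := (starRingEnd ℂ) (s + ε))]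
  · congr 2
    apply Complex.ext <;> simp [hs]
    norm_num
    ring
  · simp [hs]; linarith
  · simp [hs]; linarith

theorem exists_norm_xiFun_ratio_le {ε : ℝ} (hε : 0 < ε) (hε1 : ε ≤ 1 / 4) :
    ∃ C : ℝ, 0 < C ∧ ∀ s : ℂ, 1 / 2 ≤ s.re →
      ‖xiFun (s - ε) / xiFun (s + ε)‖ ≤ C * ‖riemannZeta₁ (s - ε) / riemannZeta₁ (s + ε)‖ := by
  obtain ⟨C, hC, h⟩ := exists_norm_Gamma_div_Gamma_le (a := 1 / 8) (by norm_num) hε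
  refine ⟨π ^ ε * C, by positivity, fun s hs => ?_⟩
  have e : xiFun (s - ε) / xiFun (s + ε) = ((s - ε) / (s + ε)) *
      (((π : ℂ) ^ (-(s - ε) / 2) / (π : ℂ) ^ (-(s + ε) / 2)) *
      (Complex.Gamma ((s - ε) / 2) / Complex.Gamma ((s - ε) / 2 + ε))) *
      (riemannZeta₁ (s - ε) / riemannZeta₁ (s + ε)) := by
    have : (s - ε) / 2 + ε = (s + ε) / 2 := by ring
    rw [this, xiFun, xiFun, Complex.Gammaℝ_def, Complex.Gammaℝ_def]
    simp only [mul_div_mul_comm]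
  have h1 : ‖(s - ε) / (s + ε)‖ ≤ 1 := by
    have h0 : s + ε ≠ 0 := by
      intro h
      have := congrArg Complex.re h
      simp at this
      linarith
    rw [norm_div, div_le_one (norm_pos_iff.2 h0)]
    refine abs_le_of_sq_le_sq' ?_ (norm_nonneg _) |>.2
    rw [Complex.sq_norm, Complex.sq_norm, Complex.normSq_apply, Complex.normSq_apply]
    simp
    nlinarith
  have h2 : ‖(π : ℂ) ^ (-(s - ε) / 2) / (π : ℂ) ^ (-(s + ε) / 2)‖ = π ^ ε := by
    rw [← Complex.cpow_sub _ _ (by simp [Real.pi_ne_zero]),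
      Complex.norm_cpow_eq_rpow_re_of_pos Real.pi_pos]
    congr 1
    rw [show -(s - ε) / 2 - -(s + ε) / 2 = (ε : ℂ) by ring, Complex.ofReal_re]
  have h3 := h ((s - ε) / 2) (by
    rw [show ((s - ε) / 2).re = (s.re - ε) / 2 by simp]; linarith)
  rw [e, norm_mul, norm_mul, norm_mul, h2]
  refine mul_le_mul_of_nonneg_right ?_ (norm_nonneg _)
  calc _ ≤ 1 * (π ^ ε * C) := by gcongr
    _ = _ := one_mul _

/-- Under RH, `|ξ(s - ε)| ≤ |ξ(s + ε)|` to the right of the critical line. -/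
theorem RiemannHypothesis.norm_xiFun_sub_le (hRH : RiemannHypothesis) {ε : ℝ} (hε : 0 < ε)
    (hε1 : ε ≤ 1 / 4) {s : ℂ} (hs : 1 / 2 ≤ s.re) : ‖xiFun (s - ε)‖ ≤ ‖xiFun (s + ε)‖ := by
  have hne : ∀ z : ℂ, 1 / 2 ≤ z.re → xiFun (z + ε) ≠ 0 := fun z hz =>
    hRH.xiFun_ne_zero (by simp; linarith)
  obtain ⟨C, hC, hratio⟩ := exists_norm_xiFun_ratio_le hε hε1
  obtain ⟨K, hK, hlow⟩ := hRH.exists_le_norm_riemannZeta₁ hε (by linarith)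
  set F : ℂ → ℂ := fun w => xiFun ((w + 1 / 2) - ε) / xiFun ((w + 1 / 2) + ε) with hF
  have hclos : closure {z : ℂ | 0 < z.re} = {z : ℂ | 0 ≤ z.re} := by
    simp
  have hre : ∀ w : ℂ, 0 ≤ w.re → 1 / 2 ≤ (w + 1 / 2).re := by
    intro w hw; simp; linarith
  have hsub : ∀ z : ℂ, 1 / 2 ≤ z.re → (z - ε).re = z.re - ε := by intro z _; simp
  have key : ‖F (s - 1 / 2)‖ ≤ 1 := by
    refine PhragmenLindelof.right_half_plane_of_bounded_on_real ?_ ?_ ?_ ?_ (by simp; linarith)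
    · apply DifferentiableOn.diffContOnCl
      rw [hclos]
      intro w hw
      have hw' := hre w hw
      have d1 : DifferentiableAt ℂ (fun w : ℂ => xiFun ((w + 1 / 2) - ε)) w :=
        DifferentiableAt.comp (g := xiFun) w (differentiableAt_xiFun (by
          rw [hsub _ hw']; linarith)) (by fun_prop)
      have d2 : DifferentiableAt ℂ (fun w : ℂ => xiFun ((w + 1 / 2) + ε)) w :=
        DifferentiableAt.comp (g := xiFun) w (differentiableAt_xiFun (by
          rw [Complex.add_re, Complex.ofReal_re]; linarith)) (by fun_prop)
      exact (d1.div d2 (hne _ hw')).differentiableWithinAt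
    · refine ⟨1, by norm_num, K + 2, ?_⟩
      refine Asymptotics.IsBigO.of_bound (C * (10 * (156 ^ K * (3 : ℝ) ^ (K + 2)))) ?_
      refine Filter.mem_inf_of_right ?_
      intro w hw
      have hw' := hre w (le_of_lt hw)
      have hzn : ‖w + 1 / 2‖ ≤ ‖w‖ + 1 / 2 := by
        refine (norm_add_le _ _).trans ?_
        norm_num
      have hb1 : ‖riemannZeta₁ ((w + 1 / 2) - ε)‖ ≤ 5 * (3 + ‖w‖) ^ 2 := by
        refine (norm_riemannZeta₁_le (by rw [hsub _ hw']; linarith)).trans ?_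
        have : ‖(w + 1 / 2) - (ε : ℂ)‖ ≤ ‖w‖ + 1 / 2 + ε := by
          refine (norm_sub_le _ _).trans ?_
          rw [Complex.norm_real, Real.norm_of_nonneg hε.le]
          linarith
        have := pow_le_pow_left₀ (by positivity)
          (show 1 + ‖(w + 1 / 2) - (ε : ℂ)‖ ≤ 3 + ‖w‖ by linarith) 2
        linarith
      have hb2 := hlow ((w + 1 / 2) + ε) (by rw [Complex.add_re, Complex.ofReal_re]; linarith)
      have him : ((w + 1 / 2) + (ε : ℂ)).im = w.im := by simp
      rw [him, Real.rpow_neg (by positivity)] at hb2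
      have hb3 : (156 * (2 + |w.im|)) ^ K ≤ (156 * (3 + ‖w‖)) ^ K := by
        gcongr
        · norm_num
        · exact Complex.abs_im_le_norm w
      have hp1 : 0 < (156 * (2 + |w.im|)) ^ K := by positivity
      have hb4 : ‖riemannZeta₁ ((w + 1 / 2) - ε) / riemannZeta₁ ((w + 1 / 2) + ε)‖ ≤
          5 * (3 + ‖w‖) ^ 2 * (2 * (156 * (3 + ‖w‖)) ^ K) := by
        rw [norm_div, div_eq_mul_inv]
        gcongr
        refine le_trans (inv_anti₀ (by positivity) hb2) ?_
        rw [mul_inv, inv_inv]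
        norm_num
        gcongr
      have hexp : 3 + ‖w‖ ≤ 3 * Real.exp ‖w‖ := by
        have := Real.add_one_le_exp ‖w‖
        linarith [norm_nonneg w]
      have hb5 : (3 + ‖w‖) ^ (K + 2) ≤ (3 : ℝ) ^ (K + 2) * Real.exp ((K + 2) * ‖w‖) := by
        calc (3 + ‖w‖) ^ (K + 2) ≤ (3 * Real.exp ‖w‖) ^ (K + 2) := by gcongr
          _ = _ := by
            rw [Real.mul_rpow (by norm_num) (Real.exp_pos _).le, ← Real.exp_mul, mul_comm ‖w‖]
      simp only [Set.mem_ofPred_eq, Real.rpow_one]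
      rw [Real.norm_of_nonneg (Real.exp_pos _).le]
      calc ‖F w‖ ≤ C * ‖riemannZeta₁ ((w + 1 / 2) - ε) / riemannZeta₁ ((w + 1 / 2) + ε)‖ :=
            hratio _ hw'
        _ ≤ C * (5 * (3 + ‖w‖) ^ 2 * (2 * (156 * (3 + ‖w‖)) ^ K)) := by gcongr
        _ = C * (10 * (156 ^ K * (3 + ‖w‖) ^ (K + 2))) := by
            rw [Real.mul_rpow (by norm_num) (by positivity), Real.rpow_add (by positivity), Real.rpow_two]
            ring
        _ ≤ C * (10 * (156 ^ K * ((3 : ℝ) ^ (K + 2) * Real.exp ((K + 2) * ‖w‖)))) := by gcongr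
        _ = _ := by ring
    · refine ⟨C * 4, ?_⟩
      rw [eventually_map]
      filter_upwards [eventually_ge_atTop (3 : ℝ)] with x hx
      refine (hratio _ (hre x (by simp; linarith))).trans ?_
      gcongr
      have r1 : ((x : ℂ) + 1 / 2 - ε).re = x + 1 / 2 - ε := by simp
      have r2 : ((x : ℂ) + 1 / 2 + ε).re = x + 1 / 2 + ε := by simp
      have hz1 := norm_riemannZeta_le_two (s := (x : ℂ) + 1 / 2 - ε) (by rw [r1]; linarith)
      have hz2 := norm_sub_one_le_norm_riemannZeta₁ (s := (x : ℂ) + 1 / 2 + ε)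
        (by rw [r2]; linarith)
      have hne1 : (x : ℂ) + 1 / 2 - ε ≠ 1 := by
        intro h
        have := congrArg Complex.re h
        rw [r1, Complex.one_re] at this
        linarith
      rw [norm_div, riemannZeta₁_eq_of_ne hne1, norm_mul]
      have n1 : ‖(x : ℂ) + 1 / 2 - ε - 1‖ = x + 1 / 2 - ε - 1 := by
        rw [show (x : ℂ) + 1 / 2 - ε - 1 = ((x + 1 / 2 - ε - 1 : ℝ) : ℂ) by push_cast; ring,
          Complex.norm_real, Real.norm_of_nonneg (by linarith)]
      have n2 : ‖(x : ℂ) + 1 / 2 + ε - 1‖ = x + 1 / 2 + ε - 1 := by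
        rw [show (x : ℂ) + 1 / 2 + ε - 1 = ((x + 1 / 2 + ε - 1 : ℝ) : ℂ) by push_cast; ring,
          Complex.norm_real, Real.norm_of_nonneg (by linarith)]
      rw [n2] at hz2
      rw [n1, div_le_iff₀ (by linarith)]
      nlinarith
    · intro y
      have h := norm_xiFun_sub_eq_of_re_eq hε hε1 (s := (y : ℂ) * Complex.I + 1 / 2) (by simp)
      rw [hF]
      simp only
      rw [norm_div, h]
      exact div_self_le_one _
  simp only [hF, sub_add_cancel] at key
  rw [norm_div, div_le_one (norm_pos_iff.2 (hne s hs))] at key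
  exact key

theorem RiemannHypothesis.re_logDeriv_xiFun_nonneg (hRH : RiemannHypothesis) {s : ℂ}
    (hs : 1 / 2 < s.re) : 0 ≤ (logDeriv xiFun s).re := by
  have h0 := hRH.xiFun_ne_zero hs
  have hd : HasDerivAt xiFun (deriv xiFun s) s :=
    (differentiableAt_xiFun (by linarith)).hasDerivAt
  have hd1 : HasDerivAt (fun r : ℝ => xiFun (s + r) / xiFun s) (logDeriv xiFun s) 0 := by
    have h1 : HasDerivAt (fun z : ℂ => xiFun (s + z)) (deriv xiFun s) ((0 : ℝ) : ℂ) := by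
      have : HasDerivAt xiFun (deriv xiFun s) (s + ((0 : ℝ) : ℂ)) := by simpa using hd
      exact this.comp_const_add s _
    simpa [logDeriv_apply] using (h1.comp_ofReal).div_const (xiFun s)
  have hd2 : HasDerivAt (fun r : ℝ => xiFun (s - r) / xiFun s) (-logDeriv xiFun s) 0 := by
    have h1 : HasDerivAt (fun z : ℂ => xiFun (s - z)) (-deriv xiFun s) ((0 : ℝ) : ℂ) := by
      have : HasDerivAt xiFun (deriv xiFun s) (s - ((0 : ℝ) : ℂ)) := by simpa using hd
      exact this.comp_const_sub s _
    simpa [logDeriv_apply, neg_div] using (h1.comp_ofReal).div_const (xiFun s)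
  have hd3 := (hd1.norm_sq.sub hd2.norm_sq).tendsto_slope_zero_right
  have hlim : 0 ≤ 2 * inner ℝ (xiFun (s + (0 : ℝ)) / xiFun s) (logDeriv xiFun s) -
      2 * inner ℝ (xiFun (s - (0 : ℝ)) / xiFun s) (-logDeriv xiFun s) := by
    refine ge_of_tendsto hd3 ?_
    filter_upwards [Ioc_mem_nhdsGT (show (0 : ℝ) < 1 / 4 by norm_num)] with r hr
    have h2 := hRH.norm_xiFun_sub_le hr.1 hr.2 hs.le
    have h3 : ‖xiFun (s - r) / xiFun s‖ ^ 2 ≤ ‖xiFun (s + r) / xiFun s‖ ^ 2 := by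
      rw [norm_div, norm_div]
      gcongr
    have hr0 : (0 : ℝ) ≤ r⁻¹ := inv_nonneg.2 hr.1.le
    simp only [zero_add, Pi.sub_apply, smul_eq_mul]
    apply mul_nonneg hr0
    simpa using h3
  simp [h0] at hlim
  linarith

theorem RiemannHypothesis.logDeriv_xiFun (hRH : RiemannHypothesis) {s : ℂ} (hs : 1 / 2 < s.re) :
    logDeriv xiFun s = 1 / s - Real.log π / 2 + Complex.digamma (s / 2) / 2
      + logDeriv riemannZeta₁ s := by
  have h0 : s ≠ 0 := by rintro rfl; norm_num at hs
  have hs0 : 0 < s.re := by linarith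
  have hG := Complex.Gammaℝ_ne_zero_of_re_pos hs0
  have hd := differentiableAt_Gammaℝ hs0
  have e1 : logDeriv xiFun s = logDeriv (fun s => s * Complex.Gammaℝ s) s
      + logDeriv riemannZeta₁ s :=
    logDeriv_mul s (mul_ne_zero h0 hG) (hRH.riemannZeta₁_ne_zero hs)
      (differentiableAt_id.mul hd) (differentiable_riemannZeta₁ s)
  have e2 : logDeriv (fun s => s * Complex.Gammaℝ s) s = logDeriv (fun s => s) s
      + logDeriv Complex.Gammaℝ s := logDeriv_mul s h0 hG differentiableAt_id hd
  have hπ : (π : ℂ) ≠ 0 := by simp [Real.pi_ne_zero]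
  have hΓd : DifferentiableAt ℂ Complex.Gamma (s / 2) := Complex.differentiableAt_Gamma _ (by
      intro m hm
      have h1 := congrArg Complex.re hm
      have h2 : (s / 2).re = s.re / 2 := by simp
      rw [h2] at h1
      simp at h1
      have : (0 : ℝ) ≤ m := m.cast_nonneg
      linarith)
  have hd2 : HasDerivAt (fun s : ℂ => s / 2) (1 / 2) s := (hasDerivAt_id s).div_const 2
  have hcp : HasDerivAt (fun s : ℂ => (π : ℂ) ^ (-s / 2))
      ((π : ℂ) ^ (-s / 2) * Complex.log π * (-1 / 2)) s := by
    have : HasDerivAt (fun s : ℂ => -s / 2) (-1 / 2) s := (hasDerivAt_id s).neg.div_const 2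
    exact this.const_cpow (Or.inl hπ)
  have hgm : HasDerivAt (fun s : ℂ => Complex.Gamma (s / 2))
      (deriv Complex.Gamma (s / 2) * (1 / 2)) s := hΓd.hasDerivAt.comp s hd2
  have hΓ0 : Complex.Gamma (s / 2) ≠ 0 := Complex.Gamma_ne_zero_of_re_pos (by
    have h2 : (s / 2).re = s.re / 2 := by simp
    linarith)
  have hcp0 : (π : ℂ) ^ (-s / 2) ≠ 0 := by simp [Complex.cpow_eq_zero_iff, hπ]
  have e3 : logDeriv Complex.Gammaℝ s = logDeriv (fun s : ℂ => (π : ℂ) ^ (-s / 2)) s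
      + logDeriv (fun s : ℂ => Complex.Gamma (s / 2)) s :=
    logDeriv_mul s hcp0 hΓ0 hcp.differentiableAt hgm.differentiableAt
  rw [e1, e2, e3]
  rw [logDeriv_apply, logDeriv_apply, logDeriv_apply (fun s : ℂ => Complex.Gamma (s / 2)),
    hcp.deriv, hgm.deriv, deriv_id'', Complex.digamma_def, logDeriv_apply Complex.Gamma,
    ← Complex.ofReal_log Real.pi_pos.le]
  field_simp
  ring

theorem half_lt_log_two_add_abs (t : ℝ) : 1 / 2 < Real.log (2 + |t|) := by
  have : Real.log 2 ≤ Real.log (2 + |t|) :=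
    Real.log_le_log (by norm_num) (by linarith [abs_nonneg t])
  linarith [Real.log_two_gt_d9]

theorem log_le_two_mul_log_two_add_abs {t x : ℝ} (hx : 0 < x) (h : x ≤ 2 * (2 + |t|)) :
    Real.log x ≤ 2 * Real.log (2 + |t|) := by
  have ht := abs_nonneg t
  calc Real.log x ≤ Real.log ((2 + |t|) ^ 2) := Real.log_le_log hx (by nlinarith)
    _ = 2 * Real.log (2 + |t|) := by rw [Real.log_pow]; norm_num

theorem RiemannHypothesis.exists_norm_logDeriv_xiFun_sub_le (hRH : RiemannHypothesis) :
    ∃ C : ℝ, 0 < C ∧ ∀ s : ℂ, 1 / 2 < s.re → s.re ≤ 2 →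
      ‖logDeriv xiFun s - logDeriv riemannZeta₁ s‖ ≤ C * Real.log (2 + |s.im|) := by
  obtain ⟨C, hC, h⟩ := Complex.exists_norm_digamma_le
  refine ⟨6 + C, by linarith, fun s hs1 hs2 => ?_⟩
  rw [hRH.logDeriv_xiFun hs1, add_sub_cancel_right]
  have hl := half_lt_log_two_add_abs s.im
  have h1 : ‖1 / s‖ ≤ 2 := by
    have := (le_abs_self _).trans (Complex.abs_re_le_norm s)
    rw [norm_div, norm_one, div_le_iff₀ (by linarith)]
    linarith
  have h2 : ‖((Real.log π : ℝ) : ℂ) / 2‖ ≤ 1 := by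
    rw [norm_div, Complex.norm_real, Real.norm_of_nonneg (Real.log_nonneg (by linarith [Real.pi_gt_three]))]
    have : Real.log π ≤ 2 := by
      rw [Real.log_le_iff_le_exp Real.pi_pos]
      have h3 := Real.exp_one_gt_d9
      have : Real.exp 2 = Real.exp 1 * Real.exp 1 := by rw [← Real.exp_add]; norm_num
      nlinarith [Real.pi_lt_d2]
    norm_num
    linarith
  have h3 : ‖Complex.digamma (s / 2) / 2‖ ≤ C * Real.log (2 + |s.im|) := by
    have h4 := h (s / 2) (by
      have h2 : (s / 2).re = s.re / 2 := by simp
      linarith)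
    have h5 : ‖s‖ ≤ 2 + |s.im| := by
      refine (Complex.norm_le_abs_re_add_abs_im s).trans ?_
      rw [abs_of_pos (by linarith)]
      linarith
    have h6 : Real.log (2 + ‖s / 2‖) ≤ 2 * Real.log (2 + |s.im|) := by
      refine log_le_two_mul_log_two_add_abs (by positivity) ?_
      rw [norm_div]
      norm_num
      linarith [abs_nonneg s.im]
    rw [norm_div]
    norm_num
    have : C * Real.log (2 + ‖s / 2‖) ≤ C * (2 * Real.log (2 + |s.im|)) := by gcongr
    linarith
  have h4 := norm_add_le (1 / s - ((Real.log π : ℝ) : ℂ) / 2) (Complex.digamma (s / 2) / 2)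
  have h5 := norm_sub_le (1 / s) (((Real.log π : ℝ) : ℂ) / 2)
  linarith

/-- A local integral bound for functions with nonnegative real part. -/
theorem integral_re_le_of_re_nonneg {H : ℂ → ℂ} {σ B T : ℝ} (hσ : σ < 2)
    (hd : ∀ s : ℂ, σ ≤ s.re → DifferentiableAt ℂ H s) (hpos : ∀ s : ℂ, σ ≤ s.re → 0 ≤ (H s).re)
    (hB : ∀ y ∈ Icc (T - 1) (T + 1), ‖H (2 + y * Complex.I)‖ ≤ B) :
    ∫ y in (T - 1 / 2)..(T + 1 / 2), (H (σ + y * Complex.I)).re ≤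
      4 * B * Real.cosh (π / 2 * (2 - σ)) := by
  set W : ℂ → ℂ := fun s => Complex.cosh (π / 2 * (s - σ - T * Complex.I)) with hW
  have hWd : Differentiable ℂ W := by
    rw [hW]; fun_prop
  have hrect := Complex.integral_boundary_rect_eq_zero_of_differentiableOn (fun s => H s * W s)
    (σ + (T - 1 : ℝ) * Complex.I) (2 + (T + 1 : ℝ) * Complex.I) (by
      intro s hs
      have : σ ≤ s.re := by
        have := (Complex.mem_reProdIm.1 hs).1
        simp [uIcc_of_le hσ.le] at this
        exact this.1
      exact ((hd s this).mul (hWd s)).differentiableWithinAt)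
  have r1 : ((σ : ℂ) + (T - 1 : ℝ) * Complex.I).re = σ := by simp
  have r2 : ((σ : ℂ) + (T - 1 : ℝ) * Complex.I).im = T - 1 := by simp
  have r3 : ((2 : ℂ) + (T + 1 : ℝ) * Complex.I).re = 2 := by simp
  have r4 : ((2 : ℂ) + (T + 1 : ℝ) * Complex.I).im = T + 1 := by simp
  rw [r1, r2, r3, r4] at hrect
  have hcont : ∀ g : ℝ → ℂ, Continuous g → ∀ a b : ℝ, (∀ x ∈ uIcc a b, σ ≤ (g x).re) →
      ContinuousOn (fun x => H (g x)) (uIcc a b) := by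
    intro g hg a b h x hx
    exact ((hd (g x) (h x hx)).continuousAt.comp hg.continuousAt).continuousWithinAt
  have hbot : ∀ x : ℝ, W (x + (T - 1 : ℝ) * Complex.I) =
      -((Real.sinh (π / 2 * (x - σ)) : ℝ) * Complex.I) := by
    intro x
    have e : (π / 2 * ((x : ℂ) + (T - 1 : ℝ) * Complex.I - σ - T * Complex.I) : ℂ) =
        ((π / 2 * (x - σ) : ℝ) : ℂ) - (π / 2 : ℂ) * Complex.I := by
      push_cast; ring
    rw [hW]
    simp only
    rw [e, Complex.cosh_sub, Complex.cosh_mul_I, Complex.sinh_mul_I, Complex.cos_pi_div_two,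
      Complex.sin_pi_div_two]
    push_cast
    ring
  have htop : ∀ x : ℝ, W (x + (T + 1 : ℝ) * Complex.I) =
      ((Real.sinh (π / 2 * (x - σ)) : ℝ) * Complex.I) := by
    intro x
    have e : (π / 2 * ((x : ℂ) + (T + 1 : ℝ) * Complex.I - σ - T * Complex.I) : ℂ) =
        ((π / 2 * (x - σ) : ℝ) : ℂ) + (π / 2 : ℂ) * Complex.I := by
      push_cast; ring
    rw [hW]
    simp only
    rw [e, Complex.cosh_add, Complex.cosh_mul_I, Complex.sinh_mul_I, Complex.cos_pi_div_two,
      Complex.sin_pi_div_two]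
    push_cast
    ring
  have hleft : ∀ y : ℝ, W (σ + y * Complex.I) = ((Real.cos (π / 2 * (y - T)) : ℝ) : ℂ) := by
    intro y
    have e : (π / 2 * ((σ : ℂ) + y * Complex.I - σ - T * Complex.I) : ℂ) =
        ((π / 2 * (y - T) : ℝ) : ℂ) * Complex.I := by
      push_cast; ring
    rw [hW]
    simp only
    rw [e, Complex.cosh_mul_I, Complex.ofReal_cos]
  have hright : ∀ y : ℝ, ‖W (2 + y * Complex.I)‖ ≤ Real.cosh (π / 2 * (2 - σ)) := by
    intro y
    have e : (π / 2 * ((2 : ℂ) + y * Complex.I - σ - T * Complex.I) : ℂ) =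
        ((π / 2 * (2 - σ) : ℝ) : ℂ) + ((π / 2 * (y - T) : ℝ) : ℂ) * Complex.I := by
      push_cast; ring
    rw [hW]
    simp only
    rw [e, Complex.cosh, Real.cosh_eq, norm_div]
    refine (div_le_div_of_nonneg_right (norm_add_le _ _) (norm_nonneg _)).trans ?_
    rw [Complex.norm_exp, Complex.norm_exp]
    simp
  have hib : IntervalIntegrable (fun x : ℝ => H (x + (T - 1 : ℝ) * Complex.I) *
      W (x + (T - 1 : ℝ) * Complex.I)) MeasureTheory.volume σ 2 := by
    refine ContinuousOn.intervalIntegrable ((hcont _ (by fun_prop) _ _ ?_).mul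
      (hWd.continuous.comp (by fun_prop)).continuousOn)
    intro x hx
    rw [uIcc_of_le hσ.le] at hx
    simpa using hx.1
  have hit : IntervalIntegrable (fun x : ℝ => H (x + (T + 1 : ℝ) * Complex.I) *
      W (x + (T + 1 : ℝ) * Complex.I)) MeasureTheory.volume σ 2 := by
    refine ContinuousOn.intervalIntegrable ((hcont _ (by fun_prop) _ _ ?_).mul
      (hWd.continuous.comp (by fun_prop)).continuousOn)
    intro x hx
    rw [uIcc_of_le hσ.le] at hx
    simpa using hx.1
  have hil : ∀ a b : ℝ, IntervalIntegrable (fun y : ℝ => H (σ + y * Complex.I) *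
      W (σ + y * Complex.I)) MeasureTheory.volume a b := by
    intro a b
    refine ContinuousOn.intervalIntegrable ((hcont _ (by fun_prop) _ _ ?_).mul
      (hWd.continuous.comp (by fun_prop)).continuousOn)
    intro x hx
    simp
  have him := congrArg Complex.im hrect
  have hre_int : ∀ (g : ℝ → ℂ) (a b : ℝ), IntervalIntegrable g MeasureTheory.volume a b →
      (∫ x in a..b, g x).re = ∫ x in a..b, (g x).re := fun g a b hg =>
    (Complex.reCLM.intervalIntegral_comp_comm hg).symm
  have him_int : ∀ (g : ℝ → ℂ) (a b : ℝ), IntervalIntegrable g MeasureTheory.volume a b →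
      (∫ x in a..b, g x).im = ∫ x in a..b, (g x).im := fun g a b hg =>
    (Complex.imCLM.intervalIntegral_comp_comm hg).symm
  simp only [smul_eq_mul, Complex.sub_im, Complex.add_im, Complex.mul_im, Complex.I_re,
    Complex.I_im, zero_mul, one_mul, zero_add, Complex.zero_im] at him
  rw [him_int _ _ _ hib, him_int _ _ _ hit] at him
  rw [show ((2 : ℝ) : ℂ) = 2 by norm_num] at him
  have hb_nonpos : ∫ x in σ..2, (H (x + (T - 1 : ℝ) * Complex.I) *
      W (x + (T - 1 : ℝ) * Complex.I)).im ≤ 0 := by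
    rw [← neg_nonneg, ← intervalIntegral.integral_neg]
    refine intervalIntegral.integral_nonneg hσ.le fun x hx => ?_
    rw [hbot]
    have h1 := hpos (x + (T - 1 : ℝ) * Complex.I) (by simpa using hx.1)
    have h2 : 0 ≤ Real.sinh (π / 2 * (x - σ)) := Real.sinh_nonneg_iff.2
      (mul_nonneg (by positivity) (by linarith [hx.1]))
    generalize Real.sinh (π / 2 * (x - σ)) = r at h2 ⊢
    simpa using mul_nonneg h1 h2
  have ht_nonneg : 0 ≤ ∫ x in σ..2, (H (x + (T + 1 : ℝ) * Complex.I) *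
      W (x + (T + 1 : ℝ) * Complex.I)).im := by
    refine intervalIntegral.integral_nonneg hσ.le fun x hx => ?_
    rw [htop]
    have h1 := hpos (x + (T + 1 : ℝ) * Complex.I) (by simpa using hx.1)
    have h2 : 0 ≤ Real.sinh (π / 2 * (x - σ)) := Real.sinh_nonneg_iff.2
      (mul_nonneg (by positivity) (by linarith [hx.1]))
    generalize Real.sinh (π / 2 * (x - σ)) = r at h2 ⊢
    simpa using mul_nonneg h1 h2
  have hr_le : (∫ y in (T - 1)..(T + 1), H (2 + y * Complex.I) * W (2 + y * Complex.I)).re ≤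
      2 * B * Real.cosh (π / 2 * (2 - σ)) := by
    refine (Complex.re_le_norm _).trans ?_
    refine (intervalIntegral.norm_integral_le_of_norm_le_const
      (C := B * Real.cosh (π / 2 * (2 - σ))) ?_).trans ?_
    · intro y hy
      rw [uIoc_of_le (by linarith)] at hy
      rw [norm_mul]
      exact mul_le_mul (hB y ⟨hy.1.le, hy.2⟩) (hright y) (norm_nonneg _)
        ((norm_nonneg _).trans (hB y ⟨hy.1.le, hy.2⟩))
    · rw [show T + 1 - (T - 1) = 2 by ring]
      norm_num
      apply le_of_eq
      ring
  have hl_ge : (∫ y in (T - 1 / 2)..(T + 1 / 2), (H (σ + y * Complex.I)).re) / 2 ≤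
      (∫ y in (T - 1)..(T + 1), H (σ + y * Complex.I) * W (σ + y * Complex.I)).re := by
    rw [hre_int _ _ _ (hil _ _), ← intervalIntegral.integral_div]
    have h_int : ∀ a b : ℝ, IntervalIntegrable (fun y : ℝ => (H (σ + y * Complex.I) *
      W (σ + y * Complex.I)).re) MeasureTheory.volume a b := fun a b =>
      ⟨(hil a b).1.re, (hil a b).2.re⟩
    have hc : Continuous fun y : ℝ => (H (σ + y * Complex.I)).re := by
      rw [continuous_iff_continuousAt]
      intro y
      exact Complex.continuous_re.continuousAt.comp
        (ContinuousAt.comp (g := H) (f := fun y : ℝ => (σ : ℂ) + y * Complex.I)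
          (hd _ (by simp)).continuousAt (by fun_prop))
    calc ∫ y in (T - 1 / 2)..(T + 1 / 2), (H (σ + y * Complex.I)).re / 2
        ≤ ∫ y in (T - 1 / 2)..(T + 1 / 2), (H (σ + y * Complex.I) *
            W (σ + y * Complex.I)).re := by
          refine intervalIntegral.integral_mono_on (by linarith)
            ((hc.div_const _).intervalIntegrable _ _) (h_int _ _) fun y hy => ?_
          rw [hleft, Complex.re_mul_ofReal, div_eq_mul_inv]
          refine mul_le_mul_of_nonneg_left ?_ (hpos _ (by simp))
          have h1 : |π / 2 * (y - T)| ≤ π / 3 := by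
            rw [abs_mul, abs_of_pos (by positivity)]
            have : |y - T| ≤ 1 / 2 := abs_le.2 ⟨by linarith [hy.1], by linarith [hy.2]⟩
            nlinarith [Real.pi_pos]
          have h2 := Real.cos_le_cos_of_nonneg_of_le_pi (abs_nonneg _)
            (by linarith [Real.pi_pos]) h1
          rw [Real.cos_abs, Real.cos_pi_div_three] at h2
          linarith
      _ ≤ _ := by
          refine intervalIntegral.integral_mono_interval (by linarith) (by linarith) (by linarith)
            ?_ (h_int _ _)
          filter_upwards [MeasureTheory.ae_restrict_mem measurableSet_Ioc] with y hy
          rw [hleft, Complex.re_mul_ofReal]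
          refine mul_nonneg (hpos _ (by simp)) (Real.cos_nonneg_of_mem_Icc ⟨?_, ?_⟩)
          · nlinarith [Real.pi_pos, hy.1]
          · nlinarith [Real.pi_pos, hy.2]
  linarith

theorem RiemannHypothesis.exists_integral_abs_re_logDeriv_le (hRH : RiemannHypothesis) :
    ∃ C : ℝ, 0 < C ∧ ∀ σ : ℝ, 1 / 2 < σ → σ ≤ 1 → ∀ T : ℝ,
      ∫ y in (T - 1 / 2)..(T + 1 / 2), |(logDeriv riemannZeta₁ (σ + y * Complex.I)).re| ≤
        C * Real.log (2 + |T|) := by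
  obtain ⟨C₁, hC₁, h₁⟩ := hRH.exists_norm_logDeriv_xiFun_sub_le
  obtain ⟨C₂, hC₂, h₂⟩ := hRH.exists_norm_logDeriv_riemannZeta₁_le one_pos le_rfl
  have hl : ∀ y T : ℝ, |y - T| ≤ 1 → Real.log (2 + |y|) ≤ 2 * Real.log (2 + |T|) := by
    intro y T h
    refine log_le_two_mul_log_two_add_abs (by positivity) ?_
    have := abs_sub_abs_le_abs_sub y T
    linarith [abs_nonneg T]
  refine ⟨4 * ((C₁ + C₂) * 2) * Real.cosh (π / 2 * (3 / 2)) + C₁ * 2, by positivity,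
    fun σ hσ hσ1 T => ?_⟩
  have hd : ∀ s : ℂ, σ ≤ s.re → DifferentiableAt ℂ (logDeriv xiFun) s := by
    intro s hs
    have hopen : IsOpen {z : ℂ | 0 < z.re} := isOpen_lt continuous_const Complex.continuous_re
    have hdo : DifferentiableOn ℂ xiFun {z : ℂ | 0 < z.re} := fun z hz =>
      (differentiableAt_xiFun hz).differentiableWithinAt
    have hm : {z : ℂ | 0 < z.re} ∈ nhds s :=
      hopen.mem_nhds (show 0 < s.re by linarith)
    exact ((hdo.deriv hopen).differentiableAt hm).div (hdo.differentiableAt hm)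
      (hRH.xiFun_ne_zero (by linarith))
  have hdf : ∀ s : ℂ, σ ≤ s.re → DifferentiableAt ℂ (logDeriv riemannZeta₁) s := by
    intro s hs
    exact (differentiable_riemannZeta₁.differentiableOn.deriv isOpen_univ).differentiableAt
      univ_mem |>.div (differentiable_riemannZeta₁ s) (hRH.riemannZeta₁_ne_zero (by linarith))
  have hcont : ∀ F : ℂ → ℂ, (∀ s : ℂ, σ ≤ s.re → DifferentiableAt ℂ F s) →
      Continuous fun y : ℝ => (F (σ + y * Complex.I)).re := by
    intro F hF
    rw [continuous_iff_continuousAt]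
    intro y
    exact Complex.continuous_re.continuousAt.comp
      (ContinuousAt.comp (g := F) (f := fun y : ℝ => (σ : ℂ) + y * Complex.I)
        (hF _ (by simp)).continuousAt (by fun_prop))
  have hmain := integral_re_le_of_re_nonneg (H := logDeriv xiFun) (σ := σ) (T := T)
    (B := (C₁ + C₂) * (2 * Real.log (2 + |T|))) (by linarith) hd
    (fun s hs => hRH.re_logDeriv_xiFun_nonneg (by linarith)) (by
      intro y hy
      have e1 := h₁ (2 + y * Complex.I) (by simp; norm_num) (by simp)
      have e2 := h₂ (2 + y * Complex.I) (by simp; norm_num) (by simp)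
      have e3 : (2 + y * Complex.I : ℂ).im = y := by simp
      rw [e3] at e1 e2
      have e4 := hl y T (abs_le.2 ⟨by linarith [hy.1], by linarith [hy.2]⟩)
      have e5 := norm_add_le (logDeriv xiFun (2 + y * Complex.I) -
        logDeriv riemannZeta₁ (2 + y * Complex.I)) (logDeriv riemannZeta₁ (2 + y * Complex.I))
      rw [sub_add_cancel] at e5
      have e6 : (C₁ + C₂) * Real.log (2 + |y|) ≤ (C₁ + C₂) * (2 * Real.log (2 + |T|)) := by
        gcongr
      linarith)
  have hpt : ∀ y ∈ Icc (T - 1 / 2) (T + 1 / 2),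
      |(logDeriv riemannZeta₁ (σ + y * Complex.I)).re| ≤
      (logDeriv xiFun (σ + y * Complex.I)).re + C₁ * (2 * Real.log (2 + |T|)) := by
    intro y hy
    have e1 := h₁ (σ + y * Complex.I) (by simpa using hσ) (by simp; linarith)
    have e3 : (σ + y * Complex.I : ℂ).im = y := by simp
    rw [e3] at e1
    have e4 := hl y T (abs_le.2 ⟨by linarith [hy.1], by linarith [hy.2]⟩)
    have e5 : C₁ * Real.log (2 + |y|) ≤ C₁ * (2 * Real.log (2 + |T|)) := by gcongr
    have e6 := (Complex.abs_re_le_norm _).trans e1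
    rw [Complex.sub_re, abs_le] at e6
    have e7 := hRH.re_logDeriv_xiFun_nonneg (s := σ + y * Complex.I) (by simpa using hσ)
    rw [abs_le]
    constructor <;> linarith [e6.1, e6.2]
  have h_int := intervalIntegral.integral_mono_on (by linarith : T - 1 / 2 ≤ T + 1 / 2)
    ((hcont _ hdf).abs.intervalIntegrable (μ := MeasureTheory.volume) _ _)
    (((hcont _ hd).add continuous_const).intervalIntegrable (μ := MeasureTheory.volume) _ _) hpt
  refine h_int.trans ?_
  simp only [Pi.add_apply]
  rw [intervalIntegral.integral_add ((hcont _ hd).intervalIntegrable _ _)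
    (continuous_const.intervalIntegrable _ _), intervalIntegral.integral_const]
  have hl0 := half_lt_log_two_add_abs T
  have hcosh : Real.cosh (π / 2 * (2 - σ)) ≤ Real.cosh (π / 2 * (3 / 2)) := by
    rw [Real.cosh_le_cosh, abs_of_nonneg (by have := Real.pi_pos; apply mul_nonneg <;> linarith),
      abs_of_nonneg (by positivity)]
    have := Real.pi_pos
    gcongr
    linarith
  have hfin : 4 * ((C₁ + C₂) * (2 * Real.log (2 + |T|))) * Real.cosh (π / 2 * (2 - σ)) ≤
      4 * ((C₁ + C₂) * (2 * Real.log (2 + |T|))) * Real.cosh (π / 2 * (3 / 2)) := by gcongr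
  rw [show T + 1 / 2 - (T - 1 / 2) = 1 by ring, one_smul]
  linarith

/-- The triangle function of height and half-width `U`. -/
noncomputable def tent (U v : ℝ) : ℝ := max 0 (U - |v|)

/-- The entire function `(2 sinh (U z / 2) / z) ^ 2`, the two-sided Laplace transform of `tent U`. -/
noncomputable def fejerKernel (U : ℝ) (z : ℂ) : ℂ :=
  dslope (fun z : ℂ => 2 * Complex.sinh (U * z / 2)) 0 z ^ 2

theorem continuous_tent (U : ℝ) : Continuous (tent U) := by
  unfold tent
  fun_prop

theorem tent_of_le {U v : ℝ} (h : |v| ≤ U) : tent U v = U - |v| := max_eq_right (by linarith)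

theorem tent_of_ge {U v : ℝ} (h : U ≤ |v|) : tent U v = 0 := max_eq_left (by linarith)

theorem differentiable_fejerKernel (U : ℝ) : Differentiable ℂ (fejerKernel U) := by
  have h : DifferentiableOn ℂ (dslope (fun z : ℂ => 2 * Complex.sinh (U * z / 2)) 0) univ := by
    rw [Complex.differentiableOn_dslope univ_mem]
    fun_prop
  exact (differentiableOn_univ.1 h).pow 2

theorem fejerKernel_of_ne {U : ℝ} {z : ℂ} (hz : z ≠ 0) :
    fejerKernel U z = 2 * (Complex.cosh (U * z) - 1) / z ^ 2 := by
  rw [fejerKernel, dslope_of_ne _ hz, slope_def_field]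
  have h : Complex.cosh (U * z) = 1 + 2 * Complex.sinh (U * z / 2) ^ 2 := by
    conv_lhs => rw [show (U * z : ℂ) = 2 * (U * z / 2) by ring, Complex.cosh_two_mul,
      Complex.cosh_sq]
    ring
  rw [h]
  simp
  ring

theorem exists_norm_fejerKernel_le (U : ℝ) : ∃ B : ℝ, 0 < B ∧ ∀ z : ℂ, 0 ≤ z.re → z.re ≤ 2 →
    ‖fejerKernel U z‖ ≤ B * (1 + z.im ^ 2)⁻¹ := by
  have hK : IsCompact (Icc (0 : ℝ) 2 ×ℂ Icc (-1 : ℝ) 1) := isCompact_Icc.reProdIm isCompact_Icc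
  obtain ⟨M, hM⟩ := hK.exists_bound_of_continuousOn
    (differentiable_fejerKernel U).continuous.continuousOn
  refine ⟨2 * |M| + 8 * Real.exp (2 * |U|), by positivity, fun z h0 h2 => ?_⟩
  have hpos : (0 : ℝ) < 1 + z.im ^ 2 := by positivity
  rw [← div_eq_mul_inv, le_div_iff₀ hpos]
  rcases le_total |z.im| 1 with h | h
  · have h1 := (hM z ⟨⟨h0, h2⟩, abs_le.1 h⟩).trans (le_abs_self M)
    have h3 : 1 + z.im ^ 2 ≤ 2 := by
      have := (sq_le_one_iff_abs_le_one z.im).2 h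
      linarith
    calc ‖fejerKernel U z‖ * (1 + z.im ^ 2) ≤ |M| * 2 := by gcongr
      _ ≤ _ := by linarith [Real.exp_pos (2 * |U|)]
  · have hz : z ≠ 0 := by
      rintro rfl
      norm_num at h
    rw [fejerKernel_of_ne hz, norm_div, norm_pow, norm_mul]
    have hsq : 1 ≤ z.im ^ 2 := (one_le_sq_iff_one_le_abs z.im).2 h
    have hzn : z.im ^ 2 ≤ ‖z‖ ^ 2 := by
      rw [← sq_abs]
      gcongr
      exact Complex.abs_im_le_norm z
    have hexp : ∀ w : ℂ, |w.re| ≤ 2 * |U| → ‖Complex.exp w‖ ≤ Real.exp (2 * |U|) := by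
      intro w hw
      rw [Complex.norm_exp]
      exact Real.exp_le_exp.2 ((le_abs_self _).trans hw)
    have hre : |(U * z).re| ≤ 2 * |U| := by
      rw [Complex.re_ofReal_mul, abs_mul, abs_of_nonneg h0]
      nlinarith [abs_nonneg U]
    have hcosh : ‖Complex.cosh (U * z)‖ ≤ Real.exp (2 * |U|) := by
      rw [Complex.cosh, norm_div, Complex.norm_two, div_le_iff₀ two_pos]
      refine (norm_add_le _ _).trans ?_
      have e1 := hexp _ hre
      have e2 := hexp (-(U * z)) (by rwa [Complex.neg_re, abs_neg])
      linarith
    have h1 : 1 ≤ Real.exp (2 * |U|) := Real.one_le_exp (by positivity)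
    have h3 : ‖Complex.cosh (U * z) - 1‖ ≤ 2 * Real.exp (2 * |U|) := by
      refine (norm_sub_le _ _).trans ?_
      rw [norm_one]
      linarith
    have hzp : 0 < ‖z‖ ^ 2 := by linarith
    rw [div_mul_eq_mul_div, div_le_iff₀ hzp, Complex.norm_two]
    calc 2 * ‖Complex.cosh (U * z) - 1‖ * (1 + z.im ^ 2)
        ≤ 2 * (2 * Real.exp (2 * |U|)) * (2 * ‖z‖ ^ 2) := by
          gcongr
          linarith
      _ = 8 * Real.exp (2 * |U|) * ‖z‖ ^ 2 := by ring
      _ ≤ _ := by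
          gcongr
          linarith [abs_nonneg M]

theorem integral_tent_mul_cexp {U : ℝ} (hU : 0 ≤ U) {z : ℂ} (hz : z ≠ 0) :
    ∫ v : ℝ, (tent U v : ℂ) * Complex.exp (z * v) = fejerKernel U z := by
  have hc : Continuous fun v : ℝ => (tent U v : ℂ) * Complex.exp (z * v) := by
    have := continuous_tent U
    fun_prop
  have hsupp : ∫ v : ℝ, (tent U v : ℂ) * Complex.exp (z * v) =
      ∫ v in (-U)..U, (tent U v : ℂ) * Complex.exp (z * v) := by
    rw [intervalIntegral.integral_eq_integral_of_support_subset]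
    intro v hv
    by_contra h
    apply hv
    beta_reduce
    rw [tent_of_ge]
    · simp
    · by_contra! h'
      rw [abs_lt] at h'
      exact h ⟨h'.1, h'.2.le⟩
  rw [hsupp, ← intervalIntegral.integral_add_adjacent_intervals
    (hc.intervalIntegrable (-U) 0) (hc.intervalIntegrable 0 U)]
  have hexp : ∀ v : ℝ, HasDerivAt (fun v : ℝ => Complex.exp (z * v))
      (Complex.exp (z * v) * z) v := by
    intro v
    have := ((hasDerivAt_id (v : ℂ)).const_mul z).cexp.comp_ofReal
    simpa using this
  have h1 : ∫ v in (0 : ℝ)..U, (tent U v : ℂ) * Complex.exp (z * v) =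
      ((U - U) * Complex.exp (z * U) / z + Complex.exp (z * U) / z ^ 2) -
        ((U - 0) * Complex.exp (z * 0) / z + Complex.exp (z * 0) / z ^ 2) := by
    have : ∀ v ∈ uIcc 0 U, HasDerivAt
        (fun v : ℝ => (U - v : ℂ) * Complex.exp (z * v) / z + Complex.exp (z * v) / z ^ 2)
        ((tent U v : ℂ) * Complex.exp (z * v)) v := by
      intro v hv
      rw [uIcc_of_le hU] at hv
      rw [tent_of_le (by rw [abs_of_nonneg hv.1]; exact hv.2), abs_of_nonneg hv.1]
      convert! ((((hasDerivAt_id v).ofReal_comp.const_sub (U : ℂ)).mul (hexp v)).div_const z).add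
        ((hexp v).div_const (z ^ 2)) using 1
      simp
      field_simp
      ring
    have h := intervalIntegral.integral_eq_sub_of_hasDerivAt this (hc.intervalIntegrable 0 U)
    simpa using h
  have h2 : ∫ v in (-U)..0, (tent U v : ℂ) * Complex.exp (z * v) =
      ((U + 0) * Complex.exp (z * 0) / z - Complex.exp (z * 0) / z ^ 2) -
        ((U + (-U)) * Complex.exp (z * (-U)) / z - Complex.exp (z * (-U)) / z ^ 2) := by
    have : ∀ v ∈ uIcc (-U) 0, HasDerivAt
        (fun v : ℝ => (U + v : ℂ) * Complex.exp (z * v) / z - Complex.exp (z * v) / z ^ 2)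
        ((tent U v : ℂ) * Complex.exp (z * v)) v := by
      intro v hv
      rw [uIcc_of_le (by linarith)] at hv
      rw [tent_of_le (by rw [abs_of_nonpos hv.2]; linarith [hv.1]), abs_of_nonpos hv.2]
      convert! ((((hasDerivAt_id v).ofReal_comp.const_add (U : ℂ)).mul (hexp v)).div_const z).sub
        ((hexp v).div_const (z ^ 2)) using 1
      simp
      field_simp
      ring
    have h := intervalIntegral.integral_eq_sub_of_hasDerivAt this (hc.intervalIntegrable (-U) 0)
    simpa using h
  rw [h1, h2, fejerKernel_of_ne hz, Complex.cosh]
  simp only [mul_zero, Complex.exp_zero]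
  rw [show (z * -U : ℂ) = -(U * z) by ring, show (z * U : ℂ) = U * z by ring]
  field_simp
  ring

theorem integrable_fejerKernel (U : ℝ) {a : ℝ} (ha : 0 ≤ a) (ha2 : a ≤ 2) :
    MeasureTheory.Integrable fun t : ℝ => fejerKernel U (a + t * Complex.I) := by
  obtain ⟨B, hB, h⟩ := exists_norm_fejerKernel_le U
  refine (integrable_inv_one_add_sq.const_mul B).mono'
    ((differentiable_fejerKernel U).continuous.comp (by fun_prop)).aestronglyMeasurable ?_
  refine Eventually.of_forall fun t => ?_
  simpa using h (a + t * Complex.I) (by simpa using ha) (by simpa using ha2)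

theorem integral_cexp_mul_fejerKernel {U a : ℝ} (hU : 0 ≤ U) (ha : 0 < a) (ha2 : a ≤ 2) (v : ℝ) :
    ∫ t : ℝ, Complex.exp (-(t * v) * Complex.I) * fejerKernel U (a + t * Complex.I) =
      2 * π * (Real.exp (a * v) * tent U v) := by
  set f : ℝ → ℂ := fun v => (Real.exp (a * v) * tent U v : ℝ) with hf
  have hfc : Continuous f := by
    have := continuous_tent U
    fun_prop
  have hF : FourierTransform.fourier f =
      fun w : ℝ => fejerKernel U (a + (-2 * π * w : ℝ) * Complex.I) := by
    ext w
    rw [Real.fourier_real_eq_integral_exp_smul, ← integral_tent_mul_cexp hU]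
    · refine MeasureTheory.integral_congr_ae (Eventually.of_forall fun v => ?_)
      simp only [hf, smul_eq_mul]
      push_cast
      rw [← mul_assoc, ← Complex.exp_add, mul_comm]
      congr 2
      ring
    · intro h
      have := congrArg Complex.re h
      simp at this
      linarith
  have hfi : MeasureTheory.Integrable f := by
    refine hfc.integrable_of_hasCompactSupport ?_
    refine HasCompactSupport.of_support_subset_isCompact (isCompact_Icc (a := -U) (b := U)) ?_
    intro v hv
    by_contra h
    apply hv
    simp only [hf]
    rw [tent_of_ge]
    · simp
    · by_contra! h'
      exact h (abs_le.1 h'.le)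
  have hFi : MeasureTheory.Integrable (FourierTransform.fourier f) := by
    rw [hF]
    exact (integrable_fejerKernel U ha.le ha2).comp_mul_left' (R := -2 * π)
      (by simp [Real.pi_ne_zero])
  have hinv := congrFun (hfc.fourierInv_fourier_eq hfi hFi) v
  rw [Real.fourierInv_eq', hF] at hinv
  have hsub := MeasureTheory.Measure.integral_comp_mul_left
    (fun t : ℝ => Complex.exp (-(t * v) * Complex.I) * fejerKernel U (a + t * Complex.I)) (-2 * π)
  have hlhs : (∫ x : ℝ, Complex.exp (-(((-2 * π * x : ℝ) : ℂ) * v) * Complex.I) *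
      fejerKernel U (a + (-2 * π * x : ℝ) * Complex.I)) = f v := by
    rw [← hinv]
    refine MeasureTheory.integral_congr_ae (Eventually.of_forall fun w => ?_)
    simp only [smul_eq_mul]
    congr 2
    simp
    ring
  rw [hlhs] at hsub
  have habs : |(-2 * π)⁻¹| = (2 * π)⁻¹ := by
    rw [abs_inv, abs_mul, abs_neg, abs_two, abs_of_pos Real.pi_pos]
  rw [habs, Complex.real_smul] at hsub
  have hpi : (π : ℂ) ≠ 0 := by exact_mod_cast Real.pi_ne_zero
  simp only [hf] at hsub
  push_cast at hsub ⊢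
  rw [hsub, ← mul_assoc, mul_inv_cancel₀ (mul_ne_zero two_ne_zero hpi), one_mul]

theorem neg_logDeriv_riemannZeta₁_eq {s : ℂ} (hs : 1 < s.re) :
    -logDeriv riemannZeta₁ s =
      LSeries (fun n => (ArithmeticFunction.vonMangoldt n : ℂ)) s - 1 / (s - 1) := by
  have hs1 : s ≠ 1 := by
    rintro rfl
    simp at hs
  have hsub : s - 1 ≠ 0 := sub_ne_zero.2 hs1
  have hz := riemannZeta_ne_zero_of_one_lt_re hs
  have hev : riemannZeta₁ =ᶠ[nhds s] fun w => (w - 1) * riemannZeta w := by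
    filter_upwards [isOpen_ne.mem_nhds hs1] with w hw
    exact riemannZeta₁_eq_of_ne hw
  rw [logDeriv_apply, hev.deriv_eq, hev.eq_of_nhds, ← logDeriv_apply (fun w => (w - 1) * riemannZeta w),
    logDeriv_mul (f := fun w => w - 1) s hsub hz (by fun_prop) (differentiableAt_riemannZeta hs1),
    ArithmeticFunction.LSeries_vonMangoldt_eq_deriv_riemannZeta_div hs]
  simp [logDeriv_apply]
  ring

theorem integral_LSeries_vonMangoldt_mul_fejerKernel {U a : ℝ} (hU : 0 ≤ U) (ha : 0 < a)
    (ha2 : a ≤ 2) {N : ℕ} (hN : Real.exp U ≤ N) :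
    MeasureTheory.Integrable (fun t : ℝ =>
      LSeries (fun n => (ArithmeticFunction.vonMangoldt n : ℂ)) (2 + t * Complex.I) *
        fejerKernel U (a + t * Complex.I)) ∧
    ∫ t : ℝ, LSeries (fun n => (ArithmeticFunction.vonMangoldt n : ℂ)) (2 + t * Complex.I) *
      fejerKernel U (a + t * Complex.I) =
    2 * π * (∑ n ∈ Finset.range N, ArithmeticFunction.vonMangoldt n * (n : ℝ) ^ (a - 2) *
      tent U (Real.log n) : ℝ) := by
  have hK := integrable_fejerKernel U ha.le ha2
  have hsum : Summable fun n : ℕ => ArithmeticFunction.vonMangoldt n * (n : ℝ) ^ (-2 : ℝ) := by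
    have h := (ArithmeticFunction.LSeriesSummable_vonMangoldt (s := 2) (by norm_num)).norm
    refine h.congr fun n => ?_
    rcases eq_or_ne n 0 with rfl | hn
    · simp
    · rw [LSeries.norm_term_eq, if_neg hn]
      simp [abs_of_nonneg ArithmeticFunction.vonMangoldt_nonneg, div_eq_mul_inv]
  have hterm : ∀ (n : ℕ) (t : ℝ),
      LSeries.term (fun n => (ArithmeticFunction.vonMangoldt n : ℂ)) (2 + t * Complex.I) n =
      (ArithmeticFunction.vonMangoldt n * (n : ℝ) ^ (-2 : ℝ) : ℝ) *
        Complex.exp (-(t * Real.log n) * Complex.I) := by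
    intro n t
    rcases eq_or_ne n 0 with rfl | hn
    · simp
    · have hn0 : (n : ℂ) ≠ 0 := by exact_mod_cast hn
      rw [LSeries.term_of_ne_zero hn, div_eq_mul_inv, ← Complex.cpow_neg, neg_add,
        Complex.cpow_add _ _ hn0, Complex.cpow_def_of_ne_zero hn0 (-(t * Complex.I)),
        ← Complex.natCast_log]
      push_cast
      rw [Complex.ofReal_cpow (by positivity)]
      push_cast
      rw [mul_assoc]
      congr 3
      ring
  have hexp : ∀ x y : ℝ, ‖Complex.exp (-(x * y) * Complex.I)‖ = 1 := fun x y => by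
    rw [← Complex.ofReal_mul, ← Complex.ofReal_neg, Complex.norm_exp_ofReal_mul_I]
  have h_int : ∀ n : ℕ, MeasureTheory.Integrable (fun t : ℝ =>
      LSeries.term (fun n => (ArithmeticFunction.vonMangoldt n : ℂ)) (2 + t * Complex.I) n *
        fejerKernel U (a + t * Complex.I)) := by
    intro n
    simp_rw [hterm]
    refine hK.bdd_mul (c := ArithmeticFunction.vonMangoldt n * (n : ℝ) ^ (-2 : ℝ))
      (Continuous.aestronglyMeasurable (by fun_prop)) (Eventually.of_forall fun t => ?_)
    rw [norm_mul, Complex.norm_real, Real.norm_of_nonneg (mul_nonneg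
      ArithmeticFunction.vonMangoldt_nonneg (by positivity)), hexp, mul_one]
  have hnorm : ∀ n : ℕ, ∫ t : ℝ,
      ‖LSeries.term (fun n => (ArithmeticFunction.vonMangoldt n : ℂ)) (2 + t * Complex.I) n *
        fejerKernel U (a + t * Complex.I)‖ = ArithmeticFunction.vonMangoldt n * (n : ℝ) ^ (-2 : ℝ) *
        ∫ t : ℝ, ‖fejerKernel U (a + t * Complex.I)‖ := by
    intro n
    rw [← MeasureTheory.integral_const_mul]
    refine MeasureTheory.integral_congr_ae (Eventually.of_forall fun t => ?_)
    simp only [hterm]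
    rw [norm_mul, norm_mul, Complex.norm_real, Real.norm_of_nonneg (mul_nonneg
      ArithmeticFunction.vonMangoldt_nonneg (by positivity)), hexp, mul_one]
  have hsn : Summable fun n : ℕ => ∫ t : ℝ,
      ‖LSeries.term (fun n => (ArithmeticFunction.vonMangoldt n : ℂ)) (2 + t * Complex.I) n *
        fejerKernel U (a + t * Complex.I)‖ := by
    simp_rw [hnorm]
    exact hsum.mul_right _
  have hs := MeasureTheory.hasSum_integral_of_summable_integral_norm h_int hsn
  simp_rw [tsum_mul_right] at hs
  refine ⟨?_, ?_⟩
  · refine hK.bdd_mul (c := ∑' n : ℕ, ArithmeticFunction.vonMangoldt n * (n : ℝ) ^ (-2 : ℝ))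
      (Continuous.aestronglyMeasurable ?_) (Eventually.of_forall fun t => ?_)
    · have heq : (fun t : ℝ => LSeries (fun n => (ArithmeticFunction.vonMangoldt n : ℂ))
          (2 + t * Complex.I)) = fun t : ℝ => -logDeriv riemannZeta₁ (2 + t * Complex.I) +
            1 / (2 + t * Complex.I - 1) := by
        ext t
        rw [neg_logDeriv_riemannZeta₁_eq (by simp)]
        ring
      rw [heq, continuous_iff_continuousAt]
      intro t
      have hne : riemannZeta₁ (2 + t * Complex.I) ≠ 0 := by
        have h1 := norm_sub_one_le_norm_riemannZeta₁ (s := 2 + t * Complex.I) (by simp)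
        intro h
        rw [h, norm_zero] at h1
        have h2 := Complex.re_le_norm (2 + t * Complex.I - 1)
        norm_num at h2
        linarith
      have hd : DifferentiableAt ℂ (logDeriv riemannZeta₁) (2 + t * Complex.I) :=
        (differentiable_riemannZeta₁.differentiableOn.deriv isOpen_univ).differentiableAt
          univ_mem |>.div (differentiable_riemannZeta₁ _) hne
      refine (ContinuousAt.comp (g := logDeriv riemannZeta₁) (f := fun y : ℝ => 2 + y * Complex.I)
        hd.continuousAt (by fun_prop)).neg.add (ContinuousAt.div continuousAt_const
          (by fun_prop) ?_)
      intro h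
      have := congrArg Complex.re h
      norm_num at this
    · rw [LSeries]
      have h1 : ∀ n : ℕ, ‖LSeries.term (fun n => (ArithmeticFunction.vonMangoldt n : ℂ))
          (2 + t * Complex.I) n‖ = ArithmeticFunction.vonMangoldt n * (n : ℝ) ^ (-2 : ℝ) := by
        intro n
        rw [hterm, norm_mul, Complex.norm_real, Real.norm_of_nonneg (mul_nonneg
          ArithmeticFunction.vonMangoldt_nonneg (by positivity)), hexp, mul_one]
      refine (norm_tsum_le_tsum_norm ?_).trans_eq (tsum_congr h1)
      exact hsum.congr fun n => (h1 n).symm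
  change HasSum _ (∫ t : ℝ, LSeries (fun n => (ArithmeticFunction.vonMangoldt n : ℂ))
    (2 + t * Complex.I) * fejerKernel U (a + t * Complex.I)) at hs
  have hval : ∀ n : ℕ, ∫ t : ℝ,
      LSeries.term (fun n => (ArithmeticFunction.vonMangoldt n : ℂ)) (2 + t * Complex.I) n *
        fejerKernel U (a + t * Complex.I) =
      (2 * π * (ArithmeticFunction.vonMangoldt n * (n : ℝ) ^ (a - 2) *
        tent U (Real.log n)) : ℝ) := by
    intro n
    simp_rw [hterm, mul_assoc]
    rw [MeasureTheory.integral_const_mul]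
    have := integral_cexp_mul_fejerKernel hU ha ha2 (Real.log n)
    simp_rw [mul_assoc] at this
    rw [this]
    rcases eq_or_ne n 0 with rfl | hn
    · simp
    · have hn0 : (0 : ℝ) < n := by positivity
      rw [mul_comm a, ← Real.rpow_def_of_pos hn0, sub_eq_add_neg, Real.rpow_add hn0]
      push_cast
      ring
  rw [← hs.tsum_eq]
  simp_rw [hval]
  rw [← Complex.ofReal_tsum, tsum_eq_sum (s := Finset.range N), ← Finset.mul_sum]
  · push_cast
    ring
  · intro n hn
    rw [Finset.mem_range, not_lt] at hn
    have h1 : Real.exp U ≤ n := hN.trans (by exact_mod_cast hn)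
    have h2 : U ≤ Real.log n := (Real.le_log_iff_exp_le ((Real.exp_pos U).trans_le h1)).2 h1
    rw [tent_of_ge (h2.trans (le_abs_self _))]
    simp

theorem integral_one_div_mul_fejerKernel {U a : ℝ} (hU : 0 ≤ U) (ha : 1 < a) (ha2 : a ≤ 2) :
    MeasureTheory.Integrable (fun t : ℝ => 1 / (2 + t * Complex.I - 1) *
        fejerKernel U (a + t * Complex.I)) ∧
    ∫ t : ℝ, 1 / (2 + t * Complex.I - 1) * fejerKernel U (a + t * Complex.I) =
    2 * π * ((Real.exp ((a - 1) * U) - 1 - (a - 1) * U) / (a - 1) ^ 2 : ℝ) := by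
  have hK := integrable_fejerKernel U (by linarith : 0 ≤ a) ha2
  have hre : ∀ t : ℝ, (2 + t * Complex.I - 1 : ℂ).re = 1 := fun t => by norm_num
  have hE : MeasureTheory.IntegrableOn (fun v : ℝ => Real.exp (-v)) (Ioi 0) :=
    integrableOn_exp_neg_Ioi 0
  have hprod : MeasureTheory.Integrable (Function.uncurry fun (t v : ℝ) =>
      Complex.exp (-(2 + t * Complex.I - 1) * v) * fejerKernel U (a + t * Complex.I))
      (MeasureTheory.volume.prod (MeasureTheory.volume.restrict (Ioi 0))) := by
    refine (hK.mul_prod hE.ofReal).mono (Continuous.aestronglyMeasurable ?_) ?_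
    · have := (differentiable_fejerKernel U).continuous
      unfold Function.uncurry
      fun_prop
    · refine Eventually.of_forall fun p => le_of_eq ?_
      simp [Function.uncurry, Complex.norm_exp]
      ring_nf
  have hinner : ∀ t : ℝ, ∫ v in Ioi (0 : ℝ), Complex.exp (-(2 + t * Complex.I - 1) * v) *
      fejerKernel U (a + t * Complex.I) =
      1 / (2 + t * Complex.I - 1) * fejerKernel U (a + t * Complex.I) := by
    intro t
    rw [MeasureTheory.integral_mul_const, integral_exp_mul_complex_Ioi (by
      rw [Complex.neg_re, hre]; norm_num)]
    rw [Complex.ofReal_zero, mul_zero, Complex.exp_zero, neg_div_neg_eq]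
  have h_int := hprod.integral_prod_left
  simp only [Function.uncurry] at h_int
  simp_rw [hinner] at h_int
  refine ⟨h_int, ?_⟩
  have hswap := MeasureTheory.integral_integral_swap hprod
  simp_rw [hinner] at hswap
  rw [hswap]
  have hval : ∀ v : ℝ, ∫ t : ℝ, Complex.exp (-(2 + t * Complex.I - 1) * v) *
      fejerKernel U (a + t * Complex.I) =
      (2 * π : ℂ) * (Real.exp ((a - 1) * v) * tent U v : ℝ) := by
    intro v
    have h : ∀ t : ℝ, Complex.exp (-(2 + t * Complex.I - 1) * v) *
        fejerKernel U (a + t * Complex.I) = Complex.exp (-v) *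
        (Complex.exp (-(t * v) * Complex.I) * fejerKernel U (a + t * Complex.I)) := by
      intro t
      rw [← mul_assoc, ← Complex.exp_add]
      congr 2
      ring
    simp_rw [h]
    rw [MeasureTheory.integral_const_mul, integral_cexp_mul_fejerKernel hU (by linarith) ha2,
      show (a - 1) * v = -v + a * v by ring, Real.exp_add]
    push_cast
    ring
  simp_rw [hval]
  rw [MeasureTheory.integral_const_mul, integral_complex_ofReal]
  congr 2
  have hsupp : ∫ v in Ioi (0 : ℝ), Real.exp ((a - 1) * v) * tent U v =
      ∫ v in (0 : ℝ)..U, Real.exp ((a - 1) * v) * tent U v := by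
    rw [intervalIntegral.integral_of_le hU]
    refine MeasureTheory.setIntegral_eq_of_subset_of_forall_sdiff_eq_zero measurableSet_Ioi
      Ioc_subset_Ioi_self ?_
    intro v hv
    have h1 : U ≤ |v| := by
      by_contra! h
      exact hv.2 ⟨hv.1, (le_abs_self v).trans h.le⟩
    rw [tent_of_ge h1, mul_zero]
  have hb : a - 1 ≠ 0 := by linarith
  rw [hsupp]
  have hderiv : ∀ v ∈ uIcc 0 U, HasDerivAt (fun v : ℝ => (U - v) * Real.exp ((a - 1) * v) / (a - 1) +
      Real.exp ((a - 1) * v) / (a - 1) ^ 2) (Real.exp ((a - 1) * v) * tent U v) v := by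
    intro v hv
    rw [uIcc_of_le hU] at hv
    rw [tent_of_le (by rw [abs_of_nonneg hv.1]; exact hv.2), abs_of_nonneg hv.1]
    have he : HasDerivAt (fun v : ℝ => Real.exp ((a - 1) * v))
        (Real.exp ((a - 1) * v) * (a - 1)) v := by
      simpa using ((hasDerivAt_id v).const_mul (a - 1)).exp
    convert! ((((hasDerivAt_id v).const_sub U).mul he).div_const (a - 1)).add
      (he.div_const ((a - 1) ^ 2)) using 1
    simp
    field_simp
    ring
  have hc : Continuous fun v : ℝ => Real.exp ((a - 1) * v) * tent U v := by
    have := continuous_tent U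
    fun_prop
  rw [intervalIntegral.integral_eq_sub_of_hasDerivAt hderiv (hc.intervalIntegrable 0 U)]
  simp
  field_simp
  ring

theorem integral_logDeriv_mul_fejerKernel_two {U a : ℝ} (hU : 0 ≤ U) (ha : 1 < a) (ha2 : a ≤ 2)
    {N : ℕ} (hN : Real.exp U ≤ N) :
    ∫ t : ℝ, logDeriv riemannZeta₁ (2 + t * Complex.I) * fejerKernel U (a + t * Complex.I) =
    (2 * π * ((Real.exp ((a - 1) * U) - 1 - (a - 1) * U) / (a - 1) ^ 2 -
      ∑ n ∈ Finset.range N, ArithmeticFunction.vonMangoldt n * (n : ℝ) ^ (a - 2) *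
        tent U (Real.log n)) : ℝ) := by
  obtain ⟨i1, e1⟩ := integral_LSeries_vonMangoldt_mul_fejerKernel hU (by linarith) ha2 hN
  obtain ⟨i2, e2⟩ := integral_one_div_mul_fejerKernel hU ha ha2
  have h : ∀ t : ℝ, logDeriv riemannZeta₁ (2 + t * Complex.I) * fejerKernel U (a + t * Complex.I) =
      1 / (2 + t * Complex.I - 1) * fejerKernel U (a + t * Complex.I) -
      LSeries (fun n => (ArithmeticFunction.vonMangoldt n : ℂ)) (2 + t * Complex.I) *
        fejerKernel U (a + t * Complex.I) := by
    intro t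
    rw [← neg_neg (logDeriv _ _), neg_logDeriv_riemannZeta₁_eq (by simp)]
    ring
  simp_rw [h]
  rw [MeasureTheory.integral_sub i2 i1, e1, e2]
  push_cast
  ring

theorem integral_vertical_line_eq {F : ℂ → ℂ} {σ b : ℝ} (hσb : σ ≤ b)
    (hd : ∀ s : ℂ, σ ≤ s.re → s.re ≤ b → DifferentiableAt ℂ F s) {g : ℝ → ℝ}
    (hg : MeasureTheory.Integrable g) (hg_top : Tendsto g atTop (nhds 0))
    (hg_bot : Tendsto g atBot (nhds 0))
    (hF : ∀ x ∈ Icc σ b, ∀ y : ℝ, ‖F (x + y * Complex.I)‖ ≤ g y) :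
    MeasureTheory.Integrable (fun y : ℝ => F (σ + y * Complex.I)) ∧
      ∫ y : ℝ, F (σ + y * Complex.I) = ∫ y : ℝ, F (b + y * Complex.I) := by
  have h_int : ∀ x ∈ Icc σ b, MeasureTheory.Integrable fun y : ℝ => F (x + y * Complex.I) := by
    intro x hx
    refine hg.mono' (Continuous.aestronglyMeasurable ?_) (Eventually.of_forall (hF x hx))
    rw [continuous_iff_continuousAt]
    intro y
    exact ContinuousAt.comp (g := F) (f := fun y : ℝ => (x : ℂ) + y * Complex.I)
      (hd _ (by simpa using hx.1) (by simpa using hx.2)).continuousAt (by fun_prop)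
  have hσm : σ ∈ Icc σ b := ⟨le_rfl, hσb⟩
  have hbm : b ∈ Icc σ b := ⟨hσb, le_rfl⟩
  refine ⟨h_int σ hσm, ?_⟩
  have hrect : ∀ T : ℝ, (∫ x in σ..b, F (x + (-T : ℝ) * Complex.I)) -
      (∫ x in σ..b, F (x + T * Complex.I)) +
      Complex.I * (∫ y in (-T)..T, F (b + y * Complex.I)) -
      Complex.I * (∫ y in (-T)..T, F (σ + y * Complex.I)) = 0 := by
    intro T
    have h := Complex.integral_boundary_rect_eq_zero_of_differentiableOn F (σ + (-T : ℝ) * Complex.I)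
      (b + T * Complex.I) (by
        intro s hs
        have h1 := hs.1
        simp [uIcc_of_le hσb] at h1
        exact (hd s h1.1 h1.2).differentiableWithinAt)
    simpa using h
  have hl := MeasureTheory.intervalIntegral_tendsto_integral (h_int σ hσm) tendsto_neg_atTop_atBot
    tendsto_id
  have hr := MeasureTheory.intervalIntegral_tendsto_integral (h_int b hbm) tendsto_neg_atTop_atBot
    tendsto_id
  have hhor : ∀ u : ℝ → ℝ, Tendsto (fun T => g (u T)) atTop (nhds 0) →
      Tendsto (fun T : ℝ => ∫ x in σ..b, F (x + (u T : ℝ) * Complex.I)) atTop (nhds 0) := by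
    intro u hu
    refine squeeze_zero_norm (a := fun T => g (u T) * |b - σ|) (fun T => ?_) (by
      simpa using hu.mul_const |b - σ|)
    refine intervalIntegral.norm_integral_le_of_norm_le_const fun x hx => ?_
    rw [uIoc_of_le hσb] at hx
    exact hF x ⟨hx.1.le, hx.2⟩ _
  have h1 := hhor (fun T => -T) (hg_bot.comp tendsto_neg_atTop_atBot)
  have h2 := hhor (fun T => T) hg_top
  have h := ((h1.sub h2).add (hr.const_mul Complex.I)).sub (hl.const_mul Complex.I)
  have h0 := tendsto_nhds_unique (h.congr fun T => hrect T) tendsto_const_nhds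
  rw [sub_zero, zero_add, ← mul_sub, mul_eq_zero] at h0
  exact (sub_eq_zero.1 (h0.resolve_left Complex.I_ne_zero)).symm

theorem log_two_add_abs_div_le (y : ℝ) :
    Real.log (2 + |y|) * (1 + y ^ 2)⁻¹ ≤ 8 * (1 + ‖y‖ ^ 2) ^ (-(3 / 2) / 2 : ℝ) := by
  have hp : (0 : ℝ) < 1 + y ^ 2 := by positivity
  have h1 : Real.log (2 + |y|) ≤ 2 * (2 + |y|) ^ (1 / 2 : ℝ) := by
    have := Real.log_le_rpow_div (by positivity : 0 ≤ 2 + |y|) (by norm_num : (0 : ℝ) < 1 / 2)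
    linarith
  have h2 : (2 + |y|) ^ (1 / 2 : ℝ) ≤ 4 * (1 + y ^ 2) ^ (1 / 4 : ℝ) := by
    have h3 : 2 + |y| ≤ 4 * (1 + y ^ 2) ^ (1 / 2 : ℝ) := by
      rw [← Real.sqrt_eq_rpow]
      have e1 : 1 ≤ Real.sqrt (1 + y ^ 2) := Real.one_le_sqrt.2 (by nlinarith)
      have e2 : |y| ≤ Real.sqrt (1 + y ^ 2) := Real.abs_le_sqrt (by linarith)
      linarith
    calc (2 + |y|) ^ (1 / 2 : ℝ) ≤ (4 * (1 + y ^ 2) ^ (1 / 2 : ℝ)) ^ (1 / 2 : ℝ) := by gcongr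
      _ = 2 * (1 + y ^ 2) ^ (1 / 4 : ℝ) := by
        rw [Real.mul_rpow (by norm_num) (by positivity), ← Real.rpow_mul hp.le,
          ← Real.sqrt_eq_rpow, show (4 : ℝ) = 2 ^ 2 by norm_num, Real.sqrt_sq (by norm_num)]
        norm_num
      _ ≤ _ := by
        gcongr
        norm_num
  have h4 : (1 + ‖y‖ ^ 2) ^ (-(3 / 2) / 2 : ℝ) = (1 + y ^ 2) ^ (1 / 4 : ℝ) * (1 + y ^ 2)⁻¹ := by
    rw [Real.norm_eq_abs, sq_abs, ← Real.rpow_neg_one, ← Real.rpow_add hp]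
    norm_num
  rw [h4, ← mul_assoc]
  gcongr
  linarith

theorem RiemannHypothesis.integral_logDeriv_mul_fejerKernel (hRH : RiemannHypothesis) {U σ : ℝ}
    (hU : 0 ≤ U) (hσ : 1 / 2 < σ) (hσ1 : σ < 1) {N : ℕ} (hN : Real.exp U ≤ N) :
    MeasureTheory.Integrable (fun t : ℝ => logDeriv riemannZeta₁ (σ + t * Complex.I) *
      fejerKernel U (t * Complex.I)) ∧
    ∫ t : ℝ, logDeriv riemannZeta₁ (σ + t * Complex.I) * fejerKernel U (t * Complex.I) =
    (2 * π * ((Real.exp ((1 - σ) * U) - 1 - (1 - σ) * U) / (1 - σ) ^ 2 -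
      ∑ n ∈ Finset.range N, ArithmeticFunction.vonMangoldt n * (n : ℝ) ^ (-σ) *
        tent U (Real.log n)) : ℝ) := by
  obtain ⟨B, hB, hK⟩ := exists_norm_fejerKernel_le U
  obtain ⟨C, hC, hA⟩ := hRH.exists_norm_logDeriv_riemannZeta₁_le (ε := σ - 1 / 2) (by linarith)
    (by linarith)
  have hdec : Tendsto (fun y : ℝ => C * B * (8 * (1 + ‖y‖ ^ 2) ^ (-(3 / 2) / 2 : ℝ)))
      (Bornology.cobounded ℝ) (nhds 0) := by
    have h1 : Tendsto (fun y : ℝ => 1 + ‖y‖ ^ 2) (Bornology.cobounded ℝ) atTop :=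
      tendsto_atTop_add_const_left _ _
        ((tendsto_pow_atTop two_ne_zero).comp tendsto_norm_cobounded_atTop)
    have h2 := (tendsto_rpow_neg_atTop (y := 3 / 4) (by norm_num)).comp h1
    have h3 := (h2.const_mul 8).const_mul (C * B)
    simp only [mul_zero] at h3
    refine h3.congr fun y => ?_
    norm_num
  have hcb := IsOrderBornology.cobounded_eq (α := ℝ)
  have h := integral_vertical_line_eq (F := fun s => logDeriv riemannZeta₁ s * fejerKernel U (s - σ))
    (σ := σ) (b := 2) (g := fun y => C * B * (8 * (1 + ‖y‖ ^ 2) ^ (-(3 / 2) / 2 : ℝ)))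
    (by linarith) (fun s hs _ => ?_) ?_ (hdec.mono_left ?_) (hdec.mono_left ?_) ?_
  · simp only [add_sub_cancel_left] at h
    refine ⟨h.1, h.2.trans ?_⟩
    have h2 := integral_logDeriv_mul_fejerKernel_two hU (a := 2 - σ) (by linarith) (by linarith) hN
    rw [show 2 - σ - 1 = 1 - σ by ring, show 2 - σ - 2 = -σ by ring] at h2
    rw [← h2]
    refine MeasureTheory.integral_congr_ae (Eventually.of_forall fun t => ?_)
    simp only
    congr 2
    push_cast
    ring
  · refine DifferentiableAt.mul ?_ ((differentiable_fejerKernel U _).comp s (by fun_prop))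
    exact (differentiable_riemannZeta₁.differentiableOn.deriv isOpen_univ).differentiableAt
      univ_mem |>.div (differentiable_riemannZeta₁ s) (hRH.riemannZeta₁_ne_zero (by linarith))
  · exact ((integrable_rpow_neg_one_add_norm_sq (by norm_num)).const_mul 8).const_mul _
  · rw [hcb]
    exact le_sup_right
  · rw [hcb]
    exact le_sup_left
  · intro x hx y
    have h1 := hA (x + y * Complex.I) (by simp; exact hx.1) (by simpa using hx.2)
    have h2 := hK (x + y * Complex.I - σ) (by simpa using hx.1) (by
      simp
      linarith [hx.2])
    have h3 : (x + y * Complex.I : ℂ).im = y := by simp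
    have h4 : (x + y * Complex.I - σ : ℂ).im = y := by simp
    rw [h3] at h1
    rw [h4] at h2
    rw [norm_mul]
    calc _ ≤ C * Real.log (2 + |y|) * (B * (1 + y ^ 2)⁻¹) := by
          refine mul_le_mul h1 h2 (norm_nonneg _) ((norm_nonneg _).trans h1)
      _ = C * B * (Real.log (2 + |y|) * (1 + y ^ 2)⁻¹) := by ring
      _ ≤ _ := by
          exact mul_le_mul_of_nonneg_left (log_two_add_abs_div_le y) (by positivity)

theorem fejerKernel_mul_I_of_ne (U : ℝ) {t : ℝ} (ht : t ≠ 0) :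
    fejerKernel U (t * Complex.I) = (2 * (1 - Real.cos (U * t)) / t ^ 2 : ℝ) := by
  rw [fejerKernel_of_ne (mul_ne_zero (by exact_mod_cast ht) Complex.I_ne_zero), ← mul_assoc,
    Complex.cosh_mul_I, mul_pow, Complex.I_sq]
  push_cast
  ring

theorem RiemannHypothesis.integral_re_logDeriv_mul (hRH : RiemannHypothesis) {U σ : ℝ}
    (hU : 0 ≤ U) (hσ : 1 / 2 < σ) (hσ1 : σ < 1) {N : ℕ} (hN : Real.exp U ≤ N) :
    MeasureTheory.Integrable (fun t : ℝ => (logDeriv riemannZeta₁ (σ + t * Complex.I)).re *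
      (2 * (1 - Real.cos (U * t)) / t ^ 2)) ∧
    ∫ t : ℝ, (logDeriv riemannZeta₁ (σ + t * Complex.I)).re *
      (2 * (1 - Real.cos (U * t)) / t ^ 2) =
    2 * π * ((Real.exp ((1 - σ) * U) - 1 - (1 - σ) * U) / (1 - σ) ^ 2 -
      ∑ n ∈ Finset.range N, ArithmeticFunction.vonMangoldt n * (n : ℝ) ^ (-σ) *
        tent U (Real.log n)) := by
  obtain ⟨h1, h2⟩ := hRH.integral_logDeriv_mul_fejerKernel hU hσ hσ1 hN
  have hae : (fun t : ℝ => (logDeriv riemannZeta₁ (σ + t * Complex.I) *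
      fejerKernel U (t * Complex.I)).re) =ᵐ[MeasureTheory.volume]
      fun t : ℝ => (logDeriv riemannZeta₁ (σ + t * Complex.I)).re *
      (2 * (1 - Real.cos (U * t)) / t ^ 2) := by
    filter_upwards [MeasureTheory.Measure.ae_ne MeasureTheory.volume 0] with t ht
    rw [fejerKernel_mul_I_of_ne U ht, Complex.re_mul_ofReal]
  refine ⟨MeasureTheory.Integrable.congr h1.re hae, ?_⟩
  rw [← MeasureTheory.integral_congr_ae hae]
  have := integral_re h1
  rw [h2] at this
  exact this.trans (Complex.ofReal_re _)

/-- The Fourier transform of the trapezoid `(tent (U + η) - tent U) / η`. -/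
noncomputable def trapezoidKernel (U η t : ℝ) : ℝ :=
  (2 * (1 - Real.cos ((U + η) * t)) / t ^ 2 - 2 * (1 - Real.cos (U * t)) / t ^ 2) / η

theorem trapezoidKernel_eq (U : ℝ) {η t : ℝ} (hη : 0 < η) (ht : t ≠ 0) :
    trapezoidKernel U η t =
      4 * Real.sin ((2 * U + η) * t / 2) * Real.sin (η * t / 2) / (η * t ^ 2) := by
  have h : Real.cos (U * t) - Real.cos ((U + η) * t) =
      2 * Real.sin ((2 * U + η) * t / 2) * Real.sin (η * t / 2) := by
    rw [Real.cos_sub_cos, show (U * t + (U + η) * t) / 2 = (2 * U + η) * t / 2 by ring,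
      show (U * t - (U + η) * t) / 2 = -(η * t / 2) by ring, Real.sin_neg]
    ring
  rw [trapezoidKernel]
  generalize Real.sin ((2 * U + η) * t / 2) = a at h ⊢
  generalize Real.sin (η * t / 2) = b at h ⊢
  field_simp
  linear_combination 2 * h

theorem abs_trapezoidKernel_eq (U : ℝ) {η t : ℝ} (hη : 0 < η) (ht : t ≠ 0) :
    |trapezoidKernel U η t| =
      4 * |Real.sin ((2 * U + η) * t / 2)| * |Real.sin (η * t / 2)| / (η * t ^ 2) := by
  rw [trapezoidKernel_eq U hη ht, abs_div, abs_mul, abs_mul, abs_of_pos (by norm_num : (0 : ℝ) < 4),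
    abs_of_pos (by positivity : 0 < η * t ^ 2)]

theorem abs_trapezoidKernel_le {U η : ℝ} (hU : 0 ≤ U) (hη : 0 < η) (t : ℝ) :
    |trapezoidKernel U η t| ≤ 2 * U + η := by
  rcases eq_or_ne t 0 with rfl | ht
  · simp [trapezoidKernel]
    linarith
  · rw [abs_trapezoidKernel_eq U hη ht, div_le_iff₀ (by positivity)]
    have h1 : |Real.sin ((2 * U + η) * t / 2)| ≤ (2 * U + η) * |t| / 2 := by
      refine Real.abs_sin_le_abs.trans_eq ?_
      rw [abs_div, abs_mul, abs_of_pos (by linarith : 0 < 2 * U + η), abs_two]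
    have h2 : |Real.sin (η * t / 2)| ≤ η * |t| / 2 := by
      refine Real.abs_sin_le_abs.trans_eq ?_
      rw [abs_div, abs_mul, abs_of_pos hη, abs_two]
    calc _ ≤ 4 * ((2 * U + η) * |t| / 2) * (η * |t| / 2) := by gcongr
      _ = (2 * U + η) * (η * |t| ^ 2) := by ring
      _ = _ := by rw [sq_abs]

theorem abs_trapezoidKernel_le_rpow (U : ℝ) {η δ : ℝ} (hη : 0 < η) (hδ : 0 ≤ δ) (hδ1 : δ ≤ 1)
    {t : ℝ} (ht : t ≠ 0) :
    |trapezoidKernel U η t| ≤ 4 * η ^ (-δ) * |t| ^ (-1 - δ) := by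
  have htp : 0 < |t| := abs_pos.2 ht
  have hp : 0 < η * |t| := by positivity
  have h1 : |Real.sin (η * t / 2)| ≤ (η * |t|) ^ (1 - δ) := by
    rcases le_total (η * |t|) 1 with h | h
    · have e1 : |Real.sin (η * t / 2)| ≤ η * |t| := by
        refine Real.abs_sin_le_abs.trans ?_
        rw [abs_div, abs_mul, abs_of_pos hη, abs_two]
        linarith
      refine e1.trans ?_
      conv_lhs => rw [← Real.rpow_one (η * |t|)]
      exact Real.rpow_le_rpow_of_exponent_ge hp h (by linarith)
    · exact (Real.abs_sin_le_one _).trans (Real.one_le_rpow h (by linarith))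
  rw [abs_trapezoidKernel_eq U hη ht, div_le_iff₀ (by positivity)]
  calc _ ≤ 4 * 1 * (η * |t|) ^ (1 - δ) := by
        gcongr
        exact Real.abs_sin_le_one _
    _ = 4 * η ^ (-δ) * |t| ^ (-1 - δ) * (η * |t| ^ 2) := by
        rw [Real.mul_rpow hη.le htp.le, sub_eq_add_neg 1 δ, Real.rpow_add hη, Real.rpow_add htp,
          sub_eq_add_neg (-1) δ, Real.rpow_add htp, Real.rpow_neg_one, Real.rpow_one, Real.rpow_one]
        field_simp
    _ = _ := by rw [sq_abs]

theorem sum_range_succ_rpow_le {ε : ℝ} (hε : 0 < ε) (N : ℕ) :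
    ∑ j ∈ Finset.range N, ((j : ℝ) + 1) ^ (-1 - ε) ≤ 1 + 1 / ε := by
  rcases N with _ | N
  · simp
    positivity
  · rw [Finset.sum_range_succ']
    have hanti : AntitoneOn (fun x : ℝ => x ^ (-1 - ε)) (Icc 1 (1 + (N : ℝ))) := by
      intro x hx y hy hxy
      exact Real.rpow_le_rpow_of_nonpos (by linarith [hx.1]) hxy (by linarith)
    have h1 := hanti.sum_le_integral
    have h2 : ∫ x in (1 : ℝ)..(1 + N), x ^ (-1 - ε) ≤ 1 / ε := by
      rw [integral_rpow (Or.inr ⟨by linarith, by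
        rw [uIcc_of_le (by linarith [(Nat.cast_nonneg N : (0 : ℝ) ≤ N)])]
        intro h
        linarith [h.1]⟩), Real.one_rpow, show -1 - ε + 1 = -ε by ring, div_neg, ← neg_div]
      gcongr
      have : 0 ≤ (1 + (N : ℝ)) ^ (-ε) := by positivity
      linarith
    have h3 : ∑ j ∈ Finset.range N, (((j + 1 : ℕ) : ℝ) + 1) ^ (-1 - ε) ≤ 1 / ε := by
      refine le_trans (le_of_eq ?_) (h1.trans h2)
      refine Finset.sum_congr rfl fun j _ => ?_
      rw [add_comm]
    have h4 : (((0 : ℕ) : ℝ) + 1) ^ (-1 - ε) = 1 := by simp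
    rw [h4]
    linarith

theorem integral_mul_le_of_rpow_decay {h k : ℝ → ℝ} {C K L : ℝ} (hC : 0 ≤ C) (hK : 0 ≤ K)
    (hL : 1 ≤ L) (h0 : ∀ t, 0 ≤ h t) (hc : Continuous h)
    (h_int : MeasureTheory.Integrable fun t => h t * |k t|)
    (hh : ∀ T, ∫ t in (T - 1 / 2)..(T + 1 / 2), h t ≤ C * Real.log (2 + |T|))
    (hk : ∀ t, 1 / 2 ≤ t → |k t| ≤ K * t ^ (-1 - 1 / L)) (N : ℕ) :
    ∫ t in (1 / 2 : ℝ)..(N + 1 / 2), h t * |k t| ≤ 48 * C * K * L ^ 2 := by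
  have hL0 : 0 < L := by linarith
  have hstep : ∀ j : ℕ, ∫ t in ((j : ℝ) + 1 / 2)..(((j + 1 : ℕ) : ℝ) + 1 / 2), h t * |k t| ≤
      16 * C * K * L * ((j : ℝ) + 1) ^ (-1 - 1 / (2 * L)) := by
    intro j
    have hm : (1 : ℝ) ≤ j + 1 := by linarith [(Nat.cast_nonneg j : (0 : ℝ) ≤ j)]
    have hm0 : (0 : ℝ) < j + 1 := by linarith
    set m : ℝ := (j : ℝ) + 1 with hmdef
    have hab : (j : ℝ) + 1 / 2 ≤ ((j + 1 : ℕ) : ℝ) + 1 / 2 := by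
      push_cast
      linarith
    have h1 : ∀ t ∈ Icc ((j : ℝ) + 1 / 2) (((j + 1 : ℕ) : ℝ) + 1 / 2),
        h t * |k t| ≤ h t * (4 * K * m ^ (-1 - 1 / L)) := by
      intro t ht
      have hj0 : (0 : ℝ) ≤ j := Nat.cast_nonneg j
      refine mul_le_mul_of_nonneg_left ((hk t (by linarith [ht.1])).trans ?_) (h0 t)
      have hL1 : 1 / L ≤ 1 := by rwa [div_le_one hL0]
      calc K * t ^ (-1 - 1 / L) ≤ K * (m / 2) ^ (-1 - 1 / L) := by
            refine mul_le_mul_of_nonneg_left ?_ hK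
            refine Real.rpow_le_rpow_of_nonpos (by positivity) (by linarith [ht.1]) ?_
            have : 0 < 1 / L := by positivity
            linarith
        _ = K * (m ^ (-1 - 1 / L) * 2 ^ (1 + 1 / L)) := by
            rw [Real.div_rpow hm0.le (by norm_num), div_eq_mul_inv, ← Real.rpow_neg (by norm_num)]
            congr 3
            ring
        _ ≤ K * (m ^ (-1 - 1 / L) * 2 ^ (2 : ℝ)) := by
            gcongr
            · norm_num
            · linarith
        _ = _ := by
            norm_num
            ring
    have h2 := intervalIntegral.integral_mono_on hab h_int.intervalIntegrable
      ((hc.mul continuous_const).intervalIntegrable (μ := MeasureTheory.volume) _ _) h1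
    refine h2.trans ?_
    simp only [Pi.mul_apply]
    rw [intervalIntegral.integral_mul_const]
    have h3 := hh m
    rw [show m - 1 / 2 = j + 1 / 2 by rw [hmdef]; ring, abs_of_pos hm0] at h3
    have h4 : Real.log (2 + m) ≤ 4 * L * m ^ (1 / (2 * L)) := by
      have e1 : Real.log (2 + m) ≤ Real.log 3 + Real.log m := by
        rw [← Real.log_mul (by norm_num) hm0.ne']
        exact Real.log_le_log (by positivity) (by linarith)
      have e2 : Real.log 3 ≤ 2 := by
        have := Real.log_le_sub_one_of_pos (by norm_num : (0 : ℝ) < 3)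
        linarith
      have e3 := Real.log_le_rpow_div hm0.le (by positivity : 0 < 1 / (2 * L))
      rw [div_div_eq_mul_div, div_one] at e3
      have e4 : 1 ≤ m ^ (1 / (2 * L)) := Real.one_le_rpow hm (by positivity)
      nlinarith
    have h5 : (∫ t in ((j : ℝ) + 1 / 2)..(((j + 1 : ℕ) : ℝ) + 1 / 2), h t) ≤
        C * (4 * L * m ^ (1 / (2 * L))) := by
      push_cast
      refine h3.trans ?_
      gcongr
    calc _ ≤ C * (4 * L * m ^ (1 / (2 * L))) * (4 * K * m ^ (-1 - 1 / L)) := by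
          gcongr
      _ = 16 * C * K * L * (m ^ (1 / (2 * L)) * m ^ (-1 - 1 / L)) := by ring
      _ = _ := by
          rw [← Real.rpow_add hm0]
          congr 2
          field_simp
          ring
  have hsum := intervalIntegral.sum_integral_adjacent_intervals (f := fun t => h t * |k t|)
    (a := fun j : ℕ => (j : ℝ) + 1 / 2) (n := N) (μ := MeasureTheory.volume)
    (fun _ _ => h_int.intervalIntegrable)
  simp only [Nat.cast_zero, zero_add] at hsum
  rw [← hsum]
  refine (Finset.sum_le_sum fun j _ => hstep j).trans ?_
  rw [← Finset.mul_sum]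
  have h6 := sum_range_succ_rpow_le (ε := 1 / (2 * L)) (by positivity) N
  rw [one_div_one_div] at h6
  calc _ ≤ 16 * C * K * L * (1 + 2 * L) := by gcongr
    _ ≤ 16 * C * K * L * (3 * L) := by
        gcongr
        linarith
    _ = _ := by ring

theorem integral_mul_trapezoidKernel_le {h : ℝ → ℝ} {C U η : ℝ} (hC : 0 ≤ C) (hU : 0 ≤ U)
    (hη : 0 < η) (hη1 : η ≤ Real.exp (-1)) (h0 : ∀ t, 0 ≤ h t) (hc : Continuous h)
    (h_int : MeasureTheory.Integrable fun t => h t * |trapezoidKernel U η t|)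
    (hh : ∀ T, ∫ t in (T - 1 / 2)..(T + 1 / 2), h t ≤ C * Real.log (2 + |T|)) :
    ∫ t, h t * |trapezoidKernel U η t| ≤ C * (2 * U + 1 + 1152 * (Real.log η) ^ 2) := by
  set L : ℝ := -Real.log η with hLdef
  have hL : 1 ≤ L := by
    have := Real.log_le_log hη hη1
    rw [Real.log_exp] at this
    linarith
  have hL0 : 0 < L := by linarith
  have hηL : η ^ (-(1 / L)) = Real.exp 1 := by
    rw [Real.rpow_def_of_pos hη, show Real.log η = -L by rw [hLdef, neg_neg]]
    congr 1
    field_simp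
  have hL1 : 1 / L ≤ 1 := by rwa [div_le_one hL0]
  have hk : ∀ t, t ≠ 0 → |trapezoidKernel U η t| ≤ 12 * |t| ^ (-1 - 1 / L) := by
    intro t ht
    refine (abs_trapezoidKernel_le_rpow U hη (by positivity) hL1 ht).trans ?_
    rw [hηL]
    have := Real.exp_one_lt_d9
    gcongr
    linarith
  have hpos := integral_mul_le_of_rpow_decay hC (by norm_num : (0 : ℝ) ≤ 12) hL h0 hc h_int hh
    (fun t ht => by
      have := hk t (by linarith)
      rwa [abs_of_pos (by linarith : 0 < t)] at this)
  have hneg := integral_mul_le_of_rpow_decay (h := fun t => h (-t))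
    (k := fun t => trapezoidKernel U η (-t)) hC (by norm_num : (0 : ℝ) ≤ 12) hL
    (fun t => h0 _) (hc.comp continuous_neg) h_int.comp_neg (fun T => by
      rw [intervalIntegral.integral_comp_neg]
      have := hh (-T)
      rw [abs_neg] at this
      convert this using 2 <;> ring) (fun t ht => by
      have := hk (-t) (by linarith)
      rwa [abs_neg, abs_of_pos (by linarith : 0 < t)] at this)
  have hmid : ∫ t in (-(1 / 2) : ℝ)..(1 / 2), h t * |trapezoidKernel U η t| ≤ C * (2 * U + 1) := by
    have h1 := intervalIntegral.integral_mono_on (by norm_num : -(1 / 2) ≤ (1 / 2 : ℝ))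
      h_int.intervalIntegrable ((hc.mul (continuous_const (y := 2 * U + η))).intervalIntegrable
        (μ := MeasureTheory.volume) _ _)
      (fun t _ => mul_le_mul_of_nonneg_left (abs_trapezoidKernel_le hU hη t) (h0 t))
    refine h1.trans ?_
    simp only [Pi.mul_apply]
    rw [intervalIntegral.integral_mul_const]
    have h2 := hh 0
    have h3 : Real.log (2 + |(0 : ℝ)|) ≤ 1 := by
      rw [abs_zero, add_zero]
      linarith [Real.log_two_lt_d9]
    rw [zero_sub, zero_add] at h2
    have h4 : η ≤ 1 := hη1.trans (Real.exp_le_one_iff.2 (by norm_num))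
    calc _ ≤ C * Real.log (2 + |(0 : ℝ)|) * (2 * U + η) := by gcongr
      _ ≤ C * 1 * (2 * U + 1) := by gcongr
      _ = _ := by ring
  have htend := MeasureTheory.intervalIntegral_tendsto_integral h_int
    (a := fun N : ℕ => -((N : ℝ) + 1 / 2)) (b := fun N : ℕ => (N : ℝ) + 1 / 2) (l := atTop)
    (tendsto_neg_atTop_atBot.comp (tendsto_atTop_add_const_right _ _ tendsto_natCast_atTop_atTop))
    (tendsto_atTop_add_const_right _ _ tendsto_natCast_atTop_atTop)
  refine le_of_tendsto htend (Eventually.of_forall fun N => ?_)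
  rw [← intervalIntegral.integral_add_adjacent_intervals (b := 1 / 2) h_int.intervalIntegrable
    h_int.intervalIntegrable, ← intervalIntegral.integral_add_adjacent_intervals (b := -(1 / 2))
    h_int.intervalIntegrable h_int.intervalIntegrable]
  have e1 := hpos N
  have e2 := hneg N
  rw [intervalIntegral.integral_comp_neg (fun t => h t * |trapezoidKernel U η t|)] at e2
  have e3 : L ^ 2 = Real.log η ^ 2 := by rw [hLdef, neg_sq]
  rw [e3] at e1 e2
  linarith

theorem RiemannHypothesis.exists_abs_sum_vonMangoldt_sub_le_of_lt (hRH : RiemannHypothesis) :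
    ∃ C : ℝ, 0 < C ∧ ∀ U η σ : ℝ, 0 ≤ U → 0 < η → η ≤ Real.exp (-1) → 1 / 2 < σ → σ < 1 →
      ∀ N : ℕ, Real.exp (U + η) ≤ N →
      |∑ n ∈ Finset.range N, ArithmeticFunction.vonMangoldt n * (n : ℝ) ^ (-σ) *
          ((tent (U + η) (Real.log n) - tent U (Real.log n)) / η) -
        ((Real.exp ((1 - σ) * (U + η)) - Real.exp ((1 - σ) * U) - (1 - σ) * η) /
          ((1 - σ) ^ 2 * η))| ≤ C * (2 * U + 1 + 1152 * Real.log η ^ 2) := by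
  obtain ⟨C, hC, h⟩ := hRH.exists_integral_abs_re_logDeriv_le
  refine ⟨C, hC, fun U η σ hU hη hη1 hσ hσ1 N hN => ?_⟩
  obtain ⟨i1, e1⟩ := hRH.integral_re_logDeriv_mul hU hσ hσ1
    ((Real.exp_le_exp.2 (by linarith)).trans hN : Real.exp U ≤ N)
  obtain ⟨i2, e2⟩ := hRH.integral_re_logDeriv_mul (by linarith : 0 ≤ U + η) hσ hσ1 hN
  have hker : ∀ t : ℝ, (logDeriv riemannZeta₁ (σ + t * Complex.I)).re * trapezoidKernel U η t =
      ((logDeriv riemannZeta₁ (σ + t * Complex.I)).re *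
        (2 * (1 - Real.cos ((U + η) * t)) / t ^ 2) -
      (logDeriv riemannZeta₁ (σ + t * Complex.I)).re *
        (2 * (1 - Real.cos (U * t)) / t ^ 2)) / η := by
    intro t
    rw [trapezoidKernel]
    ring
  have hi : MeasureTheory.Integrable fun t : ℝ =>
      (logDeriv riemannZeta₁ (σ + t * Complex.I)).re * trapezoidKernel U η t := by
    simp_rw [hker]
    exact (i2.sub i1).div_const η
  have hval : ∫ t : ℝ, (logDeriv riemannZeta₁ (σ + t * Complex.I)).re * trapezoidKernel U η t =
      2 * π * (((Real.exp ((1 - σ) * (U + η)) - Real.exp ((1 - σ) * U) - (1 - σ) * η) /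
          ((1 - σ) ^ 2 * η)) - ∑ n ∈ Finset.range N, ArithmeticFunction.vonMangoldt n *
          (n : ℝ) ^ (-σ) * ((tent (U + η) (Real.log n) - tent U (Real.log n)) / η)) := by
    simp_rw [hker]
    rw [MeasureTheory.integral_div, MeasureTheory.integral_sub i2 i1, e1, e2]
    have hs : ∑ n ∈ Finset.range N, ArithmeticFunction.vonMangoldt n *
        (n : ℝ) ^ (-σ) * ((tent (U + η) (Real.log n) - tent U (Real.log n)) / η) =
        (∑ n ∈ Finset.range N, ArithmeticFunction.vonMangoldt n * (n : ℝ) ^ (-σ) *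
          tent (U + η) (Real.log n) - ∑ n ∈ Finset.range N, ArithmeticFunction.vonMangoldt n *
          (n : ℝ) ^ (-σ) * tent U (Real.log n)) / η := by
      rw [← Finset.sum_sub_distrib, Finset.sum_div]
      refine Finset.sum_congr rfl fun n _ => ?_
      ring
    rw [hs]
    have : 1 - σ ≠ 0 := by linarith
    field_simp
    ring
  have hc : Continuous fun t : ℝ => |(logDeriv riemannZeta₁ (σ + t * Complex.I)).re| := by
    rw [continuous_iff_continuousAt]
    intro t
    have hd : DifferentiableAt ℂ (logDeriv riemannZeta₁) (σ + t * Complex.I) :=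
      (differentiable_riemannZeta₁.differentiableOn.deriv isOpen_univ).differentiableAt
        univ_mem |>.div (differentiable_riemannZeta₁ _)
          (hRH.riemannZeta₁_ne_zero (by simpa using hσ))
    exact (Complex.continuous_re.continuousAt.comp
      (ContinuousAt.comp (g := logDeriv riemannZeta₁) (f := fun y : ℝ => (σ : ℂ) + y * Complex.I)
        hd.continuousAt (by fun_prop))).abs
  have hb := integral_mul_trapezoidKernel_le hC.le hU hη hη1 (fun t => abs_nonneg _) hc
    (by simpa only [abs_mul] using hi.abs) (h σ hσ hσ1.le)
  have hle := MeasureTheory.abs_integral_le_integral_abs (f := fun t : ℝ =>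
    (logDeriv riemannZeta₁ (σ + t * Complex.I)).re * trapezoidKernel U η t)
      (μ := MeasureTheory.volume)
  simp_rw [abs_mul] at hle
  rw [hval, abs_mul, abs_sub_comm, abs_of_pos (by positivity)] at hle
  refine le_trans ?_ (hle.trans hb)
  refine le_mul_of_one_le_left (abs_nonneg _) ?_
  linarith [Real.pi_gt_three]

theorem RiemannHypothesis.exists_abs_sum_vonMangoldt_mul_trapezoid_sub_le
    (hRH : RiemannHypothesis) :
    ∃ C : ℝ, 0 < C ∧ ∀ U η : ℝ, 0 ≤ U → 0 < η → η ≤ Real.exp (-1) →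
      ∀ N : ℕ, Real.exp (U + η) ≤ N →
      |∑ n ∈ Finset.range N, ArithmeticFunction.vonMangoldt n / Real.sqrt n *
          ((tent (U + η) (Real.log n) - tent U (Real.log n)) / η) -
        4 * (Real.exp ((U + η) / 2) - Real.exp (U / 2) - η / 2) / η| ≤
        C * (2 * U + 1 + 1152 * Real.log η ^ 2) := by
  obtain ⟨C, hC, h⟩ := hRH.exists_abs_sum_vonMangoldt_sub_le_of_lt
  refine ⟨C, hC, fun U η hU hη hη1 N hN => ?_⟩
  set G : ℝ → ℝ := fun σ => |∑ n ∈ Finset.range N, ArithmeticFunction.vonMangoldt n *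
    (n : ℝ) ^ (-σ) * ((tent (U + η) (Real.log n) - tent U (Real.log n)) / η) -
      ((Real.exp ((1 - σ) * (U + η)) - Real.exp ((1 - σ) * U) - (1 - σ) * η) /
        ((1 - σ) ^ 2 * η))| with hG
  have hcont : ContinuousAt G (1 / 2) := by
    refine ContinuousAt.abs (ContinuousAt.sub ?_ (ContinuousAt.div (by fun_prop) (by fun_prop) ?_))
    · refine tendsto_finsetSum _ fun n _ => ?_
      rcases eq_or_ne n 0 with rfl | hn
      · simp
      · have : (n : ℝ) ≠ 0 := by exact_mod_cast hn
        refine ContinuousAt.mul (ContinuousAt.mul continuousAt_const ?_) continuousAt_const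
        exact ContinuousAt.comp (Real.continuousAt_const_rpow this) continuousAt_neg
    · have := hη.ne'
      norm_num
      exact this
  have hle : G (1 / 2) ≤ C * (2 * U + 1 + 1152 * Real.log η ^ 2) := by
    refine le_of_tendsto (hcont.tendsto.mono_left
      (nhdsWithin_le_nhds (s := Ioi (1 / 2 : ℝ)))) ?_
    filter_upwards [Ioo_mem_nhdsGT (by norm_num : (1 / 2 : ℝ) < 1)] with σ hσ
    exact h U η σ hU hη hη1 hσ.1 hσ.2 N hN
  convert hle using 1
  rw [hG]
  congr 2
  · refine Finset.sum_congr rfl fun n _ => ?_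
    rw [Real.rpow_neg (by positivity), ← Real.sqrt_eq_rpow, ← div_eq_mul_inv]
  · norm_num
    field_simp

/-- The sum of `Λ(n) / √n` over `n ≤ x`. -/
noncomputable def sumVonMangoldtSqrt (x : ℝ) : ℝ :=
  ∑ n ∈ Finset.Icc 0 ⌊x⌋₊, ArithmeticFunction.vonMangoldt n / Real.sqrt n

theorem trapezoid_nonneg {U η : ℝ} (hη : 0 < η) (v : ℝ) :
    0 ≤ (tent (U + η) v - tent U v) / η :=
  div_nonneg (sub_nonneg.2 (max_le_max le_rfl (by linarith))) hη.le

theorem trapezoid_le_one {U η : ℝ} (hη : 0 < η) (v : ℝ) :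
    (tent (U + η) v - tent U v) / η ≤ 1 := by
  rw [div_le_one hη, tent, tent, sub_le_iff_le_add]
  refine max_le (by positivity) ?_
  linarith [le_max_right 0 (U - |v|)]

theorem trapezoid_eq_one {U η v : ℝ} (hη : 0 < η) (hv : |v| ≤ U) :
    (tent (U + η) v - tent U v) / η = 1 := by
  rw [tent_of_le hv, tent_of_le (hv.trans (by linarith)), div_eq_one_iff_eq hη.ne']
  ring

theorem trapezoid_eq_zero {U η v : ℝ} (hη : 0 < η) (hv : U + η ≤ |v|) :
    (tent (U + η) v - tent U v) / η = 0 := by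
  rw [tent_of_ge hv, tent_of_ge ((by linarith : U ≤ U + η).trans hv), sub_zero, zero_div]

theorem vonMangoldt_div_sqrt_nonneg (n : ℕ) :
    0 ≤ ArithmeticFunction.vonMangoldt n / Real.sqrt n :=
  div_nonneg ArithmeticFunction.vonMangoldt_nonneg (Real.sqrt_nonneg _)

theorem sumVonMangoldtSqrt_le_sum_trapezoid {U η : ℝ} (hη : 0 < η) {N : ℕ}
    (hN : Real.exp (U + η) ≤ N) :
    sumVonMangoldtSqrt (Real.exp U) ≤ ∑ n ∈ Finset.range N,
      ArithmeticFunction.vonMangoldt n / Real.sqrt n *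
        ((tent (U + η) (Real.log n) - tent U (Real.log n)) / η) := by
  have hsub : Finset.Icc 0 ⌊Real.exp U⌋₊ ⊆ Finset.range N := by
    intro n hn
    rw [Finset.mem_Icc, Nat.le_floor_iff (Real.exp_pos U).le] at hn
    rw [Finset.mem_range]
    have : (n : ℝ) < N := hn.2.trans_lt ((Real.exp_lt_exp.2 (by linarith)).trans_le hN)
    exact_mod_cast this
  refine le_trans (Finset.sum_le_sum fun n hn => ?_)
    (Finset.sum_le_sum_of_subset_of_nonneg hsub fun n _ _ =>
      mul_nonneg (vonMangoldt_div_sqrt_nonneg n) (trapezoid_nonneg hη _))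
  rcases eq_or_ne n 0 with rfl | hn0
  · simp
  rw [Finset.mem_Icc, Nat.le_floor_iff (Real.exp_pos U).le] at hn
  rw [trapezoid_eq_one hη, mul_one]
  rw [abs_of_nonneg (Real.log_natCast_nonneg n)]
  exact (Real.log_le_iff_le_exp (by positivity)).2 hn.2

theorem sum_trapezoid_le_sumVonMangoldtSqrt {U η : ℝ} (hη : 0 < η) (N : ℕ) :
    ∑ n ∈ Finset.range N, ArithmeticFunction.vonMangoldt n / Real.sqrt n *
        ((tent (U + η) (Real.log n) - tent U (Real.log n)) / η) ≤
      sumVonMangoldtSqrt (Real.exp (U + η)) := by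
  classical
  refine le_trans (le_trans (Finset.sum_le_sum fun n _ => ?_)
    (Finset.sum_filter (s := Finset.range N) (fun n => n ∈ Finset.Icc 0 ⌊Real.exp (U + η)⌋₊)
      (fun n => ArithmeticFunction.vonMangoldt n / Real.sqrt n)).ge)
    (Finset.sum_le_sum_of_subset_of_nonneg (fun n hn => (Finset.mem_filter.1 hn).2)
      fun n _ _ => vonMangoldt_div_sqrt_nonneg n)
  split_ifs with h
  · exact mul_le_of_le_one_right (vonMangoldt_div_sqrt_nonneg n) (trapezoid_le_one hη _)
  · rw [trapezoid_eq_zero hη, mul_zero]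
    rw [Finset.mem_Icc, Nat.le_floor_iff (Real.exp_pos _).le] at h
    push Not at h
    have h1 := h (Nat.zero_le n)
    rw [abs_of_nonneg (Real.log_natCast_nonneg n)]
    exact (Real.le_log_iff_exp_le ((Real.exp_pos _).trans h1)).2 h1.le

theorem sumVonMangoldtSqrt_mono {x y : ℝ} (h : x ≤ y) :
    sumVonMangoldtSqrt x ≤ sumVonMangoldtSqrt y :=
  Finset.sum_le_sum_of_subset_of_nonneg
    (Finset.Icc_subset_Icc_right (Nat.floor_le_floor h))
      fun n _ _ => vonMangoldt_div_sqrt_nonneg n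

theorem sumVonMangoldtSqrt_nonneg (x : ℝ) : 0 ≤ sumVonMangoldtSqrt x :=
  Finset.sum_nonneg fun n _ => vonMangoldt_div_sqrt_nonneg n

/-- Under RH, `∑_{n ≤ x} Λ(n) / √n = 2 √x + O(log² x)`. -/
theorem RiemannHypothesis.exists_abs_sumVonMangoldtSqrt_sub_le (hRH : RiemannHypothesis) :
    ∃ C : ℝ, 0 < C ∧ ∀ x : ℝ, 2 ≤ x →
      |sumVonMangoldtSqrt x - 2 * Real.sqrt x| ≤ C * Real.log x ^ 2 := by
  obtain ⟨C, hC, h⟩ := hRH.exists_abs_sum_vonMangoldt_mul_trapezoid_sub_le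
  have hS2 := sumVonMangoldtSqrt_nonneg (Real.exp 2)
  have hl2 : 0 < Real.log 2 := Real.log_pos (by norm_num)
  refine ⟨3 + 300 * C + (sumVonMangoldtSqrt (Real.exp 2) + 2 * Real.sqrt (Real.exp 2)) /
    Real.log 2 ^ 2, by positivity, fun x hx => ?_⟩
  have hx0 : 0 < x := by linarith
  have hlog : Real.log 2 ≤ Real.log x := Real.log_le_log two_pos hx
  rcases le_total x (Real.exp 2) with hx2 | hx2
  · have h1 : |sumVonMangoldtSqrt x - 2 * Real.sqrt x| ≤
        sumVonMangoldtSqrt (Real.exp 2) + 2 * Real.sqrt (Real.exp 2) := by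
      have e1 := sumVonMangoldtSqrt_mono hx2
      have e2 := sumVonMangoldtSqrt_nonneg x
      have e3 := Real.sqrt_le_sqrt hx2
      have e4 := Real.sqrt_nonneg x
      rw [abs_le]
      constructor <;> linarith
    refine h1.trans ?_
    have h2 : (sumVonMangoldtSqrt (Real.exp 2) + 2 * Real.sqrt (Real.exp 2)) =
        (sumVonMangoldtSqrt (Real.exp 2) + 2 * Real.sqrt (Real.exp 2)) / Real.log 2 ^ 2 *
          Real.log 2 ^ 2 := by
      field_simp
    rw [add_mul]
    have h3 : (sumVonMangoldtSqrt (Real.exp 2) + 2 * Real.sqrt (Real.exp 2)) / Real.log 2 ^ 2 *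
          Real.log 2 ^ 2 ≤ (sumVonMangoldtSqrt (Real.exp 2) + 2 * Real.sqrt (Real.exp 2)) /
            Real.log 2 ^ 2 * Real.log x ^ 2 := by gcongr
    have h4 : 0 ≤ (3 + 300 * C) * Real.log x ^ 2 := by positivity
    linarith
  · set V := Real.log x with hV
    have hV2 : 2 ≤ V := (Real.le_log_iff_exp_le hx0).2 hx2
    have hxV : Real.exp V = x := Real.exp_log hx0
    have hsx : Real.exp (V / 2) = Real.sqrt x := by rw [Real.exp_half, hxV]
    set η := Real.exp (-(V / 2)) with hη
    have hη0 : 0 < η := Real.exp_pos _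
    have hη1 : η ≤ Real.exp (-1) := Real.exp_le_exp.2 (by linarith)
    have hηle : η ≤ 1 := hη1.trans (Real.exp_le_one_iff.2 (by norm_num))
    have hlogη : Real.log η = -(V / 2) := Real.log_exp _
    have hsη : Real.sqrt x * η = 1 := by
      rw [← hsx, hη, ← Real.exp_add]
      simp
    have hexp1 : Real.exp (η / 2) - 1 ≤ η / 2 + η ^ 2 / 4 := by
      have := Real.abs_exp_sub_one_sub_id_le (x := η / 2) (by rw [abs_of_pos] <;> linarith)
      have := le_of_abs_le this
      linarith
    have hexp2 : η / 2 ≤ Real.exp (η / 2) - 1 := by linarith [Real.add_one_le_exp (η / 2)]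
    have hfin : ∀ U, 0 ≤ U → U ≤ V →
        C * (2 * U + 1 + 1152 * Real.log η ^ 2) ≤ 300 * C * V ^ 2 := by
      intro U _ hU
      rw [hlogη]
      have : 2 * U + 1 + 1152 * (-(V / 2)) ^ 2 ≤ 300 * V ^ 2 := by nlinarith
      calc _ ≤ C * (300 * V ^ 2) := by gcongr
        _ = _ := by ring
    have hupper : sumVonMangoldtSqrt x ≤ 2 * Real.sqrt x + 1 + 300 * C * V ^ 2 := by
      obtain ⟨N, hN⟩ := exists_nat_ge (Real.exp (V + η))
      have e1 := sumVonMangoldtSqrt_le_sum_trapezoid hη0 hN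
      have e2 := le_of_abs_le (h V η (by linarith) hη0 hη1 N hN)
      have e3 := hfin V (by linarith) le_rfl
      have e4 : 4 * (Real.exp ((V + η) / 2) - Real.exp (V / 2) - η / 2) / η ≤
          2 * Real.sqrt x + 1 := by
        rw [div_le_iff₀ hη0, add_div, Real.exp_add, hsx]
        nlinarith [Real.sqrt_nonneg x, mul_le_mul_of_nonneg_left hexp1 (Real.sqrt_nonneg x)]
      rw [hxV] at e1
      linarith
    have hlower : 2 * Real.sqrt x - 3 - 300 * C * V ^ 2 ≤ sumVonMangoldtSqrt x := by
      obtain ⟨N, hN⟩ := exists_nat_ge (Real.exp (V - η + η))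
      have e1 := sum_trapezoid_le_sumVonMangoldtSqrt (U := V - η) hη0 N
      have e2 := neg_le_of_abs_le (h (V - η) η (by linarith) hη0 hη1 N hN)
      have e3 := hfin (V - η) (by linarith) (by linarith)
      have e4 : 2 * Real.sqrt x - 3 ≤
          4 * (Real.exp ((V - η + η) / 2) - Real.exp ((V - η) / 2) - η / 2) / η := by
        have e5 : Real.exp ((V - η) / 2) * Real.exp (η / 2) = Real.sqrt x := by
          rw [← hsx, ← Real.exp_add]
          congr 1
          ring
        have e6 : Real.sqrt x * (1 - η / 2) ≤ Real.exp ((V - η) / 2) := by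
          rw [show (V - η) / 2 = V / 2 + -(η / 2) by ring, Real.exp_add, hsx]
          gcongr
          linarith [Real.add_one_le_exp (-(η / 2))]
        rw [sub_add_cancel, hsx, le_div_iff₀ hη0]
        have e7 := mul_le_mul_of_nonneg_left hexp2 (Real.exp_pos ((V - η) / 2)).le
        nlinarith
      rw [show Real.exp (V - η + η) = x by rw [sub_add_cancel, hxV]] at e1
      linarith
    have hpos : 0 ≤ (sumVonMangoldtSqrt (Real.exp 2) + 2 * Real.sqrt (Real.exp 2)) /
      Real.log 2 ^ 2 * V ^ 2 := by positivity
    have h3 : 3 ≤ 3 * V ^ 2 := by nlinarith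
    rw [abs_le]
    constructor <;> linarith

/-- Abel summation with a main term `M` and a differentiable error bound `ρ`, against a decreasing
nonnegative weight `w`. -/
theorem abs_sum_mul_sub_integral_mul_le {c : ℕ → ℝ} {w w' M m ρ ρ' : ℝ → ℝ} {a b : ℝ}
    (ha : 0 ≤ a) (hab : a ≤ b)
    (hw : ∀ t ∈ Set.Icc a b, HasDerivAt w (w' t) t) (hw' : ContinuousOn w' (Set.Icc a b))
    (hM : ∀ t ∈ Set.Icc a b, HasDerivAt M (m t) t) (hm : ContinuousOn m (Set.Icc a b))
    (hρ : ∀ t ∈ Set.Icc a b, HasDerivAt ρ (ρ' t) t) (hρ' : ContinuousOn ρ' (Set.Icc a b))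
    (hw0 : ∀ t ∈ Set.Icc a b, 0 ≤ w t) (hw'0 : ∀ t ∈ Set.Icc a b, w' t ≤ 0)
    (hc : ∀ t ∈ Set.Icc a b, |∑ k ∈ Finset.Icc 0 ⌊t⌋₊, c k - M t| ≤ ρ t) :
    |∑ k ∈ Finset.Ioc ⌊a⌋₊ ⌊b⌋₊, w k * c k - ∫ t in a..b, w t * m t| ≤
      2 * (w a * ρ a) + ∫ t in a..b, w t * ρ' t := by
  have hu : Set.uIcc a b = Set.Icc a b := Set.uIcc_of_le hab
  have hd : ∀ t ∈ Set.Icc a b, deriv w t = w' t := fun t ht => (hw t ht).deriv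
  have hwi : IntervalIntegrable w' MeasureTheory.volume a b :=
    (hw'.mono hu.le).intervalIntegrable
  have hmi : IntervalIntegrable m MeasureTheory.volume a b :=
    (hm.mono hu.le).intervalIntegrable
  have hρi : IntervalIntegrable ρ' MeasureTheory.volume a b :=
    (hρ'.mono hu.le).intervalIntegrable
  have hMc : ContinuousOn M (Set.Icc a b) := fun t ht => (hM t ht).continuousAt.continuousWithinAt
  have hρc : ContinuousOn ρ (Set.Icc a b) := fun t ht => (hρ t ht).continuousAt.continuousWithinAt
  have hdi : MeasureTheory.IntegrableOn (deriv w) (Set.Icc a b) :=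
    (hw'.congr hd).integrableOn_compact isCompact_Icc
  have hAi : IntervalIntegrable (fun t => w' t * ∑ k ∈ Finset.Icc 0 ⌊t⌋₊, c k)
      MeasureTheory.volume a b := by
    rw [intervalIntegrable_iff_integrableOn_Icc_of_le hab]
    exact integrableOn_mul_sum_Icc c ha (hw'.integrableOn_compact isCompact_Icc)
  have hMi : IntervalIntegrable (fun t => w' t * M t) MeasureTheory.volume a b :=
    ((hw'.mul hMc).mono hu.le).intervalIntegrable
  have hρi' : IntervalIntegrable (fun t => w' t * ρ t) MeasureTheory.volume a b :=
    ((hw'.mul hρc).mono hu.le).intervalIntegrable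
  have h1 := sum_mul_eq_sub_sub_integral_mul c ha hab
    (fun t ht => (hw t ht).differentiableAt) hdi
  rw [← intervalIntegral.integral_of_le hab, intervalIntegral.integral_congr
    (g := fun t => w' t * ∑ k ∈ Finset.Icc 0 ⌊t⌋₊, c k)
    (fun t ht => by simp only [hd t (hu.le ht)])] at h1
  have h2 := intervalIntegral.integral_mul_deriv_eq_deriv_mul (fun t ht => hw t (hu.le ht))
    (fun t ht => hM t (hu.le ht)) hwi hmi
  have h3 := intervalIntegral.integral_mul_deriv_eq_deriv_mul (fun t ht => hw t (hu.le ht))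
    (fun t ht => hρ t (hu.le ht)) hwi hρi
  have h4 : |(∫ t in a..b, w' t * ∑ k ∈ Finset.Icc 0 ⌊t⌋₊, c k) - ∫ t in a..b, w' t * M t| ≤
      -∫ t in a..b, w' t * ρ t := by
    rw [← intervalIntegral.integral_sub hAi hMi, ← intervalIntegral.integral_neg,
      ← Real.norm_eq_abs]
    refine intervalIntegral.norm_integral_le_of_norm_le hab
      (Filter.Eventually.of_forall fun t ht => ?_) hρi'.neg
    have ht' := Set.Ioc_subset_Icc_self ht
    rw [← mul_sub, norm_mul, Real.norm_eq_abs, Real.norm_eq_abs, abs_of_nonpos (hw'0 t ht'),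
      ← neg_mul]
    exact mul_le_mul_of_nonneg_left (hc t ht') (neg_nonneg.2 (hw'0 t ht'))
  have h5 := mul_le_mul_of_nonneg_left (hc a (Set.left_mem_Icc.2 hab))
    (hw0 a (Set.left_mem_Icc.2 hab))
  have h6 := mul_le_mul_of_nonneg_left (hc b (Set.right_mem_Icc.2 hab))
    (hw0 b (Set.right_mem_Icc.2 hab))
  rw [← abs_of_nonneg (hw0 a (Set.left_mem_Icc.2 hab)), ← abs_mul, mul_sub,
    abs_of_nonneg (hw0 a (Set.left_mem_Icc.2 hab))] at h5
  rw [← abs_of_nonneg (hw0 b (Set.right_mem_Icc.2 hab)), ← abs_mul, mul_sub,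
    abs_of_nonneg (hw0 b (Set.right_mem_Icc.2 hab))] at h6
  rw [abs_le] at h4 h5 h6 ⊢
  constructor <;> linarith [h4.1, h4.2, h5.1, h5.2, h6.1, h6.2]

/-- The sum of `log p / √p` over primes `p ≤ x`. -/
noncomputable def sumLogPrimeSqrt (x : ℝ) : ℝ :=
  ∑ n ∈ Finset.Icc 0 ⌊x⌋₊, if n.Prime then Real.log n / Real.sqrt n else 0

theorem exists_abs_sumVonMangoldtSqrt_sub_sumLogPrimeSqrt_le :
    ∃ C : ℝ, 0 < C ∧ ∀ x : ℝ, 1 ≤ x →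
      |sumVonMangoldtSqrt x - sumLogPrimeSqrt x| ≤ C * (1 + Real.log x) := by
  obtain ⟨C, hC⟩ := Chebyshev.psi_sub_theta_le_mul_sqrt
  set D := |C| + 1 with hD
  have hD0 : 0 < D := by positivity
  have hCD : C ≤ D := (le_abs_self C).trans (by linarith)
  set c : ℕ → ℝ := fun n =>
    ArithmeticFunction.vonMangoldt n - if n.Prime then Real.log n else 0 with hc
  refine ⟨2 * D, by positivity, fun x hx => ?_⟩
  have hsum : ∀ t : ℝ, ∑ k ∈ Finset.Icc 0 ⌊t⌋₊, c k = Chebyshev.psi t - Chebyshev.theta t := by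
    intro t
    rw [Chebyshev.psi_eq_sum_Icc, Chebyshev.theta_eq_sum_Icc, Finset.sum_filter,
      ← Finset.sum_sub_distrib]
  have hpos : ∀ t ∈ Set.Icc 1 x, (0 : ℝ) < t := fun t ht => one_pos.trans_le ht.1
  have key := abs_sum_mul_sub_integral_mul_le (c := c) (w := fun t => t ^ (-(1 / 2) : ℝ))
    (w' := fun t => -(1 / 2) * t ^ (-(1 / 2) - 1 : ℝ)) (M := fun _ => 0) (m := fun _ => 0)
    (ρ := fun t => D * t ^ (1 / 2 : ℝ)) (ρ' := fun t => D * ((1 / 2) * t ^ (1 / 2 - 1 : ℝ)))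
    zero_le_one hx
    (fun t ht => Real.hasDerivAt_rpow_const (Or.inl (hpos t ht).ne'))
    (continuousOn_const.mul (continuousOn_id.rpow_const fun t ht => Or.inl (hpos t ht).ne'))
    (fun t _ => hasDerivAt_const t _) continuousOn_const
    (fun t ht => (Real.hasDerivAt_rpow_const (Or.inl (hpos t ht).ne')).const_mul D)
    (continuousOn_const.mul (continuousOn_const.mul
      (continuousOn_id.rpow_const fun t ht => Or.inl (hpos t ht).ne')))
    (fun t ht => Real.rpow_nonneg (hpos t ht).le _)
    (fun t ht => by nlinarith [Real.rpow_nonneg (hpos t ht).le (-(1 / 2) - 1)])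
    (fun t ht => by
      rw [hsum, sub_zero, abs_of_nonneg (sub_nonneg.2 (Chebyshev.theta_le_psi t)),
        ← Real.sqrt_eq_rpow]
      exact (hC t).trans (by gcongr))
  have h_int : ∫ t in (1 : ℝ)..x, t ^ (-(1 / 2) : ℝ) * (D * ((1 / 2) * t ^ (1 / 2 - 1 : ℝ))) =
      D / 2 * Real.log x := by
    rw [intervalIntegral.integral_congr (g := fun t => D / 2 * (1 / t)),
      intervalIntegral.integral_const_mul, integral_one_div_of_pos one_pos (by linarith), div_one]
    intro t ht
    rw [Set.uIcc_of_le hx] at ht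
    have h0 := hpos t ht
    have : t ^ (-(1 / 2) : ℝ) * t ^ (1 / 2 - 1 : ℝ) = 1 / t := by
      rw [← Real.rpow_add h0, one_div t, ← Real.rpow_neg_one]
      norm_num
    simp only
    rw [← this]
    ring
  simp only [mul_zero, intervalIntegral.integral_zero, sub_zero, Real.one_rpow, mul_one, one_mul,
    h_int, Nat.floor_one] at key
  have heq : sumVonMangoldtSqrt x - sumLogPrimeSqrt x =
      ∑ k ∈ Finset.Ioc 1 ⌊x⌋₊, (k : ℝ) ^ (-(1 / 2) : ℝ) * c k := by
    rw [sumVonMangoldtSqrt, sumLogPrimeSqrt, ← Finset.sum_sub_distrib]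
    symm
    refine Finset.sum_subset_zero_on_sdiff (fun n hn => ?_) (fun n hn => ?_) (fun n hn => ?_)
    · rw [Finset.mem_Ioc] at hn
      exact Finset.mem_Icc.2 ⟨n.zero_le, hn.2⟩
    · have : n = 0 ∨ n = 1 := by
        rw [Finset.mem_sdiff, Finset.mem_Icc, Finset.mem_Ioc] at hn
        omega
      rcases this with rfl | rfl <;> simp [Nat.not_prime_zero, Nat.not_prime_one]
    · simp only [hc]
      rw [Real.rpow_neg (Nat.cast_nonneg n), ← Real.sqrt_eq_rpow]
      split_ifs <;> ring
  rw [heq]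
  have hl := Real.log_nonneg hx
  nlinarith

theorem RiemannHypothesis.exists_abs_sumLogPrimeSqrt_sub_le (hRH : RiemannHypothesis) :
    ∃ C : ℝ, 0 < C ∧ ∀ x : ℝ, 2 ≤ x →
      |sumLogPrimeSqrt x - 2 * Real.sqrt x| ≤ C * Real.log x ^ 2 := by
  obtain ⟨C, hC, h⟩ := hRH.exists_abs_sumVonMangoldtSqrt_sub_le
  obtain ⟨D, hD, h'⟩ := exists_abs_sumVonMangoldtSqrt_sub_sumLogPrimeSqrt_le
  refine ⟨C + 6 * D, by positivity, fun x hx => ?_⟩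
  have h1 := abs_le.1 (h x hx)
  have h2 := abs_le.1 (h' x (by linarith))
  have hl : (1 / 2 : ℝ) ≤ Real.log x :=
    (by linarith [Real.log_two_gt_d9] : (1 / 2 : ℝ) ≤ Real.log 2).trans
      (Real.log_le_log two_pos hx)
  have h3 : D * (1 + Real.log x) ≤ D * (6 * Real.log x ^ 2) := by
    gcongr
    nlinarith
  rw [abs_le]
  constructor <;> nlinarith [h1.1, h1.2, h2.1, h2.2]

theorem integrableOn_log_mul_exp_neg :
    MeasureTheory.IntegrableOn (fun t : ℝ => Real.log t * Real.exp (-t)) (Set.Ioi 0) := by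
  have h := (mellin_hasDerivAt_of_isBigO_rpow (E := ℂ) (f := fun t : ℝ => (Real.exp (-t) : ℂ))
    (a := 2) (b := 0) (s := 1) ?_ ?_ (by norm_num) ?_ (by norm_num)).1
  · rw [MellinConvergent] at h
    refine MeasureTheory.IntegrableOn.congr_fun (MeasureTheory.Integrable.re h) (fun t _ => ?_)
      measurableSet_Ioi
    simp [-Complex.ofReal_exp, -Complex.ofReal_neg, ← Complex.ofReal_mul]
  · refine (Continuous.continuousOn ?_).locallyIntegrableOn measurableSet_Ioi
    fun_prop
  · rw [← Asymptotics.isBigO_norm_left]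
    simp_rw [Complex.norm_real, Asymptotics.isBigO_norm_left]
    simpa only [neg_one_mul] using (isLittleO_exp_neg_mul_rpow_atTop zero_lt_one _).isBigO
  · refine Asymptotics.IsBigO.of_bound 1 ?_
    filter_upwards [self_mem_nhdsWithin] with t ht
    rw [Complex.norm_real, Real.norm_eq_abs, Real.abs_exp]
    simpa using (Set.mem_Ioi.1 ht).le

theorem integral_log_mul_exp_neg :
    ∫ t in Set.Ioi (0 : ℝ), Real.log t * Real.exp (-t) = -Real.eulerMascheroniConstant := by
  have h1 := Complex.hasDerivAt_GammaIntegral (s := 1) (by norm_num)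
  have h2 : HasDerivAt Complex.GammaIntegral (-Real.eulerMascheroniConstant : ℂ) 1 := by
    refine Complex.hasDerivAt_Gamma_one.congr_of_eventuallyEq ?_
    filter_upwards [(isOpen_lt continuous_const Complex.continuous_re).mem_nhds
      (show (0 : ℝ) < (1 : ℂ).re by norm_num)] with s hs
    exact (Complex.Gamma_eq_integral hs).symm
  have h3 := h1.unique h2
  have h4 : ∫ t in Set.Ioi (0 : ℝ), (t : ℂ) ^ ((1 : ℂ) - 1) * (Real.log t * Real.exp (-t)) =
      ((∫ t in Set.Ioi (0 : ℝ), Real.log t * Real.exp (-t) : ℝ) : ℂ) := by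
    rw [← integral_complex_ofReal]
    refine MeasureTheory.setIntegral_congr_fun measurableSet_Ioi fun t _ => ?_
    simp
  rw [h4] at h3
  exact_mod_cast h3

theorem integral_rpow_neg_div_log {s x y : ℝ} (hs : 1 < s) (hx : 1 < x) (hxy : x ≤ y) :
    ∫ v in x..y, v ^ (-s) / Real.log v =
      Real.exp (-((s - 1) * Real.log y)) * Real.log ((s - 1) * Real.log y) -
      Real.exp (-((s - 1) * Real.log x)) * Real.log ((s - 1) * Real.log x) +
      ∫ w in ((s - 1) * Real.log x)..((s - 1) * Real.log y), Real.log w * Real.exp (-w) := by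
  have hlx : 0 < Real.log x := Real.log_pos hx
  have hs1 : 0 < s - 1 := by linarith
  have hlxy : Real.log x ≤ Real.log y := Real.log_le_log (by linarith) hxy
  set a := (s - 1) * Real.log x with ha
  set b := (s - 1) * Real.log y with hb
  have ha0 : 0 < a := by positivity
  have hab : a ≤ b := by rw [ha, hb]; gcongr
  have hsub : ∫ v in x..y, v ^ (-s) / Real.log v = ∫ w in a..b, Real.exp (-w) * (1 / w) := by
    rw [hb, ha, ← intervalIntegral.integral_comp_mul_deriv' (a := x) (b := y)
      (f := fun v => (s - 1) * Real.log v) (f' := fun v => (s - 1) * (1 / v))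
      (g := fun w => Real.exp (-w) * (1 / w))]
    · refine intervalIntegral.integral_congr fun v hv => ?_
      rw [Set.uIcc_of_le hxy] at hv
      have hv0 : 0 < v := by linarith [hv.1]
      have hlv : 0 < Real.log v := Real.log_pos (by linarith [hv.1])
      have : v ^ (-s) = Real.exp (-((s - 1) * Real.log v)) * (1 / v) := by
        rw [Real.rpow_def_of_pos hv0, one_div, ← Real.exp_log (inv_pos.2 hv0), Real.log_inv,
          ← Real.exp_add]
        congr 1
        ring
      simp only [Function.comp]
      rw [this]
      field_simp
    · intro v hv
      rw [Set.uIcc_of_le hxy] at hv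
      simpa using (Real.hasDerivAt_log (by linarith [hv.1] : v ≠ 0)).const_mul (s - 1)
    · refine continuousOn_const.mul (continuousOn_const.div continuousOn_id fun v hv => ?_)
      rw [Set.uIcc_of_le hxy] at hv
      exact ne_of_gt (by linarith [hv.1])
    · refine ContinuousOn.mul (by fun_prop) (continuousOn_const.div continuousOn_id ?_)
      rintro _ ⟨v, hv, rfl⟩
      rw [Set.uIcc_of_le hxy] at hv
      have hlv : 0 < Real.log v := Real.log_pos (by linarith [hv.1])
      positivity
  have hpos : ∀ w ∈ Set.uIcc a b, w ≠ 0 := fun w hw => by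
    rw [Set.uIcc_of_le hab] at hw
    linarith [hw.1]
  have hparts := intervalIntegral.integral_mul_deriv_eq_deriv_mul
    (u := fun w => Real.exp (-w)) (u' := fun w => -Real.exp (-w)) (v := Real.log)
    (v' := fun w => 1 / w) (a := a) (b := b)
    (fun w _ => by simpa using (hasDerivAt_neg w).exp)
    (fun w hw => by simpa using Real.hasDerivAt_log (hpos w hw))
    (Continuous.intervalIntegrable (by fun_prop) _ _)
    (ContinuousOn.intervalIntegrable (continuousOn_const.div continuousOn_id hpos))
  rw [hsub, hparts, sub_eq_add_neg _ (∫ w in a..b, _), ← intervalIntegral.integral_neg]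
  congr 2
  ext w
  ring

theorem tendsto_exp_neg_mul_log_atTop :
    Tendsto (fun b : ℝ => Real.exp (-b) * Real.log b) atTop (nhds 0) := by
  have h := Real.tendsto_pow_mul_exp_neg_atTop_nhds_zero 1
  refine squeeze_zero' ?_ ?_ h
  · filter_upwards [eventually_ge_atTop 1] with b hb
    exact mul_nonneg (Real.exp_pos _).le (Real.log_nonneg hb)
  · filter_upwards [eventually_ge_atTop 1] with b hb
    rw [pow_one, mul_comm]
    gcongr
    exact Real.log_le_self (by linarith)

theorem tendsto_integral_rpow_neg_div_log {s x : ℝ} (hs : 1 < s) (hx : 1 < x) :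
    Tendsto (fun N : ℕ => ∫ v in x..N, v ^ (-s) / Real.log v) atTop
      (nhds (-(Real.exp (-((s - 1) * Real.log x)) * Real.log ((s - 1) * Real.log x)) +
        ∫ w in Set.Ioi ((s - 1) * Real.log x), Real.log w * Real.exp (-w))) := by
  have hs1 : 0 < s - 1 := by linarith
  have hlx : 0 < Real.log x := Real.log_pos hx
  have hb : Tendsto (fun N : ℕ => (s - 1) * Real.log N) atTop atTop :=
    (Real.tendsto_log_atTop.comp tendsto_natCast_atTop_atTop).const_mul_atTop hs1
  have h1 := tendsto_exp_neg_mul_log_atTop.comp hb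
  have h2 := MeasureTheory.intervalIntegral_tendsto_integral_Ioi ((s - 1) * Real.log x)
    (integrableOn_log_mul_exp_neg.mono_set (Set.Ioi_subset_Ioi (by positivity))) hb
  have h3 := (h1.sub_const
    (Real.exp (-((s - 1) * Real.log x)) * Real.log ((s - 1) * Real.log x))).add h2
  rw [zero_sub] at h3
  refine h3.congr' ?_
  filter_upwards [eventually_ge_atTop ⌈x⌉₊] with N hN
  rw [integral_rpow_neg_div_log hs hx (Nat.ceil_le.1 hN)]
  rfl

theorem tendsto_integral_Ioi_log_mul_exp_neg :
    Tendsto (fun a : ℝ => ∫ w in Set.Ioi a, Real.log w * Real.exp (-w)) (nhdsWithin 0 (Set.Ioi 0))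
      (nhds (-Real.eulerMascheroniConstant)) := by
  have hc : MeasureTheory.AECover (MeasureTheory.volume.restrict (Set.Ioi (0 : ℝ)))
      (nhdsWithin (0 : ℝ) (Set.Ioi 0)) (fun a => Set.Ioi a) :=
    MeasureTheory.aecover_Ioi_of_Ioi (tendsto_id.mono_left nhdsWithin_le_nhds)
  have h := hc.integral_tendsto_of_countably_generated integrableOn_log_mul_exp_neg
  rw [integral_log_mul_exp_neg] at h
  refine h.congr' ?_
  filter_upwards [self_mem_nhdsWithin] with a ha
  rw [MeasureTheory.Measure.restrict_restrict measurableSet_Ioi,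
    Set.inter_eq_left.2 (Set.Ioi_subset_Ioi (Set.mem_Ioi.1 ha).le)]

theorem tendsto_exponential_integral_add_log :
    Tendsto (fun a : ℝ => -(Real.exp (-a) * Real.log a) +
        (∫ w in Set.Ioi a, Real.log w * Real.exp (-w)) + Real.log a)
      (nhdsWithin 0 (Set.Ioi 0)) (nhds (-Real.eulerMascheroniConstant)) := by
  have h1 : Tendsto (fun a : ℝ => (1 - Real.exp (-a)) * Real.log a)
      (nhdsWithin 0 (Set.Ioi 0)) (nhds 0) := by
    have h2 : Tendsto (fun a : ℝ => |a * Real.log a|) (nhdsWithin 0 (Set.Ioi 0)) (nhds 0) := by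
      have := (Real.continuous_mul_log.abs.tendsto 0).mono_left
        (nhdsWithin_le_nhds (s := Set.Ioi 0))
      simpa using this
    refine squeeze_zero_norm' ?_ h2
    filter_upwards [self_mem_nhdsWithin] with a ha
    rw [norm_mul, abs_mul, Real.norm_eq_abs, Real.norm_eq_abs, abs_of_pos (Set.mem_Ioi.1 ha)]
    gcongr
    rw [abs_of_nonneg (by simpa using (Set.mem_Ioi.1 ha).le)]
    linarith [Real.add_one_le_exp (-a)]
  have h3 := h1.add tendsto_integral_Ioi_log_mul_exp_neg
  rw [zero_add] at h3
  refine h3.congr fun a => ?_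
  ring

theorem abs_neg_log_one_sub_sub_le {q : ℝ} (hq : 0 ≤ q) (hq' : q ≤ 1 / 2) :
    |-Real.log (1 - q) - q| ≤ 2 * q ^ 2 := by
  have h := Real.abs_log_sub_add_sum_range_le (x := q) (by rw [abs_of_nonneg hq]; linarith) 1
  rw [abs_of_nonneg hq] at h
  simp only [Finset.sum_range_one, zero_add, pow_one, Nat.cast_zero, div_one] at h
  rw [← abs_neg, show -(-Real.log (1 - q) - q) = q + Real.log (1 - q) by ring]
  refine h.trans ?_
  rw [div_le_iff₀ (by linarith), one_add_one_eq_two]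
  nlinarith [mul_nonneg (sq_nonneg q) (by linarith : 0 ≤ 1 - 2 * q)]

theorem RiemannHypothesis.exists_abs_sum_prime_rpow_sub_le (hRH : RiemannHypothesis) :
    ∃ C : ℝ, 0 < C ∧ ∀ (x s : ℝ) (N : ℕ), 2 ≤ x → 1 < s → x ≤ N →
      |(∑ n ∈ Finset.Ioc ⌊x⌋₊ N, if n.Prime then (n : ℝ) ^ (-s) else 0) -
        ∫ v in x..N, v ^ (-s) / Real.log v| ≤ C * (Real.log x / Real.sqrt x) := by
  obtain ⟨C, hC, h⟩ := hRH.exists_abs_sumLogPrimeSqrt_sub_le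
  refine ⟨10 * C, by positivity, fun x s N hx hs hxN => ?_⟩
  have hpos : ∀ t ∈ Set.Icc x (N : ℝ), (0 : ℝ) < t := fun t ht => by linarith [ht.1]
  have hlog : ∀ t ∈ Set.Icc x (N : ℝ), (0 : ℝ) < Real.log t := fun t ht =>
    Real.log_pos (by linarith [ht.1])
  have hrc : ∀ r : ℝ, ContinuousOn (fun t : ℝ => t ^ r) (Set.Icc x (N : ℝ)) := fun r =>
    continuousOn_id.rpow_const fun t ht => Or.inl (hpos t ht).ne'
  have hlc : ContinuousOn Real.log (Set.Icc x (N : ℝ)) :=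
    continuousOn_id.log fun t ht => (hpos t ht).ne'
  have hic : ContinuousOn (fun t : ℝ => t⁻¹) (Set.Icc x (N : ℝ)) :=
    continuousOn_id.inv₀ fun t ht => (hpos t ht).ne'
  have key := abs_sum_mul_sub_integral_mul_le (a := x) (b := N)
    (c := fun n => if n.Prime then Real.log n / Real.sqrt n else 0)
    (w := fun t => t ^ (1 / 2 - s) / Real.log t)
    (w' := fun t => ((1 / 2 - s) * t ^ (1 / 2 - s - 1) * Real.log t -
      t ^ (1 / 2 - s) * t⁻¹) / Real.log t ^ 2)
    (M := fun t => 2 * t ^ (1 / 2 : ℝ)) (m := fun t => 2 * ((1 / 2) * t ^ (1 / 2 - 1 : ℝ)))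
    (ρ := fun t => C * Real.log t ^ 2) (ρ' := fun t => C * (2 * Real.log t * t⁻¹))
    (by linarith) hxN
    (fun t ht => (Real.hasDerivAt_rpow_const (Or.inl (hpos t ht).ne')).div
      (Real.hasDerivAt_log (hpos t ht).ne') (hlog t ht).ne')
    ((((continuousOn_const.mul (hrc _)).mul hlc).sub ((hrc _).mul hic)).div (hlc.pow 2)
      fun t ht => (pow_pos (hlog t ht) 2).ne')
    (fun t ht => (Real.hasDerivAt_rpow_const (Or.inl (hpos t ht).ne')).const_mul 2)
    (continuousOn_const.mul (continuousOn_const.mul (hrc _)))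
    (fun t ht => by
      simpa using ((Real.hasDerivAt_log (hpos t ht).ne').pow 2).const_mul C)
    (continuousOn_const.mul ((continuousOn_const.mul hlc).mul hic))
    (fun t ht => div_nonneg (Real.rpow_nonneg (hpos t ht).le _) (hlog t ht).le)
    (fun t ht => by
      refine div_nonpos_of_nonpos_of_nonneg (sub_nonpos.2 (le_trans (b := 0) ?_ ?_))
        (sq_nonneg _)
      · exact mul_nonpos_of_nonpos_of_nonneg (mul_nonpos_of_nonpos_of_nonneg (by linarith)
          (Real.rpow_nonneg (hpos t ht).le _)) (hlog t ht).le
      · exact mul_nonneg (Real.rpow_nonneg (hpos t ht).le _) (inv_nonneg.2 (hpos t ht).le))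
    (fun t ht => by
      rw [← Real.sqrt_eq_rpow]
      exact h t (hx.trans ht.1))
  have hxx : x ∈ Set.Icc x (N : ℝ) := Set.left_mem_Icc.2 hxN
  have hx0 := hpos x hxx
  have hlx := hlog x hxx
  have hsx : 0 < Real.sqrt x := Real.sqrt_pos.2 hx0
  have hsqrt : (x : ℝ) ^ (-(1 / 2) : ℝ) = 1 / Real.sqrt x := by
    rw [Real.rpow_neg hx0.le, ← Real.sqrt_eq_rpow, one_div]
  have hw : ∀ t ∈ Set.Icc x (N : ℝ), t ^ (1 / 2 - s) ≤ t ^ (-(1 / 2) : ℝ) := fun t ht =>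
    Real.rpow_le_rpow_of_exponent_le (by linarith [ht.1]) (by linarith)
  have e1 : x ^ (1 / 2 - s) / Real.log x * (C * Real.log x ^ 2) ≤
      C * (Real.log x / Real.sqrt x) := by
    calc x ^ (1 / 2 - s) / Real.log x * (C * Real.log x ^ 2)
        = C * (Real.log x * x ^ (1 / 2 - s)) := by field_simp
      _ ≤ C * (Real.log x * x ^ (-(1 / 2) : ℝ)) := by
        exact mul_le_mul_of_nonneg_left (mul_le_mul_of_nonneg_left (hw x hxx) hlx.le) hC.le
      _ = _ := by rw [hsqrt]; ring
  have e2 : ∫ t in x..N, t ^ (1 / 2 - s) / Real.log t * (C * (2 * Real.log t * t⁻¹)) ≤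
      4 * C / Real.sqrt x := by
    have hmono : ∫ t in x..N, t ^ (1 / 2 - s) / Real.log t * (C * (2 * Real.log t * t⁻¹)) ≤
        ∫ t in x..N, 2 * C * t ^ (-(3 / 2) : ℝ) := by
      refine intervalIntegral.integral_mono_on hxN
        (ContinuousOn.intervalIntegrable ?_) (ContinuousOn.intervalIntegrable ?_) fun t ht => ?_
      · rw [Set.uIcc_of_le hxN]
        exact ((hrc _).div hlc fun t ht => (hlog t ht).ne').mul
          (continuousOn_const.mul ((continuousOn_const.mul hlc).mul hic))
      · rw [Set.uIcc_of_le hxN]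
        exact continuousOn_const.mul (hrc _)
      · have hl := hlog t ht
        have ht0 := hpos t ht
        calc t ^ (1 / 2 - s) / Real.log t * (C * (2 * Real.log t * t⁻¹))
            = 2 * C * (t ^ (1 / 2 - s) * t⁻¹) := by field_simp
          _ ≤ 2 * C * (t ^ (-(1 / 2) : ℝ) * t⁻¹) := by
            exact mul_le_mul_of_nonneg_left
              (mul_le_mul_of_nonneg_right (hw t ht) (inv_nonneg.2 ht0.le)) (by positivity)
          _ = _ := by
            rw [← Real.rpow_neg_one, ← Real.rpow_add ht0]
            norm_num
    refine hmono.trans ?_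
    have hN0 : (0 : ℝ) ≤ (N : ℝ) ^ (-(1 / 2) : ℝ) := by positivity
    rw [intervalIntegral.integral_const_mul, integral_rpow
      (Or.inr ⟨by norm_num, fun h0 => by
        rw [Set.uIcc_of_le hxN] at h0
        exact (hpos 0 h0).ne rfl⟩), show (-(3 / 2) + 1 : ℝ) = -(1 / 2) by norm_num, hsqrt]
    have : 4 * C / Real.sqrt x = 2 * C * (2 * (1 / Real.sqrt x)) := by ring
    rw [this]
    gcongr
    linarith
  have e3 : ∑ n ∈ Finset.Ioc ⌊x⌋₊ ⌊(N : ℝ)⌋₊, (n : ℝ) ^ (1 / 2 - s) / Real.log n *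
        (if n.Prime then Real.log n / Real.sqrt n else 0) =
      ∑ n ∈ Finset.Ioc ⌊x⌋₊ N, if n.Prime then (n : ℝ) ^ (-s) else 0 := by
    rw [Nat.floor_natCast]
    refine Finset.sum_congr rfl fun n _ => ?_
    split_ifs with hp
    · have hn0 : (0 : ℝ) < n := by exact_mod_cast hp.pos
      have hn1 : (0 : ℝ) < Real.log n := Real.log_pos (by exact_mod_cast hp.one_lt)
      have : (n : ℝ) ^ (1 / 2 - s) = (n : ℝ) ^ (-s) * Real.sqrt n := by
        rw [Real.sqrt_eq_rpow, ← Real.rpow_add hn0]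
        congr 1
        ring
      have hsn : 0 < Real.sqrt n := Real.sqrt_pos.2 hn0
      rw [this]
      field_simp
    · simp
  have e4 : ∫ t in x..N, t ^ (1 / 2 - s) / Real.log t * (2 * ((1 / 2) * t ^ (1 / 2 - 1 : ℝ))) =
      ∫ t in x..N, t ^ (-s) / Real.log t := by
    refine intervalIntegral.integral_congr fun t ht => ?_
    rw [Set.uIcc_of_le hxN] at ht
    have : t ^ (-s) = t ^ (1 / 2 - s) * t ^ (1 / 2 - 1 : ℝ) := by
      rw [← Real.rpow_add (hpos t ht)]
      congr 1
      ring
    rw [this]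
    ring
  rw [e3, e4] at key
  have hl2 : (1 / 2 : ℝ) ≤ Real.log x :=
    (by linarith [Real.log_two_gt_d9] : (1 / 2 : ℝ) ≤ Real.log 2).trans
      (Real.log_le_log two_pos hx)
  have e5 : 4 * C / Real.sqrt x ≤ 8 * C * (Real.log x / Real.sqrt x) := by
    rw [mul_div_assoc', div_le_div_iff_of_pos_right hsx]
    nlinarith
  linarith

theorem abs_sum_neg_log_sub_sum_le {x s : ℝ} (N : ℕ) (hx : 2 ≤ x) (hs : 1 < s) (hN : x ≤ N) :
    |(∑ n ∈ Finset.Ioc ⌊x⌋₊ N, if n.Prime then -Real.log (1 - (n : ℝ) ^ (-s)) else 0) -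
      ∑ n ∈ Finset.Ioc ⌊x⌋₊ N, if n.Prime then (n : ℝ) ^ (-s) else 0| ≤
        8 * (Real.log x / Real.sqrt x) := by
  have hfl : 2 ≤ ⌊x⌋₊ := Nat.le_floor (by exact_mod_cast hx)
  have hflN : ⌊x⌋₊ ≤ N := Nat.floor_le_of_le hN
  rw [← Finset.sum_sub_distrib]
  have h1 : ∀ n ∈ Finset.Ioc ⌊x⌋₊ N,
      |(if n.Prime then -Real.log (1 - (n : ℝ) ^ (-s)) else 0) -
        (if n.Prime then (n : ℝ) ^ (-s) else 0)| ≤ 2 * ((n : ℝ) ^ 2)⁻¹ := by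
    intro n hn
    have hn2 : (2 : ℝ) ≤ n := by
      exact_mod_cast hfl.trans (Finset.mem_Ioc.1 hn).1.le
    have hq0 : (0 : ℝ) ≤ (n : ℝ) ^ (-s) := by positivity
    have hq : (n : ℝ) ^ (-s) ≤ (n : ℝ)⁻¹ := by
      rw [← Real.rpow_neg_one]
      exact Real.rpow_le_rpow_of_exponent_le (by linarith) (by linarith)
    have hq2 : (n : ℝ)⁻¹ ≤ 1 / 2 := by
      rw [one_div]
      gcongr
    split_ifs
    · refine (abs_neg_log_one_sub_sub_le hq0 (hq.trans hq2)).trans ?_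
      rw [← inv_pow]
      gcongr
    · simp
  refine (Finset.abs_sum_le_sum_abs _ _).trans ((Finset.sum_le_sum h1).trans ?_)
  rw [← Finset.mul_sum]
  have h2 := sum_Ioc_inv_sq_le_sub (α := ℝ) (k := ⌊x⌋₊) (n := N) (by omega) hflN
  have h3 : (0 : ℝ) ≤ (N : ℝ)⁻¹ := by positivity
  have h4 : (⌊x⌋₊ : ℝ)⁻¹ ≤ 2 / x := by
    have := Nat.lt_floor_add_one x
    have h2' : (2 : ℝ) ≤ ⌊x⌋₊ := by exact_mod_cast hfl
    rw [← inv_div]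
    exact inv_anti₀ (by linarith) (by linarith)
  have hx0 : 0 < x := by linarith
  have hsx : 0 < Real.sqrt x := Real.sqrt_pos.2 hx0
  have hl2 : (1 / 2 : ℝ) ≤ Real.log x :=
    (by linarith [Real.log_two_gt_d9] : (1 / 2 : ℝ) ≤ Real.log 2).trans
      (Real.log_le_log two_pos hx)
  have h5 : 2 / x ≤ 4 * (Real.log x / Real.sqrt x) := by
    rw [mul_div_assoc', div_le_div_iff₀ hx0 hsx]
    have : Real.sqrt x ≤ x := Real.sqrt_le_self_iff.2 (Or.inr (by linarith))
    nlinarith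
  linarith

theorem tendsto_sum_neg_log_one_sub_rpow {s : ℝ} (hs : 1 < s) :
    Tendsto (fun N : ℕ => ∑ n ∈ Finset.Icc 0 N,
      if n.Prime then -Real.log (1 - (n : ℝ) ^ (-s)) else 0) atTop
      (nhds (Real.log (riemannZeta s).re)) := by
  have h := (Complex.continuous_re.tendsto _).comp
    ((riemannZeta_eulerProduct (s := s) (by simpa using hs)).comp (tendsto_add_atTop_nat 1))
  have h2 := (Real.continuousAt_log (riemannZeta_re_pos_of_one_lt hs).ne').tendsto.comp h
  refine h2.congr fun N => ?_
  have h3 : ∏ p ∈ Nat.primesBelow (N + 1), (1 - (p : ℂ) ^ (-(s : ℂ)))⁻¹ =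
      ((∏ p ∈ Nat.primesBelow (N + 1), (1 - (p : ℝ) ^ (-s))⁻¹ : ℝ) : ℂ) := by
    push_cast
    refine Finset.prod_congr rfl fun p _ => ?_
    rw [Complex.ofReal_cpow (Nat.cast_nonneg p)]
    simp
  simp only [Function.comp]
  rw [h3, Complex.ofReal_re, Real.log_prod, Nat.primesBelow, Finset.sum_filter,
    Nat.range_succ_eq_Icc_zero]
  · simp only [Real.log_inv]
  · intro p hp
    have hp' := Nat.prime_of_mem_primesBelow hp
    have : (p : ℝ) ^ (-s) < 1 :=
      Real.rpow_lt_one_of_one_lt_of_neg (by exact_mod_cast hp'.one_lt) (by linarith)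
    exact inv_ne_zero (by linarith)

theorem tendsto_sum_neg_log_one_sub_rpow_one (x : ℝ) :
    Tendsto (fun s : ℝ => ∑ n ∈ Finset.Icc 0 ⌊x⌋₊,
      if n.Prime then -Real.log (1 - (n : ℝ) ^ (-s)) else 0) (nhdsWithin 1 (Set.Ioi 1))
      (nhds (Real.log (mertensProd x))) := by
  have h : Real.log (mertensProd x) = ∑ n ∈ Finset.Icc 0 ⌊x⌋₊,
      if n.Prime then -Real.log (1 - (n : ℝ) ^ (-1 : ℝ)) else 0 := by
    rw [mertensProd, Real.log_prod, Finset.sum_filter]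
    · refine Finset.sum_congr rfl fun n _ => ?_
      rw [Real.log_inv, Real.rpow_neg_one, one_div]
    · intro p hp
      have hp' : (2 : ℝ) ≤ p := by exact_mod_cast (Finset.mem_filter.1 hp).2.two_le
      have : 1 / (p : ℝ) ≤ 1 / 2 := by gcongr
      exact inv_ne_zero (by linarith)
  rw [h]
  refine tendsto_finsetSum _ fun n _ => ?_
  split_ifs with hp
  · have hn : (1 : ℝ) < n := by exact_mod_cast hp.one_lt
    have h1 : (n : ℝ) ^ (-1 : ℝ) < 1 := Real.rpow_lt_one_of_one_lt_of_neg hn (by norm_num)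
    have h2 : ContinuousAt (fun s : ℝ => -Real.log (1 - (n : ℝ) ^ (-s))) 1 :=
      ((continuousAt_const.sub (continuousAt_const.rpow continuousAt_neg
        (Or.inl (by linarith)))).log (by simpa using (sub_pos.2 h1).ne')).neg
    exact h2.tendsto.mono_left nhdsWithin_le_nhds
  · exact tendsto_const_nhds

/-- Mertens' third theorem with the error term `O(log x / √x)`, under RH. -/
theorem RiemannHypothesis.exists_abs_log_mertensProd_sub_le (hRH : RiemannHypothesis) :
    ∃ C : ℝ, 0 < C ∧ ∀ x : ℝ, 2 ≤ x →
      |Real.log (mertensProd x) - Real.log (Real.log x) - Real.eulerMascheroniConstant| ≤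
        C * (Real.log x / Real.sqrt x) := by
  obtain ⟨C, hC, h⟩ := hRH.exists_abs_sum_prime_rpow_sub_le
  refine ⟨C + 8, by positivity, fun x hx => ?_⟩
  have hlx : 0 < Real.log x := Real.log_pos (by linarith)
  set T : ℝ → ℕ → ℝ := fun s N => ∑ n ∈ Finset.Icc 0 N,
      if n.Prime then -Real.log (1 - (n : ℝ) ^ (-s)) else 0 with hT
  set E : ℝ → ℝ := fun a => -(Real.exp (-a) * Real.log a) +
    ∫ w in Set.Ioi a, Real.log w * Real.exp (-w) with hE
  have h1 : ∀ s : ℝ, 1 < s → |Real.log (riemannZeta s).re - T s ⌊x⌋₊ - E ((s - 1) * Real.log x)| ≤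
      (C + 8) * (Real.log x / Real.sqrt x) := by
    intro s hs
    have ht := (((tendsto_sum_neg_log_one_sub_rpow hs).sub_const (T s ⌊x⌋₊)).sub
      (tendsto_integral_rpow_neg_div_log hs (by linarith : 1 < x))).abs
    refine le_of_tendsto ht ?_
    filter_upwards [eventually_ge_atTop ⌈x⌉₊] with N hN
    have hxN := Nat.ceil_le.1 hN
    have e1 := abs_le.1 (h x s N hx hs hxN)
    have e2 := abs_le.1 (abs_sum_neg_log_sub_sum_le N hx hs hxN)
    have e3 : T s N - T s ⌊x⌋₊ =
        ∑ n ∈ Finset.Ioc ⌊x⌋₊ N, if n.Prime then -Real.log (1 - (n : ℝ) ^ (-s)) else 0 := by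
      rw [sub_eq_iff_eq_add, add_comm]
      simp only [hT, ← Nat.range_succ_eq_Icc_zero, Finset.range_eq_Ico]
      rw [← Finset.Ico_add_one_add_one_eq_Ioc]
      exact (Finset.sum_Ico_consecutive _ (Nat.zero_le _)
        (Nat.succ_le_succ (Nat.floor_le_of_le hxN))).symm
    change |T s N - T s ⌊x⌋₊ - _| ≤ _
    rw [e3, abs_le]
    constructor <;> linarith [e1.1, e1.2, e2.1, e2.2]
  have hz := (Asymptotics.isLittleO_one_iff ℝ).1 log_riemannZeta_add_log_sub_isLittleO_ofReal
  have ha : Tendsto (fun s : ℝ => (s - 1) * Real.log x) (nhdsWithin 1 (Set.Ioi 1))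
      (nhdsWithin 0 (Set.Ioi 0)) := by
    refine tendsto_nhdsWithin_iff.2 ⟨?_, ?_⟩
    · have : ContinuousAt (fun s : ℝ => (s - 1) * Real.log x) 1 := by fun_prop
      have := this.tendsto
      rw [sub_self, zero_mul] at this
      exact this.mono_left nhdsWithin_le_nhds
    · filter_upwards [self_mem_nhdsWithin] with s hs
      exact mul_pos (sub_pos.2 hs) hlx
  have he := tendsto_exponential_integral_add_log.comp ha
  have hlim := (((hz.sub (tendsto_sum_neg_log_one_sub_rpow_one x)).sub he).add_const
    (Real.log (Real.log x))).abs
  have h2 := le_of_tendsto hlim (b := (C + 8) * (Real.log x / Real.sqrt x)) ?_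
  · rw [← abs_neg]
    convert! h2 using 2
    ring
  · filter_upwards [self_mem_nhdsWithin] with s hs
    refine le_of_eq_of_le (congrArg _ ?_) (h1 s hs)
    simp only [Function.comp, hE, hT]
    rw [Real.log_mul (sub_pos.2 hs).ne' hlx.ne']
    ring

/-- Assuming RH, `E_M(x) ≪ (log x)²`. -/
theorem EM_le_log_sq (hRH : RiemannHypothesis) :
    ∃ C : ℝ, 0 < C ∧ ∀ x : ℝ, 5 ≤ x → |EM x| ≤ C * (Real.log x) ^ 2 := by
  obtain ⟨C, hC, h⟩ := hRH.exists_abs_log_mertensProd_sub_le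
  refine ⟨C, hC, fun x hx => ?_⟩
  have hlx : 0 < Real.log x := Real.log_pos (by linarith)
  have hsx : 0 < Real.sqrt x := Real.sqrt_pos.2 (by linarith)
  rw [EM, abs_mul, abs_of_pos (mul_pos hsx hlx)]
  refine (mul_le_mul_of_nonneg_left (h x (by linarith)) (mul_pos hsx hlx).le).trans_eq ?_
  field_simp
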